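/- arXiv:2004.01003 — 3 statements merged into one kernel-verified Lean document; each statement's English description precedes it below -/
import Mathlib

section
/- Let w(n) be an increasing sequence of positive real numbers with ∑_{n=1}^∞ 1/(n·w(n)) = ∞. Then there exist complex coefficients (a_n)_{n≥1} satisfying ∑_{n=1}^∞ |a_n|² w(n) < ∞ and a permutation σ of the positive integers such that the rearranged trigonometric series ∑_{n=1}^∞ a_{σ(n)} e^{2πi σ(n) x} diverges (its partial sums fail to converge) for almost every x ∈ 𝕋. -/
open MeasureTheory Filter

/-- The complex exponential `e^{2πinx}`. -/
noncomputable def trigChar (n : ℤ) (x : ℝ) : ℂ :=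
  Complex.exp (2 * Real.pi * Complex.I * n * x)

noncomputable def mu01 : Measure ℝ := volume.restrict (Set.Ioc (0:ℝ) 1)

instance : IsProbabilityMeasure mu01 := ⟨by simp [mu01]⟩

lemma tc_add (m n : ℤ) (x : ℝ) : trigChar (m + n) x = trigChar m x * trigChar n x := by
  simp only [trigChar, ← Complex.exp_add]; congr 1; push_cast; ring

lemma tc_zero (x : ℝ) : trigChar 0 x = 1 := by simp [trigChar]

lemma tc_form (n : ℤ) (x : ℝ) : trigChar n x = Complex.exp (((2 * Real.pi * n * x : ℝ) : ℂ) * Complex.I) := by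
  simp only [trigChar]; congr 1; push_cast; ring

lemma tc_norm (n : ℤ) (x : ℝ) : ‖trigChar n x‖ = 1 := by
  rw [tc_form, Complex.norm_exp_ofReal_mul_I]

lemma tc_conj (n : ℤ) (x : ℝ) : (starRingEnd ℂ) (trigChar n x) = trigChar (-n) x := by
  simp only [trigChar, ← Complex.exp_conj]; congr 1; simp [Complex.conj_ofNat]

lemma tc_cont (n : ℤ) : Continuous (trigChar n) := by
  unfold trigChar; fun_prop

lemma tc_im (n : ℤ) (x : ℝ) : (trigChar n x).im = Real.sin (2 * Real.pi * n * x) := by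
  rw [tc_form, Complex.exp_ofReal_mul_I_im]

lemma tc_re (n : ℤ) (x : ℝ) : (trigChar n x).re = Real.cos (2 * Real.pi * n * x) := by
  rw [tc_form, Complex.exp_ofReal_mul_I_re]

lemma tc_int_eq (n : ℤ) (a b : ℝ) (hn : n ≠ 0) : ∫ x in a..b, trigChar n x
    = (trigChar n b - trigChar n a) / (2 * Real.pi * Complex.I * n) := by
  have hc : (2 * Real.pi * Complex.I * n : ℂ) ≠ 0 := by
    simp [Real.pi_ne_zero, hn]
  have := integral_exp_mul_complex (a := a) (b := b) hc
  simpa [trigChar] using this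

lemma tc_one (n : ℤ) : trigChar n 1 = 1 := by
  rw [trigChar]
  rw [Complex.exp_eq_one_iff]
  exact ⟨n, by push_cast; ring⟩

lemma tc_int (n : ℤ) : ∫ x, trigChar n x ∂mu01 = if n = 0 then 1 else 0 := by
  unfold mu01
  rw [← intervalIntegral.integral_of_le zero_le_one]
  split_ifs with h
  · subst h; simp [tc_zero]
  · rw [tc_int_eq n 0 1 h, tc_one]; simp [trigChar]

/-- bounded measurable -/
def BM (f : ℝ → ℂ) : Prop := Measurable f ∧ ∃ C : ℝ, ∀ x, ‖f x‖ ≤ C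

lemma BM.integrable {f : ℝ → ℂ} (h : BM f) : Integrable f mu01 := by
  obtain ⟨hm, C, hC⟩ := h
  exact Integrable.of_bound hm.aestronglyMeasurable C (Eventually.of_forall hC)

lemma BM.tc (n : ℤ) : BM (trigChar n) := ⟨(tc_cont n).measurable, 1, fun x => (tc_norm n x).le⟩

lemma BM.const (c : ℂ) : BM (fun _ => c) := ⟨measurable_const, ‖c‖, fun _ => le_rfl⟩

lemma BM.mul {f g : ℝ → ℂ} (hf : BM f) (hg : BM g) : BM (fun x => f x * g x) := by
  obtain ⟨hm, C, hC⟩ := hf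
  obtain ⟨hm', C', hC'⟩ := hg
  refine ⟨hm.mul hm', C * C', fun x => ?_⟩
  rw [norm_mul]
  exact mul_le_mul (hC x) (hC' x) (norm_nonneg _) ((norm_nonneg _).trans (hC x))

lemma BM.add {f g : ℝ → ℂ} (hf : BM f) (hg : BM g) : BM (fun x => f x + g x) := by
  obtain ⟨hm, C, hC⟩ := hf
  obtain ⟨hm', C', hC'⟩ := hg
  exact ⟨hm.add hm', C + C', fun x => (norm_add_le _ _).trans (add_le_add (hC x) (hC' x))⟩

lemma BM.sub {f g : ℝ → ℂ} (hf : BM f) (hg : BM g) : BM (fun x => f x - g x) := by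
  obtain ⟨hm, C, hC⟩ := hf
  obtain ⟨hm', C', hC'⟩ := hg
  exact ⟨hm.sub hm', C + C', fun x => (norm_sub_le _ _).trans (add_le_add (hC x) (hC' x))⟩

lemma BM.star {f : ℝ → ℂ} (hf : BM f) : BM (fun x => (starRingEnd ℂ) (f x)) := by
  obtain ⟨hm, C, hC⟩ := hf
  exact ⟨Complex.continuous_conj.measurable.comp hm, C, fun x => by simpa using hC x⟩

lemma BM.sum {ι : Type*} (s : Finset ι) {f : ι → ℝ → ℂ} (hf : ∀ i ∈ s, BM (f i)) :
    BM (fun x => ∑ i ∈ s, f i x) := by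
  classical
  induction s using Finset.induction_on with
  | empty => simpa using BM.const 0
  | insert a s ha ih =>
    simp only [Finset.sum_insert ha]
    exact (hf a (by simp)).add (ih fun i hi => hf i (by simp [hi]))

lemma BM.ite {f g : ℝ → ℂ} (hf : BM f) (hg : BM g) {p : ℝ → Prop} [DecidablePred p]
    (hp : MeasurableSet {x | p x}) : BM (fun x => if p x then f x else g x) := by
  obtain ⟨hm, C, hC⟩ := hf
  obtain ⟨hm', C', hC'⟩ := hg
  refine ⟨Measurable.ite hp hm hm', max C C', fun x => ?_⟩
  dsimp only
  split_ifs
  · exact (hC x).trans (le_max_left _ _)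
  · exact (hC' x).trans (le_max_right _ _)

lemma BM.sq {f : ℝ → ℂ} (h : BM f) : Integrable (fun x => ‖f x‖ ^ 2) mu01 := by
  have h2 := (h.mul h).integrable.norm
  refine h2.congr (Eventually.of_forall fun x => ?_)
  simp [pow_two]

lemma BM.nrm {f : ℝ → ℂ} (h : BM f) : Integrable (fun x => ‖f x‖) mu01 := h.integrable.norm

lemma nsq_sub (a b : ℂ) : ‖a - b‖ ^ 2 = ‖a‖ ^ 2 + ‖b‖ ^ 2 - 2 * (a * (starRingEnd ℂ) b).re := by
  have := Complex.normSq_sub a b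
  simpa [Complex.normSq_eq_norm_sq] using this

lemma nsq_add (a b : ℂ) : ‖a + b‖ ^ 2 = ‖a‖ ^ 2 + ‖b‖ ^ 2 + 2 * (a * (starRingEnd ℂ) b).re := by
  have := Complex.normSq_add a b
  simpa [Complex.normSq_eq_norm_sq] using this

lemma nsq_add_le (a b : ℂ) : ‖a + b‖ ^ 2 ≤ 2 * ‖a‖ ^ 2 + 2 * ‖b‖ ^ 2 := by
  have h1 := norm_add_le a b
  have : ‖a + b‖ ^ 2 ≤ (‖a‖ + ‖b‖) ^ 2 := pow_le_pow_left₀ (norm_nonneg _) h1 2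
  nlinarith [sq_nonneg (‖a‖ - ‖b‖)]

/-- Parseval, finite. -/
lemma parseval {ι : Type*} (I : Finset ι) (k : ι → ℤ) (d : ι → ℂ) (hk : Set.InjOn k I) :
    ∫ x, ‖∑ i ∈ I, d i * trigChar (k i) x‖ ^ 2 ∂mu01 = ∑ i ∈ I, ‖d i‖ ^ 2 := by
  classical
  have h1 : ((∫ x, ‖∑ i ∈ I, d i * trigChar (k i) x‖ ^ 2 ∂mu01 : ℝ) : ℂ)
      = ∑ i ∈ I, ((‖d i‖ ^ 2 : ℝ) : ℂ) := by
    rw [← integral_complex_ofReal]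
    have : ∀ x, ((‖∑ i ∈ I, d i * trigChar (k i) x‖ ^ 2 : ℝ) : ℂ)
        = ∑ i ∈ I, ∑ j ∈ I, (d i * (starRingEnd ℂ) (d j)) * trigChar (k i - k j) x := by
      intro x
      push_cast
      rw [← Complex.mul_conj', map_sum, Finset.sum_mul_sum]
      refine Finset.sum_congr rfl fun i _ => Finset.sum_congr rfl fun j _ => ?_
      rw [map_mul, tc_conj, sub_eq_add_neg, tc_add]; ring
    simp_rw [this]
    rw [integral_finsetSum]
    · refine Finset.sum_congr rfl fun i hi => ?_
      rw [integral_finsetSum]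
      · simp_rw [integral_const_mul, tc_int, sub_eq_zero]
        rw [Finset.sum_eq_single i]
        · simp [Complex.mul_conj']
        · intro j hj hji
          rw [if_neg]; · simp
          intro h; exact hji (hk hj hi h.symm)
        · intro h; exact absurd hi h
      · intro j _; exact ((BM.const _).mul (BM.tc _)).integrable
    · intro i _
      exact (BM.sum I fun j _ => (BM.const _).mul (BM.tc _)).integrable
  exact_mod_cast h1

/-- Projection identity. -/
lemma proj_id (F : Finset ℤ) {g : ℝ → ℂ} (hg : BM g) (c : ℤ → ℂ)
    (hc : ∀ n ∈ F, ∫ x, g x * trigChar (-n) x ∂mu01 = c n) :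
    ∫ x, ‖g x - ∑ n ∈ F, c n * trigChar n x‖ ^ 2 ∂mu01
      = ∫ x, ‖g x‖ ^ 2 ∂mu01 - ∑ n ∈ F, ‖c n‖ ^ 2 := by
  have hp : BM (fun x => ∑ n ∈ F, c n * trigChar n x) :=
    BM.sum F fun n _ => (BM.const _).mul (BM.tc _)
  simp_rw [nsq_sub]
  have hi := (hg.mul hp.star).integrable
  have e1 : ∫ x, (g x * (starRingEnd ℂ) (∑ n ∈ F, c n * trigChar n x)) ∂mu01
      = ∑ n ∈ F, ((‖c n‖ ^ 2 : ℝ) : ℂ) := by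
    have : ∀ x, g x * (starRingEnd ℂ) (∑ n ∈ F, c n * trigChar n x)
        = ∑ n ∈ F, (starRingEnd ℂ) (c n) * (g x * trigChar (-n) x) := by
      intro x
      rw [map_sum, Finset.mul_sum]
      refine Finset.sum_congr rfl fun n _ => ?_
      rw [map_mul, tc_conj]; ring
    simp_rw [this]
    rw [integral_finsetSum]
    · refine Finset.sum_congr rfl fun n hn => ?_
      rw [integral_const_mul, hc n hn, mul_comm, Complex.mul_conj']; simp
    · intro n _; exact ((BM.const _).mul (hg.mul (BM.tc _))).integrable
  have e2 : ∫ x, (g x * (starRingEnd ℂ) (∑ n ∈ F, c n * trigChar n x)).re ∂mu01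
      = ∑ n ∈ F, ‖c n‖ ^ 2 := by
    have := integral_re (𝕜 := ℂ) hi
    simp only [RCLike.re_eq_complex_re] at this
    rw [this, e1, ← Complex.ofReal_sum, Complex.ofReal_re]
  have hA : Integrable (fun x => ‖g x‖ ^ 2 + ‖∑ n ∈ F, c n * trigChar n x‖ ^ 2) mu01 :=
    hg.sq.add hp.sq
  have hB : Integrable (fun x => 2 * (g x * (starRingEnd ℂ) (∑ n ∈ F, c n * trigChar n x)).re)
    mu01 := (hi.re).const_mul 2
  rw [integral_sub hA hB, integral_add hg.sq hp.sq,
    integral_const_mul, e2, parseval F (fun n => n) c (by intro a _ b _ h; exact h)]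
  ring

lemma bessel (F : Finset ℤ) {g : ℝ → ℂ} (hg : BM g) :
    ∑ n ∈ F, ‖∫ x, g x * trigChar (-n) x ∂mu01‖ ^ 2 ≤ ∫ x, ‖g x‖ ^ 2 ∂mu01 := by
  have := proj_id F hg (fun n => ∫ x, g x * trigChar (-n) x ∂mu01) (fun _ _ => rfl)
  have h2 : 0 ≤ ∫ x, ‖g x - ∑ n ∈ F, (∫ x, g x * trigChar (-n) x ∂mu01) * trigChar n x‖ ^ 2 ∂mu01 :=
    integral_nonneg fun _ => by positivity
  linarith

/-- number of large Fourier coefficients -/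
lemma count_large {g : ℝ → ℂ} (hg : BM g) {X κ : ℝ} (hX : ∀ x, ‖g x‖ ≤ X) (hκ : 0 < κ)
    (k : ℤ) (hk : k ≠ 0) (F : Finset ℕ)
    (hF : ∀ M ∈ F, κ < ‖∫ x, g x * trigChar (k * M) x ∂mu01‖) : (F.card : ℝ) ≤ X ^ 2 / κ ^ 2 := by
  classical
  have hX0 : 0 ≤ X := (norm_nonneg _).trans (hX 0)
  have hinj : Set.InjOn (fun M : ℕ => -(k * (M : ℤ))) F := by
    intro a _ b _ h
    simpa [hk] using h
  have h1 := bessel (F.image fun M : ℕ => -(k * (M : ℤ))) hg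
  rw [Finset.sum_image hinj] at h1
  simp only [neg_neg] at h1
  have h2 : ∫ x, ‖g x‖ ^ 2 ∂mu01 ≤ X ^ 2 := by
    have : ∫ x, ‖g x‖ ^ 2 ∂mu01 ≤ ∫ x, X ^ 2 ∂mu01 :=
      integral_mono hg.sq (integrable_const _) fun x => pow_le_pow_left₀ (norm_nonneg _) (hX x) 2
    simpa using this
  have h3 : (F.card : ℝ) * κ ^ 2 ≤ ∑ M ∈ F, ‖∫ x, g x * trigChar (k * (M : ℤ)) x ∂mu01‖ ^ 2 := by
    rw [← nsmul_eq_mul]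
    exact Finset.card_nsmul_le_sum _ _ _ fun M hM => pow_le_pow_left₀ hκ.le (hF M hM).le 2
  rw [le_div_iff₀ (by positivity)]
  linarith


noncomputable def bitf (y : ℝ) : ℕ := if Int.fract y < 1 / 2 then 1 else 0

noncomputable def ph (s : ℕ) (y : ℝ) : ℂ := if bitf y = s then 1 else 0

noncomputable def hcf (s : ℕ) (n : ℤ) : ℂ := ∫ x, ph s x * trigChar (-n) x ∂mu01

lemma bitf_meas : Measurable bitf :=
  Measurable.ite (measurableSet_lt measurable_fract measurable_const) measurable_const measurable_const

lemma bitf_lt (y : ℝ) : bitf y < 2 := by unfold bitf; split_ifs <;> norm_num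

lemma ph_bm (s : ℕ) : BM (ph s) :=
  BM.ite (BM.const 1) (BM.const 0) (bitf_meas (measurableSet_singleton s))

lemma ph_bm_mul (s : ℕ) (M : ℝ) : BM (fun x => ph s (M * x)) := by
  obtain ⟨hm, C, hC⟩ := ph_bm s
  exact ⟨hm.comp (measurable_const_mul M), C, fun x => hC _⟩

lemma ph_per (s : ℕ) : Function.Periodic (ph s) 1 := by
  intro y; simp [ph, bitf]

lemma tc_per (n : ℤ) : Function.Periodic (trigChar n) 1 := by
  intro y
  have : trigChar n (y + 1) = trigChar n y * trigChar n 1 := by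
    simp only [trigChar, ← Complex.exp_add]; congr 1; push_cast; ring
  rw [this, tc_one, mul_one]

lemma tc_mul (n : ℤ) (M : ℕ) (x : ℝ) : trigChar n (M * x) = trigChar (n * M) x := by
  simp only [trigChar]; congr 1; push_cast; ring

lemma mu_int (f : ℝ → ℂ) : ∫ x, f x ∂mu01 = ∫ x in (0:ℝ)..1, f x := by
  rw [intervalIntegral.integral_of_le zero_le_one]; rfl

lemma dil (f : ℝ → ℂ) (hf : BM f) (hp : Function.Periodic f 1) (M : ℕ) (hM : 1 ≤ M) :
    ∫ x, f (M * x) ∂mu01 = ∫ x, f x ∂mu01 := by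
  have hM0 : (M : ℝ) ≠ 0 := by positivity
  rw [mu_int, mu_int, intervalIntegral.integral_comp_mul_left f hM0]
  have hint : ∀ t₁ t₂, IntervalIntegrable f volume t₁ t₂ := by
    obtain ⟨hm, C, hC⟩ := hf
    intro a b
    refine (intervalIntegrable_const (c := C) ).mono_fun hm.aestronglyMeasurable ?_
    exact Eventually.of_forall fun x => (hC x).trans (le_abs_self _)
  have := hp.intervalIntegral_add_zsmul_eq M 0 hint
  simp only [zero_add, zsmul_eq_mul, mul_one, Int.cast_natCast] at this
  rw [mul_zero, mul_one, this]
  have hMc : (M : ℂ) ≠ 0 := by exact_mod_cast hM0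
  simp [hMc]

lemma hcf_dil (s : ℕ) (n : ℤ) (M : ℕ) (hM : 1 ≤ M) :
    ∫ x, ph s (M * x) * trigChar (-(n * M)) x ∂mu01 = hcf s n := by
  unfold hcf
  rw [← dil (fun x => ph s x * trigChar (-n) x) ((ph_bm s).mul (BM.tc _)) ?_ M hM]
  · simp_rw [tc_mul, neg_mul]
  · exact (ph_per s).mul (tc_per _)

lemma ph_sum (y : ℝ) : ph 0 y = 1 - ph 1 y := by
  unfold ph bitf; split_ifs <;> simp_all

lemma ph_int (g : ℝ → ℂ) (hg : Continuous g) :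
    ∫ x, ph 1 x * g x ∂mu01 = ∫ x in (0:ℝ)..(1/2), g x := by
  have hae : ∀ᵐ x : ℝ, x ≠ 1/2 ∧ x ≠ 1 := by
    have h1 : ∀ᵐ x : ℝ, x ≠ 1/2 := by simp [ae_iff]
    have h2 : ∀ᵐ x : ℝ, x ≠ 1 := by simp [ae_iff]
    filter_upwards [h1, h2] with x a b using ⟨a, b⟩
  have e1 : ∫ x in (0:ℝ)..(1/2), ph 1 x * g x = ∫ x in (0:ℝ)..(1/2), g x := by
    refine intervalIntegral.integral_congr_ae ?_
    filter_upwards [hae] with x hx hxI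
    rw [Set.uIoc_of_le (by norm_num)] at hxI
    have : Int.fract x = x := Int.fract_eq_self.2 ⟨hxI.1.le, by linarith [hxI.2]⟩
    have h3 : x < 1/2 := lt_of_le_of_ne hxI.2 hx.1
    simp only [ph, bitf, this, if_pos h3]; simp
  have e2 : ∫ x in (1/2:ℝ)..1, ph 1 x * g x = ∫ x in (1/2:ℝ)..1, 0 := by
    refine intervalIntegral.integral_congr_ae ?_
    filter_upwards [hae] with x hx hxI
    rw [Set.uIoc_of_le (by norm_num)] at hxI
    have h3 : x < 1 := lt_of_le_of_ne hxI.2 hx.2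
    have : Int.fract x = x := Int.fract_eq_self.2 ⟨by linarith [hxI.1], h3⟩
    have h4 : ¬ x < 1/2 := not_lt.2 hxI.1.le
    simp only [ph, bitf, this, if_neg h4]; simp
  have hint : ∀ a b : ℝ, IntervalIntegrable (fun x => ph 1 x * g x) volume a b := by
    intro a b
    refine (hg.norm.intervalIntegrable a b).mono_fun ((ph_bm 1).1.mul hg.measurable).aestronglyMeasurable ?_
    refine Eventually.of_forall fun x => ?_
    simp only [ph]; split_ifs <;> simp
  rw [mu_int, ← intervalIntegral.integral_add_adjacent_intervals (hint 0 (1/2)) (hint (1/2) 1), e1, e2]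
  simp

lemma hcf_zero (s : ℕ) (hs : s < 2) : hcf s 0 = 1 / 2 := by
  have h1 : hcf 1 0 = 1 / 2 := by
    unfold hcf
    rw [ph_int _ (tc_cont _)]
    simp [tc_zero]
  interval_cases s
  · have : hcf 0 0 = 1 - hcf 1 0 := by
      unfold hcf
      simp only [neg_zero, tc_zero, mul_one, ph_sum]
      rw [integral_sub (integrable_const _) (ph_bm 1).integrable]; simp
    rw [this, h1]; norm_num
  · exact h1

lemma hcf_neg (n : ℤ) (hn : n ≠ 0) : hcf 0 n = - hcf 1 n := by
  unfold hcf
  simp only [ph_sum, sub_mul, one_mul]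
  rw [integral_sub (BM.tc _).integrable ((ph_bm 1).mul (BM.tc _)).integrable, tc_int]
  simp [hn]

lemma hcf_bound' (s : ℕ) (hs : s < 2) (n : ℤ) (hn : n ≠ 0) : ‖hcf s n‖ ≤ 1 / (Real.pi * |(n:ℝ)|) := by
  have h1 : ‖hcf 1 n‖ ≤ 1 / (Real.pi * |(n:ℝ)|) := by
    unfold hcf
    rw [ph_int _ (tc_cont _), tc_int_eq _ _ _ (neg_ne_zero.2 hn), norm_div]
    have hn' : 0 < |(n:ℝ)| := by simpa using hn
    have a : ‖trigChar (-n) (1/2) - trigChar (-n) 0‖ ≤ 2 :=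
      (norm_sub_le _ _).trans (by rw [tc_norm, tc_norm]; norm_num)
    have b : ‖(2 * Real.pi * Complex.I * (-n : ℤ) : ℂ)‖ = 2 * (Real.pi * |(n:ℝ)|) := by
      simp [abs_of_pos Real.pi_pos]; ring
    rw [b, div_le_div_iff₀ (by positivity) (by positivity)]
    have := mul_le_mul_of_nonneg_right a (show 0 ≤ Real.pi * |(n:ℝ)| by positivity)
    linarith
  interval_cases s
  · rw [hcf_neg n hn, norm_neg]; exact h1
  · exact h1

lemma hcf_bound (s : ℕ) (hs : s < 2) (n : ℤ) : ‖hcf s n‖ ≤ 1 / (1 + |(n:ℝ)|) := by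
  by_cases hn : n = 0
  · subst hn; rw [hcf_zero s hs]; norm_num
  · refine (hcf_bound' s hs n hn).trans ?_
    have hn' : 1 ≤ |(n:ℝ)| := by exact_mod_cast Int.one_le_abs hn
    refine one_div_le_one_div_of_le (by positivity) ?_
    nlinarith [Real.pi_gt_three]

lemma ph_nsq (s : ℕ) (y : ℝ) : ((‖ph s y‖ ^ 2 : ℝ) : ℂ) = ph s y * trigChar (-0) y := by
  simp only [neg_zero, tc_zero, mul_one]
  unfold ph; split_ifs <;> simp

lemma ph_energy (s : ℕ) (hs : s < 2) (M : ℕ) (hM : 1 ≤ M) :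
    ∫ x, ‖ph s (M * x)‖ ^ 2 ∂mu01 = 1 / 2 := by
  have h : ((∫ x, ‖ph s (M * x)‖ ^ 2 ∂mu01 : ℝ) : ℂ) = ((1 / 2 : ℝ) : ℂ) := by
    rw [← integral_complex_ofReal]
    have := hcf_dil s 0 M hM
    rw [hcf_zero s hs] at this
    simp only [zero_mul] at this
    push_cast
    rw [← this]
    refine integral_congr_ae (Eventually.of_forall fun x => ?_)
    have := ph_nsq s (M * x)
    simp only [neg_zero, tc_zero] at this ⊢
    exact_mod_cast this
  exact_mod_cast h

lemma hcf_sum_le (s : ℕ) (hs : s < 2) (F : Finset ℤ) : ∑ n ∈ F, ‖hcf s n‖ ^ 2 ≤ 1 / 2 := by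
  have := bessel F (ph_bm s)
  have h2 := ph_energy s hs 1 le_rfl
  simp only [Nat.cast_one, one_mul] at h2
  rw [h2] at this
  exact this

lemma hcf_hasSum (s : ℕ) (hs : s < 2) : HasSum (fun n => ‖hcf s n‖ ^ 2) (1 / 2) := by
  have hL : MemLp (ph s) 2 (volume.restrict (Set.Ioc (0:ℝ) 1)) :=
    MemLp.of_bound (ph_bm s).1.aestronglyMeasurable 1
      (Eventually.of_forall fun x => by unfold ph; split_ifs <;> simp)
  have h := hasSum_sq_fourierCoeffOn zero_lt_one hL
  have h2 := ph_energy s hs 1 le_rfl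
  simp only [Nat.cast_one, one_mul] at h2
  convert h using 1
  · funext n
    congr 2
    rw [fourierCoeffOn_eq_integral, hcf, mu_int]
    simp only [sub_zero, div_one, one_smul]
    refine intervalIntegral.integral_congr fun x _ => ?_
    simp only [smul_eq_mul]
    rw [mul_comm]
    congr 1
    rw [fourier_coe_apply]
    simp [trigChar]
  · rw [intervalIntegral.integral_of_le zero_le_one]
    have : ∫ x in Set.Ioc (0:ℝ) 1, ‖ph s x‖ ^ 2 = 1/2 := h2
    rw [this]; simp

lemma hcf_tail_step (s : ℕ) (hs : s < 2) (N : ℕ) (hN : 1 ≤ N) (K : ℕ) (hK : N ≤ K) :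
    ∑ n ∈ Finset.Icc (-(K:ℤ)) K, ‖hcf s n‖ ^ 2
      ≤ ∑ n ∈ Finset.Icc (-(N:ℤ)) N, ‖hcf s n‖ ^ 2 + (1 / N - 1 / K) := by
  induction K, hK using Nat.le_induction with
  | base => simp
  | succ K hK ih =>
    have hset : Finset.Icc (-((K+1:ℕ):ℤ)) ((K+1:ℕ):ℤ)
        = insert (-((K:ℤ)+1)) (insert ((K:ℤ)+1) (Finset.Icc (-(K:ℤ)) K)) := by
      ext z; simp only [Finset.mem_Icc, Finset.mem_insert]; push_cast; omega
    rw [hset, Finset.sum_insert, Finset.sum_insert]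
    · have hK1 : (1:ℝ) ≤ K := by exact_mod_cast hN.trans hK
      have hb : ∀ n : ℤ, |(n:ℝ)| = K + 1 → ‖hcf s n‖ ^ 2 ≤ 1 / (9 * ((K:ℝ) + 1) ^ 2) := by
        intro n hn
        have hn0 : n ≠ 0 := by rintro rfl; simp at hn; linarith
        have h1 := hcf_bound' s hs n hn0
        rw [hn] at h1
        have h2 : 1 / (Real.pi * ((K:ℝ)+1)) ≤ 1 / (3 * ((K:ℝ)+1)) :=
          one_div_le_one_div_of_le (by positivity) (by nlinarith [Real.pi_gt_three])
        calc ‖hcf s n‖ ^ 2 ≤ (1 / (3 * ((K:ℝ)+1))) ^ 2 :=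
              pow_le_pow_left₀ (norm_nonneg _) (h1.trans h2) 2
          _ = _ := by field_simp; norm_num
      have b1 := hb (-((K:ℤ)+1)) (by push_cast; rw [abs_neg, abs_of_pos (by positivity)])
      have b2 := hb ((K:ℤ)+1) (by push_cast; rw [abs_of_pos (by positivity)])
      have : 1 / (9 * ((K:ℝ) + 1) ^ 2) + 1 / (9 * ((K:ℝ) + 1) ^ 2) ≤ 1 / (K:ℝ) - 1 / ((K+1:ℕ):ℝ) := by
        push_cast
        have hK0 : (0:ℝ) < K := by linarith
        rw [div_sub_div _ _ (by positivity) (by positivity), ← add_div,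
          div_le_div_iff₀ (by positivity) (by positivity)]
        nlinarith
      linarith
    · simp
    · simp only [Finset.mem_insert, Finset.mem_Icc]; omega

lemma hcf_tail (s : ℕ) (hs : s < 2) (N : ℕ) (hN : 1 ≤ N) :
    1 / 2 - ∑ n ∈ Finset.Icc (-(N:ℤ)) N, ‖hcf s n‖ ^ 2 ≤ 1 / N := by
  have h := hcf_hasSum s hs
  have : (1/2 : ℝ) ≤ ∑ n ∈ Finset.Icc (-(N:ℤ)) N, ‖hcf s n‖ ^ 2 + 1 / N := by
    refine hasSum_le_of_sum_le h fun F => ?_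
    obtain ⟨K, hK1, hK2⟩ : ∃ K : ℕ, N ≤ K ∧ F ⊆ Finset.Icc (-(K:ℤ)) K := by
      refine ⟨N + ∑ n ∈ F, n.natAbs, by omega, fun z hz => ?_⟩
      have : z.natAbs ≤ ∑ n ∈ F, n.natAbs :=
        Finset.single_le_sum (f := fun n : ℤ => n.natAbs) (fun _ _ => Nat.zero_le _) hz
      generalize (∑ n ∈ F, n.natAbs) = A at *
      rw [Finset.mem_Icc]; push_cast; constructor <;> omega
    have h1 := Finset.sum_le_sum_of_subset_of_nonneg hK2
      (f := fun n => ‖hcf s n‖ ^ 2) (fun _ _ _ => by positivity)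
    have h2 := hcf_tail_step s hs N hN K hK1
    have h3 : (0:ℝ) ≤ 1 / K := by positivity
    linarith
  linarith

/-- F3 -/
lemma ph_approx (s : ℕ) (hs : s < 2) (M : ℕ) (hM : 1 ≤ M) (N : ℕ) (hN : 1 ≤ N) :
    ∫ x, ‖ph s (M * x) - ∑ n ∈ Finset.Icc (-(N:ℤ)) N, hcf s n * trigChar (n * M) x‖ ^ 2 ∂mu01
      ≤ 1 / N := by
  classical
  have hM0 : (M : ℤ) ≠ 0 := by positivity
  have hinj : Set.InjOn (fun n : ℤ => n * (M:ℤ)) (Finset.Icc (-(N:ℤ)) N) := by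
    intro a _ b _ h; exact mul_right_cancel₀ hM0 h
  have h := proj_id ((Finset.Icc (-(N:ℤ)) N).image fun n : ℤ => n * (M:ℤ)) (ph_bm_mul s M)
    (fun k => hcf s (k / M)) (by
      intro k hk
      obtain ⟨n, -, rfl⟩ := Finset.mem_image.1 hk
      rw [hcf_dil s n M hM, Int.mul_ediv_cancel _ hM0])
  rw [Finset.sum_image hinj] at h
  simp_rw [Finset.sum_image hinj, Int.mul_ediv_cancel _ hM0] at h
  rw [h, ph_energy s hs M hM]
  exact hcf_tail s hs N hN


noncomputable def pw (z : ℂ) : ℝ := ‖z‖ * Real.sqrt ‖z‖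

lemma pw_nonneg (z : ℂ) : 0 ≤ pw z := by unfold pw; positivity

lemma pw_mul (z v : ℂ) : pw (z * v) = pw z * pw v := by
  unfold pw
  rw [norm_mul, Real.sqrt_mul (norm_nonneg _)]; ring

noncomputable def gg (n : ℤ) : ℝ := 1 / ((1 + |(n:ℝ)|) * Real.sqrt (1 + |(n:ℝ)|))

lemma gg_nonneg (n : ℤ) : 0 ≤ gg n := by unfold gg; positivity

lemma exists_B : ∃ B : ℝ, 1 ≤ B ∧ ∀ F : Finset ℤ, ∑ n ∈ F, gg n ≤ B := by
  have h1 : Summable (fun n : ℕ => 1 / (n:ℝ) ^ (3/2 : ℝ)) :=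
    Real.summable_one_div_nat_rpow.2 (by norm_num)
  have h2 : Summable (fun n : ℕ => 1 / ((n:ℝ) + 1) ^ (3/2 : ℝ)) := by
    have := (summable_nat_add_iff 1).2 h1
    simpa using this
  have e : ∀ y : ℝ, 0 < y → y ^ (3/2 : ℝ) = y * Real.sqrt y := by
    intro y hy
    rw [Real.sqrt_eq_rpow, show (3/2 : ℝ) = 1 + 1/2 by norm_num, Real.rpow_add hy, Real.rpow_one]
  have h3 : Summable gg := by
    refine Summable.of_nat_of_neg (f := gg) ?_ ?_
    · refine h2.congr fun n => ?_
      rw [e _ (by positivity)]; simp [gg, add_comm]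
    · refine h2.congr fun n => ?_
      rw [e _ (by positivity)]; simp [gg, add_comm]
  refine ⟨max 1 (∑' n, gg n), le_max_left _ _, fun F => ?_⟩
  exact (h3.sum_le_tsum F fun n _ => gg_nonneg n).trans (le_max_right _ _)

lemma pw_hcf (s : ℕ) (hs : s < 2) (n : ℤ) : pw (hcf s n) ≤ gg n := by
  have h := hcf_bound s hs n
  have h1 : (0:ℝ) < 1 + |(n:ℝ)| := by positivity
  have h2 : Real.sqrt ‖hcf s n‖ ≤ 1 / Real.sqrt (1 + |(n:ℝ)|) := by
    rw [← Real.sqrt_one, ← Real.sqrt_div zero_le_one, Real.sqrt_one]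
    exact Real.sqrt_le_sqrt h
  unfold pw gg
  refine (mul_le_mul h h2 (Real.sqrt_nonneg _) (by positivity)).trans (le_of_eq ?_)
  rw [div_mul_div_comm, one_mul]

lemma sq_hcf (s : ℕ) (hs : s < 2) (n : ℤ) : ‖hcf s n‖ ^ 2 * Real.sqrt |(n:ℝ)| ≤ gg n := by
  have h := hcf_bound s hs n
  have h1 : (0:ℝ) < 1 + |(n:ℝ)| := by positivity
  have h2 : Real.sqrt |(n:ℝ)| ≤ Real.sqrt (1 + |(n:ℝ)|) := Real.sqrt_le_sqrt (by linarith)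
  have h3 : ‖hcf s n‖ ^ 2 ≤ (1 / (1 + |(n:ℝ)|)) ^ 2 := pow_le_pow_left₀ (norm_nonneg _) h 2
  refine (mul_le_mul h3 h2 (Real.sqrt_nonneg _) (by positivity)).trans ?_
  unfold gg
  have h4 := Real.sq_sqrt h1.le
  have h5 : 0 < Real.sqrt (1 + |(n:ℝ)|) := Real.sqrt_pos.2 h1
  generalize Real.sqrt (1 + |(n:ℝ)|) = r at *
  rw [← h4]
  apply le_of_eq; field_simp

/-- trigonometric polynomial -/
noncomputable def tp (S : Finset ℤ) (c : ℤ → ℂ) (x : ℝ) : ℂ := ∑ t ∈ S, c t * trigChar t x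

lemma tp_bm (S : Finset ℤ) (c : ℤ → ℂ) : BM (tp S c) :=
  BM.sum S fun _ _ => (BM.const _).mul (BM.tc _)

lemma tp_le (S : Finset ℤ) (c : ℤ → ℂ) (x : ℝ) : ‖tp S c x‖ ≤ ∑ t ∈ S, ‖c t‖ := by
  refine (norm_sum_le _ _).trans (Finset.sum_le_sum fun t _ => ?_)
  rw [norm_mul, tc_norm, mul_one]

lemma tp_energy (S : Finset ℤ) (c : ℤ → ℂ) : ∫ x, ‖tp S c x‖ ^ 2 ∂mu01 = ∑ t ∈ S, ‖c t‖ ^ 2 :=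
  parseval S (fun t => t) c (fun _ _ _ _ h => h)

lemma exists_coef {ι : Type*} (K : Finset ι) (f : ι → ℤ) (hf : Set.InjOn f K) (d : ι → ℂ) :
    ∃ c : ℤ → ℂ, ∀ p ∈ K, c (f p) = d p := by
  classical
  refine ⟨fun k => ∑ p ∈ K with f p = k, d p, fun p hp => ?_⟩
  dsimp only
  rw [Finset.sum_eq_single p]
  · intro q hq hqp
    rw [Finset.mem_filter] at hq
    exact absurd (hf hq.1 hp hq.2) hqp
  · intro h; exact (h (by simp [hp])).elim

lemma sqrt_add_le' (a b : ℝ) (ha : 0 ≤ a) (hb : 0 ≤ b) :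
    Real.sqrt (a + b) ≤ Real.sqrt a + Real.sqrt b := by
  rw [Real.sqrt_le_left (by positivity)]
  nlinarith [Real.sq_sqrt ha, Real.sq_sqrt hb, Real.sqrt_nonneg a, Real.sqrt_nonneg b,
    mul_nonneg (Real.sqrt_nonneg a) (Real.sqrt_nonneg b)]

lemma sum_prod_mul (A S : Finset ℤ) (F G : ℤ → ℝ) :
    ∑ p ∈ A ×ˢ S, F p.1 * G p.2 = (∑ n ∈ A, F n) * ∑ t ∈ S, G t := by
  rw [Finset.sum_product, Finset.sum_mul_sum]

lemma step_node {B : ℝ} (hB : ∀ F : Finset ℤ, ∑ n ∈ F, gg n ≤ B)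
    (s : ℕ) (hs : s < 2) (S : Finset ℤ) (c : ℤ → ℂ) (M N : ℕ) (hM : 1 ≤ M) (hN : 1 ≤ N)
    (η : ℝ) (hη : 0 < η)
    (hinj : Set.InjOn (fun p : ℤ × ℤ => p.1 * M + p.2) (Finset.Icc (-(N:ℤ)) N ×ˢ S)) :
    ∃ (S' : Finset ℤ) (c' : ℤ → ℂ),
      ∑ t ∈ S', ‖c' t‖ ^ 2 ≤ 1 / 2 * ∑ t ∈ S, ‖c t‖ ^ 2 ∧
      ∑ t ∈ S', pw (c' t) ≤ B * ∑ t ∈ S, pw (c t) ∧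
      S'.card * (η * Real.sqrt η) ≤ B * ∑ t ∈ S, pw (c t) ∧
      ∑ t ∈ S', ‖c' t‖ ^ 2 * Real.sqrt |(t:ℝ)| ≤ 1 / 2 * ∑ t ∈ S, ‖c t‖ ^ 2 * Real.sqrt |(t:ℝ)|
        + B * Real.sqrt M * ∑ t ∈ S, ‖c t‖ ^ 2 ∧
      ∫ x, ‖ph s (M * x) * tp S c x - tp S' c' x‖ ^ 2 ∂mu01
        ≤ 2 * (∑ t ∈ S, ‖c t‖) ^ 2 / N + 2 * Real.sqrt η * (B * ∑ t ∈ S, pw (c t)) := by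
  classical
  set A := Finset.Icc (-(N:ℤ)) N with hA
  set f : ℤ × ℤ → ℤ := fun p => p.1 * M + p.2 with hf
  set d : ℤ × ℤ → ℂ := fun p => hcf s p.1 * c p.2 with hd
  set K := (A ×ˢ S).filter (fun p => η ≤ ‖d p‖) with hK
  have hKs : K ⊆ A ×ˢ S := Finset.filter_subset _ _
  have hKinj : Set.InjOn f K := hinj.mono (by exact_mod_cast hKs)
  obtain ⟨c', hc'⟩ := exists_coef K f hKinj d
  have hpw : ∑ p ∈ A ×ˢ S, pw (d p) ≤ B * ∑ t ∈ S, pw (c t) := by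
    simp only [hd, pw_mul]
    rw [sum_prod_mul A S (fun n => pw (hcf s n)) (fun t => pw (c t))]
    refine mul_le_mul_of_nonneg_right ?_ (Finset.sum_nonneg fun _ _ => pw_nonneg _)
    exact (Finset.sum_le_sum fun n _ => pw_hcf s hs n).trans (hB A)
  have hpwK : ∑ p ∈ K, pw (d p) ≤ B * ∑ t ∈ S, pw (c t) :=
    (Finset.sum_le_sum_of_subset_of_nonneg hKs fun _ _ _ => pw_nonneg _).trans hpw
  refine ⟨K.image f, c', ?_, ?_, ?_, ?_, ?_⟩
  · rw [Finset.sum_image hKinj, Finset.sum_congr rfl (g := fun p => ‖d p‖ ^ 2)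
      (fun p hp => by rw [hc' p hp])]
    refine (Finset.sum_le_sum_of_subset_of_nonneg hKs fun _ _ _ => by positivity).trans ?_
    simp only [hd, norm_mul, mul_pow]
    rw [sum_prod_mul A S (fun n => ‖hcf s n‖ ^ 2) (fun t => ‖c t‖ ^ 2)]
    exact mul_le_mul_of_nonneg_right (hcf_sum_le s hs A) (Finset.sum_nonneg fun _ _ => by positivity)
  · rw [Finset.sum_image hKinj, Finset.sum_congr rfl (g := fun p => pw (d p))
      (fun p hp => by rw [hc' p hp])]
    exact hpwK
  · rw [Finset.card_image_of_injOn hKinj, ← nsmul_eq_mul]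
    refine (Finset.card_nsmul_le_sum K (fun p => pw (d p)) _ fun p hp => ?_).trans hpwK
    have h1 : η ≤ ‖d p‖ := (Finset.mem_filter.1 hp).2
    exact mul_le_mul h1 (Real.sqrt_le_sqrt h1) (Real.sqrt_nonneg _) (norm_nonneg _)
  · rw [Finset.sum_image hKinj, Finset.sum_congr rfl
      (g := fun p => ‖d p‖ ^ 2 * Real.sqrt |((f p : ℤ) : ℝ)|) (fun p hp => by rw [hc' p hp])]
    refine (Finset.sum_le_sum_of_subset_of_nonneg hKs fun _ _ _ => by positivity).trans ?_
    have h1 : ∀ p ∈ A ×ˢ S, ‖d p‖ ^ 2 * Real.sqrt |((f p : ℤ) : ℝ)|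
        ≤ ‖hcf s p.1‖ ^ 2 * (‖c p.2‖ ^ 2 * Real.sqrt |(p.2 : ℝ)|)
          + (‖hcf s p.1‖ ^ 2 * Real.sqrt |(p.1 : ℝ)|) * (Real.sqrt M * ‖c p.2‖ ^ 2) := by
      intro p _
      have h2 : Real.sqrt |((f p : ℤ) : ℝ)| ≤ Real.sqrt |(p.1:ℝ)| * Real.sqrt M + Real.sqrt |(p.2:ℝ)| := by
        rw [← Real.sqrt_mul (abs_nonneg _)]
        refine le_trans (Real.sqrt_le_sqrt ?_) (sqrt_add_le' _ _ (by positivity) (by positivity))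
        simp only [hf]; push_cast
        refine (abs_add_le _ _).trans ?_
        rw [abs_mul, Nat.abs_cast]
      have h3 := mul_le_mul_of_nonneg_left h2 (show 0 ≤ ‖d p‖ ^ 2 by positivity)
      refine h3.trans (le_of_eq ?_)
      simp only [hd, norm_mul]; ring
    refine (Finset.sum_le_sum h1).trans ?_
    rw [Finset.sum_add_distrib, sum_prod_mul A S (fun n => ‖hcf s n‖ ^ 2) (fun t => ‖c t‖ ^ 2 * Real.sqrt |(t : ℝ)|), 
      sum_prod_mul A S (fun n => ‖hcf s n‖ ^ 2 * Real.sqrt |(n : ℝ)|) (fun t => Real.sqrt M * ‖c t‖ ^ 2), ← Finset.mul_sum]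
    refine add_le_add ?_ ?_
    · exact mul_le_mul_of_nonneg_right (hcf_sum_le s hs A) (Finset.sum_nonneg fun _ _ => by positivity)
    · rw [mul_assoc]
      refine mul_le_mul_of_nonneg_right ?_ (mul_nonneg (Real.sqrt_nonneg _) (Finset.sum_nonneg fun _ _ => by positivity))
      exact (Finset.sum_le_sum fun n _ => sq_hcf s hs n).trans (hB A)
  · have hT' : ∀ x, tp (K.image f) c' x = ∑ p ∈ K, d p * trigChar (f p) x := by
      intro x
      unfold tp
      rw [Finset.sum_image hKinj]
      exact Finset.sum_congr rfl fun p hp => by rw [hc' p hp]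
    set K2 := (A ×ˢ S).filter (fun p => ¬ η ≤ ‖d p‖) with hK2
    have hK2inj : Set.InjOn f K2 := hinj.mono (by exact_mod_cast Finset.filter_subset _ _)
    set PN : ℝ → ℂ := fun x => ∑ n ∈ A, hcf s n * trigChar (n * M) x with hPN
    have hPT : ∀ x, PN x * tp S c x - tp (K.image f) c' x = ∑ p ∈ K2, d p * trigChar (f p) x := by
      intro x
      rw [hT', sub_eq_iff_eq_add, add_comm, Finset.sum_filter_add_sum_filter_not, hPN]
      unfold tp
      simp only
      rw [Finset.sum_mul_sum, ← Finset.sum_product']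
      refine Finset.sum_congr rfl fun p _ => ?_
      simp only [hd, hf, tc_add]; ring
    have hPNbm : BM PN := BM.sum A fun _ _ => (BM.const _).mul (BM.tc _)
    have hb1 : BM (fun x => (ph s (M * x) - PN x) * tp S c x) :=
      ((ph_bm_mul s M).sub hPNbm).mul (tp_bm S c)
    have hb2 : BM (fun x => ∑ p ∈ K2, d p * trigChar (f p) x) :=
      BM.sum K2 fun _ _ => (BM.const _).mul (BM.tc _)
    have e1 : ∀ x, ph s (M * x) * tp S c x - tp (K.image f) c' x
        = (ph s (M * x) - PN x) * tp S c x + ∑ p ∈ K2, d p * trigChar (f p) x := by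
      intro x; rw [← hPT]; ring
    have i1 : ∫ x, ‖ph s (M * x) * tp S c x - tp (K.image f) c' x‖ ^ 2 ∂mu01
        ≤ ∫ x, (2 * ‖(ph s (M * x) - PN x) * tp S c x‖ ^ 2
            + 2 * ‖∑ p ∈ K2, d p * trigChar (f p) x‖ ^ 2) ∂mu01 := by
      simp_rw [e1]
      exact integral_mono (hb1.add hb2).sq ((hb1.sq.const_mul 2).add (hb2.sq.const_mul 2))
        fun x => nsq_add_le _ _
    refine i1.trans ?_
    rw [integral_add (hb1.sq.const_mul 2) (hb2.sq.const_mul 2), integral_const_mul, integral_const_mul]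
    have i2 : ∫ x, ‖(ph s (M * x) - PN x) * tp S c x‖ ^ 2 ∂mu01 ≤ (∑ t ∈ S, ‖c t‖) ^ 2 * (1 / N) := by
      have : ∫ x, ‖(ph s (M * x) - PN x) * tp S c x‖ ^ 2 ∂mu01
          ≤ ∫ x, (∑ t ∈ S, ‖c t‖) ^ 2 * ‖ph s (M * x) - PN x‖ ^ 2 ∂mu01 := by
        refine integral_mono hb1.sq (((ph_bm_mul s M).sub hPNbm).sq.const_mul _) fun x => ?_
        dsimp only
        rw [norm_mul, mul_pow, mul_comm]
        exact mul_le_mul_of_nonneg_right (pow_le_pow_left₀ (norm_nonneg _) (tp_le S c x) 2) (by positivity)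
      refine this.trans ?_
      rw [integral_const_mul]
      exact mul_le_mul_of_nonneg_left (ph_approx s hs M hM N hN) (by positivity)
    have i3 : ∫ x, ‖∑ p ∈ K2, d p * trigChar (f p) x‖ ^ 2 ∂mu01
        ≤ Real.sqrt η * (B * ∑ t ∈ S, pw (c t)) := by
      rw [parseval K2 f d hK2inj]
      have : ∀ p ∈ K2, ‖d p‖ ^ 2 ≤ Real.sqrt η * pw (d p) := by
        intro p hp
        have h1 : ‖d p‖ ≤ η := (not_le.1 (Finset.mem_filter.1 hp).2).le
        have h2 := Real.sqrt_le_sqrt h1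
        have h3 := Real.mul_self_sqrt (norm_nonneg (d p))
        unfold pw
        calc ‖d p‖ ^ 2 = Real.sqrt ‖d p‖ * (‖d p‖ * Real.sqrt ‖d p‖) := by rw [pow_two]; nlinarith
          _ ≤ _ := mul_le_mul_of_nonneg_right h2 (by positivity)
      refine (Finset.sum_le_sum this).trans ?_
      rw [← Finset.mul_sum]
      refine mul_le_mul_of_nonneg_left ?_ (Real.sqrt_nonneg _)
      exact (Finset.sum_le_sum_of_subset_of_nonneg (Finset.filter_subset _ _)
        fun _ _ _ => pw_nonneg _).trans hpw
    have : 2 * (∑ t ∈ S, ‖c t‖) ^ 2 / N = 2 * ((∑ t ∈ S, ‖c t‖) ^ 2 * (1 / N)) := by ring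
    rw [this]
    linarith


lemma select (R L u v : ℕ) (U : ℕ → ℕ → Prop) (V : ℕ → ℕ → ℕ → ℕ → Prop)
    (hU : ∀ a < L, ∀ F : Finset ℕ, (∀ M ∈ F, U a M) → F.card ≤ u)
    (hV : ∀ a < L, ∀ a' < a, ∀ M', ∀ F : Finset ℕ, (∀ M ∈ F, V a M a' M') → F.card ≤ v)
    (h : u + L * v < R) :
    ∃ M : ℕ → ℕ, ∀ a < L, R ≤ M a ∧ M a < 2 * R ∧ ¬ U a (M a) ∧ ∀ a' < a, ¬ V a (M a) a' (M a') := by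
  classical
  have key : ∀ l ≤ L, ∃ M : ℕ → ℕ, ∀ a < l, R ≤ M a ∧ M a < 2 * R ∧ ¬ U a (M a) ∧
      ∀ a' < a, ¬ V a (M a) a' (M a') := by
    intro l
    induction l with
    | zero => intro _; exact ⟨fun _ => 0, fun a ha => absurd ha (Nat.not_lt_zero a)⟩
    | succ l ih =>
      intro hl
      obtain ⟨M, hM⟩ := ih (by omega)
      have : ∃ m ∈ Finset.Ico R (2 * R), ¬ U l m ∧ ∀ a' < l, ¬ V l m a' (M a') := by
        by_contra! hcon
        have hsub : Finset.Ico R (2 * R) ⊆ (Finset.Ico R (2 * R)).filter (U l) ∪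
            (Finset.range l).biUnion (fun a' => (Finset.Ico R (2 * R)).filter (fun m => V l m a' (M a'))) := by
          intro m hm
          by_cases hu : U l m
          · exact Finset.mem_union_left _ (Finset.mem_filter.2 ⟨hm, hu⟩)
          · obtain ⟨a', ha', hv⟩ := hcon m hm hu
            refine Finset.mem_union_right _ (Finset.mem_biUnion.2 ⟨a', Finset.mem_range.2 ha', ?_⟩)
            exact Finset.mem_filter.2 ⟨hm, hv⟩
        have h1 := Finset.card_le_card hsub
        have h2 := Finset.card_union_le ((Finset.Ico R (2 * R)).filter (U l))
          ((Finset.range l).biUnion (fun a' => (Finset.Ico R (2 * R)).filter (fun m => V l m a' (M a'))))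
        have h3 : ((Finset.range l).biUnion
            (fun a' => (Finset.Ico R (2 * R)).filter (fun m => V l m a' (M a')))).card ≤ l * v := by
          refine Finset.card_biUnion_le.trans ?_
          refine (Finset.sum_le_card_nsmul _ _ v fun a' ha' => ?_).trans (by simp)
          exact hV l (by omega) a' (Finset.mem_range.1 ha') (M a') _ fun m hm => (Finset.mem_filter.1 hm).2
        have h4 := hU l (by omega) ((Finset.Ico R (2 * R)).filter (U l)) fun m hm => (Finset.mem_filter.1 hm).2
        have h5 : l * v ≤ L * v := Nat.mul_le_mul_right _ (by omega)
        rw [Nat.card_Ico] at h1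
        omega
      obtain ⟨m, hm, hmU, hmV⟩ := this
      rw [Finset.mem_Ico] at hm
      refine ⟨Function.update M l m, fun a ha => ?_⟩
      rcases Nat.lt_succ_iff_lt_or_eq.1 ha with hlt | rfl
      · have e : ∀ b ≤ a, Function.update M l m b = M b := fun b hb =>
          Function.update_of_ne (by omega) _ _
        rw [e a le_rfl]
        obtain ⟨p1, p2, p3, p4⟩ := hM a hlt
        refine ⟨p1, p2, p3, fun a' ha' => ?_⟩
        rw [e a' ha'.le]; exact p4 a' ha'
      · rw [Function.update_self]
        refine ⟨hm.1, hm.2, hmU, fun a' ha' => ?_⟩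
        rw [Function.update_of_ne (by omega)]; exact hmV a' ha'
  exact key L le_rfl

lemma count_inj (N : ℕ) (S : Finset ℤ) (F : Finset ℕ)
    (hF : ∀ M ∈ F, ¬ Set.InjOn (fun p : ℤ × ℤ => p.1 * (M:ℤ) + p.2) (Finset.Icc (-(N:ℤ)) N ×ˢ S : Finset (ℤ × ℤ))) :
    F.card ≤ ((2 * N + 1) * S.card) ^ 2 := by
  classical
  set K : Finset (ℤ × ℤ) := Finset.Icc (-(N:ℤ)) N ×ˢ S with hK
  have hsub : F ⊆ (K ×ˢ K).image (fun r => ((r.2.2 - r.1.2) / (r.1.1 - r.2.1)).toNat) := by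
    intro M hM
    have h := hF M hM
    simp only [Set.InjOn] at h
    push Not at h
    obtain ⟨p, hp, q, hq, h1, h2⟩ := h
    refine Finset.mem_image.2 ⟨(p, q), Finset.mem_product.2 ⟨hp, hq⟩, ?_⟩
    have hne : p.1 - q.1 ≠ 0 := by
      intro h0
      have h3 : p.1 = q.1 := by omega
      rw [h3] at h1
      exact h2 (Prod.ext h3 (by omega))
    have h4 : q.2 - p.2 = (M : ℤ) * (p.1 - q.1) := by linarith
    simp only [h4, Int.mul_ediv_cancel _ hne, Int.toNat_natCast]
  have h1 := (Finset.card_le_card hsub).trans Finset.card_image_le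
  rw [Finset.card_product] at h1
  have h2 : K.card = (2 * N + 1) * S.card := by
    rw [hK, Finset.card_product, Int.card_Icc]; congr 1; omega
  rw [h2] at h1
  rw [pow_two]; exact h1

lemma count_diff (S S' : Finset ℤ) (M' : ℕ) (F : Finset ℕ)
    (hF : ∀ M ∈ F, ∃ t ∈ S, ∃ t' ∈ S', (M:ℤ) + t = M' + t') : F.card ≤ S.card * S'.card := by
  classical
  have hsub : F ⊆ (S ×ˢ S').image (fun r => ((M':ℤ) + r.2 - r.1).toNat) := by
    intro M hM
    obtain ⟨t, ht, t', ht', h⟩ := hF M hM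
    refine Finset.mem_image.2 ⟨(t, t'), Finset.mem_product.2 ⟨ht, ht'⟩, ?_⟩
    simp only; omega
  have h1 := (Finset.card_le_card hsub).trans Finset.card_image_le
  rwa [Finset.card_product] at h1

/-- almost orthogonality -/
lemma almost_orth (L : ℕ) (f : ℕ → ℝ → ℂ) (hf : ∀ a < L, BM (f a)) (β : ℕ → ℝ) (hβ : ∀ a, 0 ≤ β a)
    (κ : ℝ) (hκ : 0 ≤ κ)
    (h : ∀ a < L, ∀ b < a, ‖∫ x, f a x * (starRingEnd ℂ) (f b x) ∂mu01‖ ≤ κ) :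
    ∫ x, ‖∑ a ∈ Finset.range L, (β a : ℂ) * f a x‖ ^ 2 ∂mu01
      ≤ ∑ a ∈ Finset.range L, β a ^ 2 * ∫ x, ‖f a x‖ ^ 2 ∂mu01
        + (∑ a ∈ Finset.range L, β a) ^ 2 * κ := by
  induction L with
  | zero => simp
  | succ l ih =>
    have ih := ih (fun a ha => hf a (by omega)) (fun a ha b hb => h a (by omega) b hb)
    have hs : BM (fun x => ∑ a ∈ Finset.range l, (β a : ℂ) * f a x) :=
      BM.sum _ fun a ha => (BM.const _).mul (hf a (by have := Finset.mem_range.1 ha; omega))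
    have hl : BM (fun x => (β l : ℂ) * f l x) := (BM.const _).mul (hf l (by omega))
    have hi := (hl.mul hs.star).integrable
    have e : ∀ x, ‖∑ a ∈ Finset.range (l+1), (β a : ℂ) * f a x‖ ^ 2
        = (‖(β l : ℂ) * f l x‖ ^ 2 + ‖∑ a ∈ Finset.range l, (β a : ℂ) * f a x‖ ^ 2)
          + 2 * ((β l : ℂ) * f l x * (starRingEnd ℂ) (∑ a ∈ Finset.range l, (β a : ℂ) * f a x)).re := by
      intro x
      rw [Finset.sum_range_succ, add_comm, nsq_add]
    simp_rw [e]
    have hA : Integrable (fun x => ‖(β l : ℂ) * f l x‖ ^ 2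
        + ‖∑ a ∈ Finset.range l, (β a : ℂ) * f a x‖ ^ 2) mu01 := hl.sq.add hs.sq
    have hB : Integrable (fun x => 2 * ((β l : ℂ) * f l x *
        (starRingEnd ℂ) (∑ a ∈ Finset.range l, (β a : ℂ) * f a x)).re) mu01 := (hi.re).const_mul 2
    rw [integral_add hA hB, integral_add hl.sq hs.sq,
      integral_const_mul]
    have e1 : ∫ x, ‖(β l : ℂ) * f l x‖ ^ 2 ∂mu01 = β l ^ 2 * ∫ x, ‖f l x‖ ^ 2 ∂mu01 := by
      rw [← integral_const_mul]
      refine integral_congr_ae (Eventually.of_forall fun x => ?_)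
      simp [mul_pow]
    have e2 : ∫ x, ((β l : ℂ) * f l x * (starRingEnd ℂ) (∑ a ∈ Finset.range l, (β a : ℂ) * f a x)).re ∂mu01
        ≤ β l * (∑ a ∈ Finset.range l, β a) * κ := by
      have h1 := integral_re (𝕜 := ℂ) hi
      simp only [RCLike.re_eq_complex_re] at h1
      rw [h1]
      refine (Complex.re_le_norm _).trans ?_
      have h2 : ∀ x, (β l : ℂ) * f l x * (starRingEnd ℂ) (∑ a ∈ Finset.range l, (β a : ℂ) * f a x)
          = ∑ a ∈ Finset.range l, ((β l * β a : ℝ) : ℂ) * (f l x * (starRingEnd ℂ) (f a x)) := by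
        intro x
        rw [map_sum, Finset.mul_sum]
        refine Finset.sum_congr rfl fun a _ => ?_
        rw [map_mul, Complex.conj_ofReal]; push_cast; ring
      simp_rw [h2]
      rw [integral_finsetSum]
      · refine (norm_sum_le _ _).trans ?_
        rw [mul_assoc, Finset.sum_mul, Finset.mul_sum]
        refine Finset.sum_le_sum fun a ha => ?_
        rw [integral_const_mul, norm_mul, Complex.norm_real, Real.norm_of_nonneg (mul_nonneg (hβ _) (hβ _)),
          ← mul_assoc]
        exact mul_le_mul_of_nonneg_left (h l (by omega) a (Finset.mem_range.1 ha)) (mul_nonneg (hβ _) (hβ _))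
      · intro a ha
        exact ((BM.const _).mul ((hf l (by omega)).mul
          (hf a (by have := Finset.mem_range.1 ha; omega)).star)).integrable
    rw [Finset.sum_range_succ, Finset.sum_range_succ, e1]
    nlinarith [mul_nonneg (sq_nonneg (β l)) hκ]


/-- indicator of a level set -/
noncomputable def ia (p : ℝ → ℕ) (a : ℕ) (x : ℝ) : ℂ := if p x = a then 1 else 0

lemma ia_bm {p : ℝ → ℕ} (hp : Measurable p) (a : ℕ) : BM (ia p a) :=
  BM.ite (BM.const 1) (BM.const 0) (hp (measurableSet_singleton a))

lemma ia_sum {p : ℝ → ℕ} {L : ℕ} (hL : ∀ x, p x < L) (f : ℕ → ℂ) (x : ℝ) :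
    f (p x) = ∑ a ∈ Finset.range L, ia p a x * f a := by
  rw [Finset.sum_eq_single (p x)]
  · simp [ia]
  · intro b _ hb; simp [ia, Ne.symm hb]
  · intro h; exact absurd (Finset.mem_range.2 (hL x)) h

lemma sel_bm {p : ℝ → ℕ} (hp : Measurable p) {L : ℕ} (hL : ∀ x, p x < L) {f : ℕ → ℝ → ℂ}
    (hf : ∀ a < L, BM (f a)) : BM (fun x => f (p x) x) := by
  have : (fun x => f (p x) x) = fun x => ∑ a ∈ Finset.range L, ia p a x * f a x := by
    funext x; exact ia_sum hL (fun a => f a x) x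
  rw [this]
  exact BM.sum _ fun a ha => (ia_bm hp a).mul (hf a (Finset.mem_range.1 ha))

lemma ia_int {p : ℝ → ℕ} (hp : Measurable p) {L : ℕ} (hL : ∀ x, p x < L) {f : ℕ → ℝ → ℂ}
    (hf : ∀ a < L, BM (f a)) {g : ℝ → ℂ} (hg : BM g) {κ : ℝ}
    (h : ∀ a < L, ‖∫ x, g x * ia p a x * f a x ∂mu01‖ ≤ κ) :
    ‖∫ x, g x * f (p x) x ∂mu01‖ ≤ L * κ := by
  have : ∀ x, g x * f (p x) x = ∑ a ∈ Finset.range L, g x * ia p a x * f a x := by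
    intro x
    rw [ia_sum hL (fun a => f a x) x, Finset.mul_sum]
    exact Finset.sum_congr rfl fun a _ => by ring
  simp_rw [this]
  rw [integral_finsetSum]
  · refine (norm_sum_le _ _).trans ?_
    refine (Finset.sum_le_card_nsmul _ _ κ fun a ha => h a (Finset.mem_range.1 ha)).trans ?_
    simp
  · intro a ha
    exact ((hg.mul (ia_bm hp a)).mul (hf a (Finset.mem_range.1 ha))).integrable

/-- the deviation at one level -/
noncomputable def WW (L : ℕ) (p bit : ℝ → ℕ) (T : ℕ → ℝ → ℂ) (M : ℕ → ℕ) (x : ℝ) : ℂ :=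
  ∑ a ∈ Finset.range L, (if 2 * a + 1 ≤ 2 * p x + bit x then T a x * trigChar (M a) x else 0)
    - (if bit x = 1 then trigChar (M (p x)) x else 0)

lemma WW_bm {L : ℕ} {p bit : ℝ → ℕ} {T : ℕ → ℝ → ℂ} {M : ℕ → ℕ} (hp : Measurable p)
    (hL : ∀ x, p x < L) (hb : Measurable bit) (hT : ∀ a, BM (T a)) : BM (WW L p bit T M) := by
  refine BM.sub (BM.sum _ fun a _ => ?_) ?_
  · exact BM.ite ((hT a).mul (BM.tc _)) (BM.const 0)
      (measurableSet_le measurable_const ((hp.const_mul 2).add hb))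
  · exact BM.ite (sel_bm hp hL (f := fun a => trigChar (M a)) fun a _ => BM.tc _) (BM.const 0)
      (hb (measurableSet_singleton 1))

lemma W_est {L : ℕ} {p bit : ℝ → ℕ} {T : ℕ → ℝ → ℂ} {M : ℕ → ℕ} (hp : Measurable p)
    (hL : ∀ x, p x < L) (hb : Measurable bit) (hb2 : ∀ x, bit x < 2) (hT : ∀ a, BM (T a))
    {κ : ℝ} (hκ : 0 ≤ κ)
    (h : ∀ a < L, ∀ b < a, ‖∫ x, (if a < p x then T a x else 0) *
      (starRingEnd ℂ) (if b < p x then T b x else 0) * trigChar ((M a : ℤ) - M b) x ∂mu01‖ ≤ κ) :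
    ∫ x, ‖WW L p bit T M x‖ ^ 2 ∂mu01
      ≤ 4 * ∑ a ∈ Finset.range L, ∫ x, ‖ia p a x - T a x‖ ^ 2 ∂mu01 + 2 * (L:ℝ) ^ 2 * κ := by
  set f : ℕ → ℝ → ℂ := fun a x => (if a < p x then T a x else 0) * trigChar (M a) x with hf
  have hfb : ∀ a, BM (f a) := fun a =>
    (BM.ite (hT a) (BM.const 0) (measurableSet_lt measurable_const hp)).mul (BM.tc _)
  have horth := almost_orth L f (fun a _ => hfb a) (fun _ => 1) (fun _ => zero_le_one) κ hκ (by
    intro a ha b hb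
    convert h a ha b hb using 4
    rename_i x
    simp only [hf, map_mul, tc_conj]
    rw [sub_eq_add_neg, tc_add]; ring)
  simp only [Complex.ofReal_one, one_mul, one_pow, Finset.sum_const, Finset.card_range,
    nsmul_eq_mul, mul_one] at horth
  have hdb : ∀ a, BM (fun x => ia p a x - T a x) := fun a => (ia_bm hp a).sub (hT a)
  have hF : BM (fun x => ∑ a ∈ Finset.range L, f a x) := BM.sum _ fun a _ => hfb a
  have hdi : Integrable (fun x => ∑ a ∈ Finset.range L, ‖ia p a x - T a x‖ ^ 2) mu01 :=
    integrable_finsetSum _ fun a _ => (hdb a).sq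
  have hpt : ∀ x, ‖WW L p bit T M x‖ ^ 2 ≤ 2 * ‖∑ a ∈ Finset.range L, f a x‖ ^ 2
      + 2 * ∑ a ∈ Finset.range L, ‖ia p a x - T a x‖ ^ 2 := by
    intro x
    have e : WW L p bit T M x = ∑ a ∈ Finset.range L, f a x
        + (if bit x = 1 then (T (p x) x - 1) * trigChar (M (p x)) x else 0) := by
      have h1 : ∀ a ∈ Finset.range L,
          (if 2 * a + 1 ≤ 2 * p x + bit x then T a x * trigChar (M a) x else 0)
          = f a x + (if a = p x then (if bit x = 1 then T a x * trigChar (M a) x else 0) else 0) := by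
        intro a _
        have := hb2 x
        simp only [hf]
        rcases lt_trichotomy a (p x) with h1 | h1 | h1
        · rw [if_pos (by omega), if_pos h1, if_neg (by omega), add_zero]
        · rw [if_neg (show ¬ a < p x by omega), if_pos h1]
          by_cases hbit : bit x = 1
          · rw [if_pos (by omega), if_pos hbit]; ring
          · rw [if_neg (by omega), if_neg hbit]; ring
        · rw [if_neg (by omega), if_neg (by omega), if_neg (by omega)]; ring
      unfold WW
      rw [Finset.sum_congr rfl h1, Finset.sum_add_distrib, Finset.sum_ite_eq' (Finset.range L),
        if_pos (Finset.mem_range.2 (hL x))]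
      split_ifs <;> ring
    rw [e]
    refine (nsq_add_le _ _).trans ?_
    have : ‖(if bit x = 1 then (T (p x) x - 1) * trigChar (M (p x)) x else 0)‖ ^ 2
        ≤ ∑ a ∈ Finset.range L, ‖ia p a x - T a x‖ ^ 2 := by
      refine le_trans ?_ (Finset.single_le_sum (f := fun a => ‖ia p a x - T a x‖ ^ 2)
        (fun _ _ => by positivity) (Finset.mem_range.2 (hL x)))
      split_ifs
      · simp [ia, tc_norm, norm_sub_rev]
      · simp
    linarith
  have i1 := integral_mono (WW_bm (M := M) hp hL hb hT).sq ((hF.sq.const_mul 2).add (hdi.const_mul 2)) hpt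
  have i2 : ∫ x, (2 * ‖∑ a ∈ Finset.range L, f a x‖ ^ 2
      + 2 * ∑ a ∈ Finset.range L, ‖ia p a x - T a x‖ ^ 2) ∂mu01
      = 2 * ∫ x, ‖∑ a ∈ Finset.range L, f a x‖ ^ 2 ∂mu01
        + 2 * ∑ a ∈ Finset.range L, ∫ x, ‖ia p a x - T a x‖ ^ 2 ∂mu01 := by
    rw [integral_add (hF.sq.const_mul 2) (hdi.const_mul 2), integral_const_mul, integral_const_mul,
      integral_finsetSum]
    intro a _; exact (hdb a).sq
  have i3 : ∑ a ∈ Finset.range L, ∫ x, ‖f a x‖ ^ 2 ∂mu01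
      ≤ ∑ a ∈ Finset.range L, ∫ x, ‖ia p a x - T a x‖ ^ 2 ∂mu01 := by
    refine Finset.sum_le_sum fun a _ => integral_mono (hfb a).sq (hdb a).sq fun x => ?_
    simp only [hf, ia]
    split_ifs with h1 h2 h2
    · omega
    · simp [tc_norm]
    · simp
    · simp
  have i1' : ∫ x, ‖WW L p bit T M x‖ ^ 2 ∂mu01 ≤ ∫ x, (2 * ‖∑ a ∈ Finset.range L, f a x‖ ^ 2
      + 2 * ∑ a ∈ Finset.range L, ‖ia p a x - T a x‖ ^ 2) ∂mu01 := i1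
  rw [i2] at i1'
  linarith

/-- truncation -/
lemma trunc_est {g : ℝ → ℂ} (hg : BM g) (S : Finset ℤ) (c : ℤ → ℂ) (r : ℝ) (hr : 0 < r) :
    ∫ x, ‖g x - tp (S.filter fun t => |(t:ℝ)| ≤ r) c x‖ ^ 2 ∂mu01
      ≤ 2 * ∫ x, ‖g x - tp S c x‖ ^ 2 ∂mu01
        + 2 * ((∑ t ∈ S, ‖c t‖ ^ 2 * Real.sqrt |(t:ℝ)|) / Real.sqrt r) := by
  have hb1 := hg.sub (tp_bm S c)
  have hb2 := tp_bm (S.filter fun t => ¬ |(t:ℝ)| ≤ r) c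
  have e : ∀ x, g x - tp (S.filter fun t => |(t:ℝ)| ≤ r) c x
      = (g x - tp S c x) + tp (S.filter fun t => ¬ |(t:ℝ)| ≤ r) c x := by
    intro x
    have : tp S c x = tp (S.filter fun t => |(t:ℝ)| ≤ r) c x + tp (S.filter fun t => ¬ |(t:ℝ)| ≤ r) c x := by
      unfold tp; rw [Finset.sum_filter_add_sum_filter_not]
    rw [this]; ring
  simp_rw [e]
  have i1 := integral_mono (hb1.add hb2).sq ((hb1.sq.const_mul 2).add (hb2.sq.const_mul 2))
    fun x => nsq_add_le (g x - tp S c x) (tp (S.filter fun t => ¬ |(t:ℝ)| ≤ r) c x)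
  refine i1.trans ?_
  simp only [Pi.add_apply]
  rw [integral_add (hb1.sq.const_mul 2) (hb2.sq.const_mul 2), integral_const_mul, integral_const_mul,
    tp_energy]
  have : ∑ t ∈ S.filter (fun t : ℤ => ¬ |(t:ℝ)| ≤ r), ‖c t‖ ^ 2
      ≤ (∑ t ∈ S, ‖c t‖ ^ 2 * Real.sqrt |(t:ℝ)|) / Real.sqrt r := by
    rw [le_div_iff₀ (Real.sqrt_pos.2 hr), Finset.sum_mul]
    refine (Finset.sum_le_sum fun t ht => ?_).trans
      (Finset.sum_le_sum_of_subset_of_nonneg (Finset.filter_subset _ _) fun _ _ _ => by positivity)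
    have h1 := (Finset.mem_filter.1 ht).2
    exact mul_le_mul_of_nonneg_left (Real.sqrt_le_sqrt (not_le.1 h1).le) (by positivity)
  linarith


def CB (P : ℕ → Prop) (u : ℕ) : Prop := ∀ F : Finset ℕ, (∀ M ∈ F, P M) → F.card ≤ u

lemma CB.or {P P' : ℕ → Prop} {u u' : ℕ} (h : CB P u) (h' : CB P' u') :
    CB (fun M => P M ∨ P' M) (u + u') := by
  classical
  intro F hF
  have hs : F ⊆ F.filter P ∪ F.filter P' := by
    intro M hM
    rcases hF M hM with h1 | h1
    · exact Finset.mem_union_left _ (Finset.mem_filter.2 ⟨hM, h1⟩)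
    · exact Finset.mem_union_right _ (Finset.mem_filter.2 ⟨hM, h1⟩)
  refine (Finset.card_le_card hs).trans ((Finset.card_union_le _ _).trans ?_)
  exact add_le_add (h _ fun M hM => (Finset.mem_filter.1 hM).2) (h' _ fun M hM => (Finset.mem_filter.1 hM).2)

lemma CB.ex {P : ℕ → ℕ → Prop} {u : ℕ} (m : ℕ) (h : ∀ n < m, CB (P n) u) :
    CB (fun M => ∃ n < m, P n M) (m * u) := by
  induction m with
  | zero =>
    intro F hF
    have : F = ∅ := Finset.eq_empty_of_forall_notMem fun M hM => by
      obtain ⟨n, hn, _⟩ := hF M hM; omega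
    simp [this]
  | succ m ih =>
    have h1 := (ih fun n hn => h n (by omega)).or (h m (by omega))
    intro F hF
    have := h1 F fun M hM => by
      obtain ⟨n, hn, hp⟩ := hF M hM
      rcases Nat.lt_succ_iff_lt_or_eq.1 hn with h2 | rfl
      · exact Or.inl ⟨n, h2, hp⟩
      · exact Or.inr hp
    rw [Nat.succ_mul]; exact this

lemma CB.large {g : ℝ → ℂ} (hg : BM g) {X q : ℕ} (hq : 1 ≤ q) (hX : ∀ x, ‖g x‖ ≤ X)
    (k : ℤ) (hk : k ≠ 0) :
    CB (fun M => 1 / (q:ℝ) ^ 2 < ‖∫ x, g x * trigChar (k * M) x ∂mu01‖) (X ^ 2 * q ^ 4) := by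
  intro F hF
  have hq0 : (0:ℝ) < q := by exact_mod_cast hq
  have h := count_large hg hX (show 0 < 1 / (q:ℝ) ^ 2 by positivity) k hk F hF
  have e : (X:ℝ) ^ 2 / (1 / (q:ℝ) ^ 2) ^ 2 = ((X ^ 2 * q ^ 4 : ℕ) : ℝ) := by
    push_cast; field_simp
  rw [e] at h
  exact_mod_cast h

structure St where
  p : ℝ → ℕ
  S : ℕ → Finset ℤ
  c : ℕ → ℤ → ℂ
  G : ℕ → ℝ → ℂ

structure LInv (B : ℝ) (Q j0 j : ℕ) (st : St) : Prop where
  pm : Measurable st.p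
  pl : ∀ x, st.p x < 2 ^ j
  card : ∀ a < 2 ^ j, (st.S a).card ≤ Q ^ (10 * j)
  hpw : ∀ a < 2 ^ j, ∑ t ∈ st.S a, pw (st.c a t) ≤ B ^ j
  en : ∑ a ∈ Finset.range (2 ^ j), ∑ t ∈ st.S a, ‖st.c a t‖ ^ 2 ≤ 1
  mo : ∑ a ∈ Finset.range (2 ^ j), ∑ t ∈ st.S a, ‖st.c a t‖ ^ 2 * Real.sqrt |(t:ℝ)|
    ≤ (Q:ℝ) ^ (50 * (j + j0)) / Q
  er : ∑ a ∈ Finset.range (2 ^ j), ∫ x, ‖ia st.p a x - tp (st.S a) (st.c a) x‖ ^ 2 ∂mu01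
    ≤ (1 - 1 / 2 ^ j) / Q
  Gb : ∀ n, BM (st.G n)
  G1 : ∀ n x, ‖st.G n x‖ ≤ 1

/-- truncated support -/
noncomputable def St.F (st : St) (r : ℕ) (a : ℕ) : Finset ℤ :=
  (st.S a).filter fun t => |(t:ℝ)| ≤ (r:ℝ) / 2

structure Out (Q j0 j : ℕ) (st st' : St) (M : ℕ → ℕ) : Prop where
  M1 : ∀ a < 2 ^ j, Q ^ (100 * (j + j0)) ≤ M a ∧ M a < 2 * Q ^ (100 * (j + j0))
  dis : ∀ a < 2 ^ j, ∀ b < a, ∀ t ∈ st.S a, ∀ t' ∈ st.S b, (M a : ℤ) + t ≠ M b + t'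
  hp : ∀ x, st'.p x = 2 * st.p x + bitf (M (st.p x) * x)
  W : ∫ x, ‖WW (2 ^ j) st.p (fun x => bitf (M (st.p x) * x))
    (fun a => tp (st.F (Q ^ (100 * (j + j0))) a) (st.c a)) M x‖ ^ 2 ∂mu01 ≤ 25 / Q
  Y : ∀ n < 2 * j, ‖∫ x, st.G n x * trigChar (M (st.p x)) x ∂mu01‖ ≤ 1 / Q
  Z : ∀ n < 2 * j, ‖∫ x, st.G n x * trigChar (2 * M (st.p x)) x ∂mu01‖ ≤ 1 / Q
  hG : ∀ n x, st'.G n x = if n = 2 * j then (starRingEnd ℂ) (trigChar (M (st.p x)) x)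
    else if n = 2 * j + 1 then (starRingEnd ℂ) (trigChar (2 * M (st.p x)) x) else st.G n x

lemma num1 (Q j : ℕ) (hQ : 256 ≤ Q) : 256 * (2 ^ j) ^ 3 ≤ Q ^ (j + 1) := by
  have h1 : (8:ℕ) ^ j ≤ Q ^ j := Nat.pow_le_pow_left (by omega) j
  have h2 : ((2:ℕ) ^ j) ^ 3 = 8 ^ j := by rw [← pow_mul, mul_comm, pow_mul]; norm_num
  rw [h2, pow_succ, mul_comm]
  exact Nat.mul_le_mul h1 hQ

lemma num2 (q L j : ℕ) (hq : 256 * L ^ 3 ≤ q) (hL : 1 ≤ L) (hj : j ≤ L) :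
    (((2 * q ^ 24 + 1) * q ^ 10) ^ 2 + (2 * j * (1 ^ 2 * q ^ 4) + 2 * j * (1 ^ 2 * q ^ 4)))
      + L * (q ^ 10 * q ^ 10 + (q ^ 20) ^ 2 * q ^ 4) < q ^ 100 := by
  have hL3 : L ≤ L ^ 3 := Nat.le_self_pow (by norm_num) L
  have hLq : 256 * L ≤ q := by omega
  have hq256 : 256 ≤ q := by omega
  have hpow : ∀ m n : ℕ, m ≤ n → q ^ m ≤ q ^ n := fun m n h => Nat.pow_le_pow_right (by omega) h
  have h1 : 2 * q ^ 24 + 1 ≤ q ^ 25 := by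
    have : 1 ≤ q ^ 24 := Nat.one_le_pow _ _ (by omega)
    have e : q ^ 25 = q ^ 24 * q := pow_succ _ _
    nlinarith
  have h2 : ((2 * q ^ 24 + 1) * q ^ 10) ^ 2 ≤ q ^ 70 := by
    calc _ ≤ (q ^ 25 * q ^ 10) ^ 2 := Nat.pow_le_pow_left (Nat.mul_le_mul_right _ h1) 2
      _ = q ^ 70 := by ring
  have h3 : 2 * j * (1 ^ 2 * q ^ 4) + 2 * j * (1 ^ 2 * q ^ 4) ≤ q ^ 70 := by
    calc _ = (4 * j) * q ^ 4 := by ring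
      _ ≤ q * q ^ 4 := Nat.mul_le_mul_right _ (by omega)
      _ = q ^ 5 := by ring
      _ ≤ q ^ 70 := hpow _ _ (by norm_num)
  have h4 : L * (q ^ 10 * q ^ 10 + (q ^ 20) ^ 2 * q ^ 4) ≤ q ^ 70 + q ^ 70 := by
    calc _ ≤ q * (q ^ 10 * q ^ 10 + (q ^ 20) ^ 2 * q ^ 4) := Nat.mul_le_mul_right _ (by omega)
      _ = q ^ 21 + q ^ 45 := by ring
      _ ≤ _ := add_le_add (hpow _ _ (by norm_num)) (hpow _ _ (by norm_num))
  have h5 : q ^ 71 ≤ q ^ 100 := hpow _ _ (by norm_num)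
  have h6 : q ^ 71 = q ^ 70 * q := pow_succ _ _
  have h7 : 1 ≤ q ^ 70 := Nat.one_le_pow _ _ (by omega)
  nlinarith

lemma LInv.csum {B : ℝ} {Q j0 j : ℕ} {st : St} (h : LInv B Q j0 j st) (hQ : 1 ≤ Q) {a : ℕ} (ha : a < 2 ^ j)
    (S : Finset ℤ) (hS : S ⊆ st.S a) : ∑ t ∈ S, ‖st.c a t‖ ≤ ((Q ^ (j + 1)) ^ 10 : ℕ) := by
  have h1 : ∀ t ∈ S, ‖st.c a t‖ ≤ 1 := by
    intro t ht
    have e1 : ‖st.c a t‖ ^ 2 ≤ ∑ t ∈ st.S a, ‖st.c a t‖ ^ 2 :=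
      Finset.single_le_sum (f := fun t => ‖st.c a t‖ ^ 2) (fun _ _ => by positivity) (hS ht)
    have e2 : ∑ t ∈ st.S a, ‖st.c a t‖ ^ 2 ≤ ∑ a ∈ Finset.range (2 ^ j), ∑ t ∈ st.S a, ‖st.c a t‖ ^ 2 :=
      Finset.single_le_sum (f := fun a => ∑ t ∈ st.S a, ‖st.c a t‖ ^ 2)
        (fun _ _ => Finset.sum_nonneg fun _ _ => by positivity) (Finset.mem_range.2 ha)
    have e3 := e1.trans (e2.trans h.en)
    exact (sq_le_one_iff₀ (norm_nonneg _)).1 e3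
  refine (Finset.sum_le_card_nsmul S _ 1 h1).trans ?_
  rw [nsmul_eq_mul, mul_one]
  have h2 : S.card ≤ (Q ^ (j + 1)) ^ 10 := by
    refine (Finset.card_le_card hS).trans ((h.card a ha).trans ?_)
    rw [← pow_mul]
    exact Nat.pow_le_pow_right hQ (by omega)
  exact_mod_cast h2

/-- choice of the multipliers -/
lemma choose_M {B : ℝ} {Q j0 j : ℕ} {st : St} (h : LInv B Q j0 j st) (hQ : 256 ≤ Q) (hj0 : 1 ≤ j0) (r : ℕ) :
    ∃ M : ℕ → ℕ,
      (∀ a < 2 ^ j, Q ^ (100 * (j + j0)) ≤ M a ∧ M a < 2 * Q ^ (100 * (j + j0))) ∧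
      (∀ a < 2 ^ j, ∀ b < a, ∀ t ∈ st.S a, ∀ t' ∈ st.S b, (M a : ℤ) + t ≠ M b + t') ∧
      (∀ a < 2 ^ j, Set.InjOn (fun p : ℤ × ℤ => p.1 * (M a:ℤ) + p.2)
        (Finset.Icc (-(((Q ^ (j+1)) ^ 24 : ℕ):ℤ)) ((Q ^ (j+1)) ^ 24 : ℕ) ×ˢ st.S a : Finset (ℤ × ℤ))) ∧
      (∀ a < 2 ^ j, ∀ n < 2 * j,
        ‖∫ x, st.G n x * ia st.p a x * trigChar (M a) x ∂mu01‖ ≤ 1 / ((Q ^ (j+1) : ℕ):ℝ) ^ 2) ∧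
      (∀ a < 2 ^ j, ∀ n < 2 * j,
        ‖∫ x, st.G n x * ia st.p a x * trigChar (2 * M a) x ∂mu01‖ ≤ 1 / ((Q ^ (j+1) : ℕ):ℝ) ^ 2) ∧
      (∀ a < 2 ^ j, ∀ b < a, ‖∫ x, (if a < st.p x then tp (st.F r a) (st.c a) x else 0) *
        (starRingEnd ℂ) (if b < st.p x then tp (st.F r b) (st.c b) x else 0)
          * trigChar ((M a : ℤ) - M b) x ∂mu01‖ ≤ 1 / ((Q ^ (j+1) : ℕ):ℝ) ^ 2) := by
  set q := Q ^ (j + 1) with hq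
  have hq1 : 1 ≤ q := Nat.one_le_pow _ _ (by omega)
  have hcard : ∀ a < 2 ^ j, (st.S a).card ≤ q ^ 10 := by
    intro a ha
    refine (h.card a ha).trans ?_
    rw [hq, ← pow_mul]
    exact Nat.pow_le_pow_right (by omega) (by omega)
  set u : ℕ → ℝ → ℂ := fun a x => if a < st.p x then tp (st.F r a) (st.c a) x else 0 with hu
  have hub : ∀ a, BM (u a) := fun a =>
    BM.ite (tp_bm _ _) (BM.const 0) (measurableSet_lt measurable_const h.pm)
  have hu1 : ∀ a < 2 ^ j, ∀ x, ‖u a x‖ ≤ (q ^ 10 : ℕ) := by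
    intro a ha x
    simp only [hu]
    split_ifs
    · exact (tp_le _ _ _).trans (h.csum (by omega) ha _ (Finset.filter_subset _ _))
    · simp
  set U : ℕ → ℕ → Prop := fun a M =>
    ¬ Set.InjOn (fun p : ℤ × ℤ => p.1 * (M:ℤ) + p.2)
        (Finset.Icc (-((q ^ 24 : ℕ):ℤ)) (q ^ 24 : ℕ) ×ˢ st.S a : Finset (ℤ × ℤ)) ∨
    ((∃ n < 2 * j, 1 / (q:ℝ) ^ 2 < ‖∫ x, st.G n x * ia st.p a x * trigChar (1 * M) x ∂mu01‖) ∨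
     (∃ n < 2 * j, 1 / (q:ℝ) ^ 2 < ‖∫ x, st.G n x * ia st.p a x * trigChar (2 * M) x ∂mu01‖)) with hU
  set V : ℕ → ℕ → ℕ → ℕ → Prop := fun a M b M' =>
    (∃ t ∈ st.S a, ∃ t' ∈ st.S b, (M:ℤ) + t = M' + t') ∨
    1 / (q:ℝ) ^ 2 < ‖∫ x, u a x * (starRingEnd ℂ) (u b x) * trigChar (-(M':ℤ)) x * trigChar (1 * M) x ∂mu01‖ with hV
  have hgi : ∀ n a, BM (fun x => st.G n x * ia st.p a x) := fun n a => (h.Gb n).mul (ia_bm h.pm a)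
  have hgi1 : ∀ n a x, ‖st.G n x * ia st.p a x‖ ≤ (1 : ℕ) := by
    intro n a x
    rw [norm_mul]
    have h1 : ‖ia st.p a x‖ ≤ 1 := by unfold ia; split_ifs <;> simp
    have := mul_le_mul (h.G1 n x) h1 (norm_nonneg _) zero_le_one
    simpa using this
  have cU : ∀ a < 2 ^ j, CB (U a) (((2 * q ^ 24 + 1) * q ^ 10) ^ 2
      + (2 * j * (1 ^ 2 * q ^ 4) + 2 * j * (1 ^ 2 * q ^ 4))) := by
    intro a ha
    refine CB.or ?_ (CB.or ?_ ?_)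
    · intro F hF
      refine (count_inj (q ^ 24) (st.S a) F hF).trans ?_
      exact Nat.pow_le_pow_left (Nat.mul_le_mul_left _ (hcard a ha)) 2
    · exact CB.ex (2 * j) fun n _ => CB.large (hgi n a) hq1 (hgi1 n a) 1 one_ne_zero
    · exact CB.ex (2 * j) fun n _ => CB.large (hgi n a) hq1 (hgi1 n a) 2 two_ne_zero
  have cV : ∀ a < 2 ^ j, ∀ b < a, ∀ M', CB (fun M => V a M b M') (q ^ 10 * q ^ 10 + (q ^ 20) ^ 2 * q ^ 4) := by
    intro a ha b hb M'
    refine CB.or ?_ ?_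
    · intro F hF
      exact (count_diff _ _ M' F hF).trans (Nat.mul_le_mul (hcard a ha) (hcard b (by omega)))
    · refine CB.large (((hub a).mul (hub b).star).mul (BM.tc _)) hq1 (fun x => ?_) 1 one_ne_zero
      rw [norm_mul, norm_mul, tc_norm, mul_one, RCLike.norm_conj]
      have := mul_le_mul (hu1 a ha x) (hu1 b (by omega) x) (norm_nonneg _) (Nat.cast_nonneg _)
      refine this.trans (le_of_eq ?_)
      push_cast; ring
  have hnum := num2 q (2 ^ j) j (num1 Q j hQ) Nat.one_le_two_pow Nat.lt_two_pow_self.le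
  have hR : q ^ 100 ≤ Q ^ (100 * (j + j0)) := by
    rw [hq, ← pow_mul]; exact Nat.pow_le_pow_right (by omega) (by omega)
  obtain ⟨M, hM⟩ := select (Q ^ (100 * (j + j0))) (2 ^ j) _ _ U V (fun a ha F => cU a ha F)
    (fun a ha b hb M' F => cV a ha b hb M' F) (hnum.trans_le hR)
  refine ⟨M, fun a ha => ⟨(hM a ha).1, (hM a ha).2.1⟩, ?_, ?_, ?_, ?_, ?_⟩
  · intro a ha b hb t ht t' ht' heq
    exact (hM a ha).2.2.2 b hb (Or.inl ⟨t, ht, t', ht', heq⟩)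
  · intro a ha
    by_contra hc
    exact (hM a ha).2.2.1 (Or.inl hc)
  · intro a ha n hn
    by_contra hc
    refine (hM a ha).2.2.1 (Or.inr (Or.inl ⟨n, hn, ?_⟩))
    rw [one_mul]; exact not_le.1 hc
  · intro a ha n hn
    by_contra hc
    exact (hM a ha).2.2.1 (Or.inr (Or.inr ⟨n, hn, not_le.1 hc⟩))
  · intro a ha b hb
    by_contra hc
    refine (hM a ha).2.2.2 b hb (Or.inr ?_)
    refine (not_le.1 hc).trans_le (le_of_eq ?_)
    congr 1
    refine integral_congr_ae (Eventually.of_forall fun x => ?_)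
    simp only [hu]
    rw [sub_eq_add_neg, tc_add, one_mul]; ring


lemma sum_double (L : ℕ) (g : ℕ → ℝ) :
    ∑ a ∈ Finset.range (2 * L), g a = ∑ a ∈ Finset.range L, (g (2 * a) + g (2 * a + 1)) := by
  induction L with
  | zero => simp
  | succ l ih =>
    rw [show 2 * (l + 1) = 2 * l + 1 + 1 by ring, Finset.sum_range_succ, Finset.sum_range_succ, ih,
      Finset.sum_range_succ]; ring

lemma nsq_add_tau (a b : ℂ) (τ : ℝ) (hτ : 0 < τ) :
    ‖a + b‖ ^ 2 ≤ (1 + τ) * ‖a‖ ^ 2 + (1 + 1 / τ) * ‖b‖ ^ 2 := by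
  have h1 := norm_add_le a b
  have h2 : ‖a + b‖ ^ 2 ≤ (‖a‖ + ‖b‖) ^ 2 := pow_le_pow_left₀ (norm_nonneg _) h1 2
  have h3 : 0 ≤ (τ * ‖a‖ - ‖b‖) ^ 2 / τ := by positivity
  have h4 : (τ * ‖a‖ - ‖b‖) ^ 2 / τ = τ * ‖a‖ ^ 2 - 2 * (‖a‖ * ‖b‖) + 1 / τ * ‖b‖ ^ 2 := by
    field_simp; ring
  nlinarith

lemma err_step {p p' : ℝ → ℕ} (hp : Measurable p) (a M : ℕ) {S S0 S1 : Finset ℤ} {c c0 c1 : ℤ → ℂ}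
    (h0 : ∀ x, ia p' (2 * a) x = ia p a x * ph 0 (M * x))
    (h1 : ∀ x, ia p' (2 * a + 1) x = ia p a x * ph 1 (M * x)) {ρ τ : ℝ} (hτ : 0 < τ)
    (r0 : ∫ x, ‖ph 0 (M * x) * tp S c x - tp S0 c0 x‖ ^ 2 ∂mu01 ≤ ρ)
    (r1 : ∫ x, ‖ph 1 (M * x) * tp S c x - tp S1 c1 x‖ ^ 2 ∂mu01 ≤ ρ) :
    ∫ x, ‖ia p' (2 * a) x - tp S0 c0 x‖ ^ 2 ∂mu01 + ∫ x, ‖ia p' (2 * a + 1) x - tp S1 c1 x‖ ^ 2 ∂mu01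
      ≤ (1 + τ) * ∫ x, ‖ia p a x - tp S c x‖ ^ 2 ∂mu01 + (1 + 1 / τ) * (2 * ρ) := by
  have hD : BM (fun x => ia p a x - tp S c x) := (ia_bm hp a).sub (tp_bm S c)
  have key : ∀ s, ∀ S' : Finset ℤ, ∀ c' : ℤ → ℂ,
      ∫ x, ‖ph s (M * x) * tp S c x - tp S' c' x‖ ^ 2 ∂mu01 ≤ ρ →
      ∫ x, ‖ia p a x * ph s (M * x) - tp S' c' x‖ ^ 2 ∂mu01
        ≤ (1 + τ) * ∫ x, ‖ph s (M * x) * (ia p a x - tp S c x)‖ ^ 2 ∂mu01 + (1 + 1 / τ) * ρ := by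
    intro s S' c' hr
    have hb1 : BM (fun x => ph s (M * x) * (ia p a x - tp S c x)) := (ph_bm_mul s M).mul hD
    have hb2 : BM (fun x => ph s (M * x) * tp S c x - tp S' c' x) :=
      ((ph_bm_mul s M).mul (tp_bm S c)).sub (tp_bm S' c')
    have e : ∀ x, ia p a x * ph s (M * x) - tp S' c' x
        = ph s (M * x) * (ia p a x - tp S c x) + (ph s (M * x) * tp S c x - tp S' c' x) := by
      intro x; ring
    simp_rw [e]
    have i1 : ∫ x, ‖ph s (M * x) * (ia p a x - tp S c x) + (ph s (M * x) * tp S c x - tp S' c' x)‖ ^ 2 ∂mu01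
        ≤ ∫ x, ((1 + τ) * ‖ph s (M * x) * (ia p a x - tp S c x)‖ ^ 2
          + (1 + 1 / τ) * ‖ph s (M * x) * tp S c x - tp S' c' x‖ ^ 2) ∂mu01 :=
      integral_mono (hb1.add hb2).sq ((hb1.sq.const_mul _).add (hb2.sq.const_mul _))
        fun x => nsq_add_tau _ _ τ hτ
    refine i1.trans ?_
    rw [integral_add (hb1.sq.const_mul _) (hb2.sq.const_mul _), integral_const_mul, integral_const_mul]
    have : 0 ≤ 1 + 1 / τ := by positivity
    have := mul_le_mul_of_nonneg_left hr this
    linarith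
  have k0 := key 0 S0 c0 r0
  have k1 := key 1 S1 c1 r1
  simp_rw [h0, h1]
  have hsum : ∫ x, ‖ph 0 (M * x) * (ia p a x - tp S c x)‖ ^ 2 ∂mu01
      + ∫ x, ‖ph 1 (M * x) * (ia p a x - tp S c x)‖ ^ 2 ∂mu01
      = ∫ x, ‖ia p a x - tp S c x‖ ^ 2 ∂mu01 := by
    rw [← integral_add ((ph_bm_mul 0 M).mul hD).sq ((ph_bm_mul 1 M).mul hD).sq]
    refine integral_congr_ae (Eventually.of_forall fun x => ?_)
    simp only [norm_mul, mul_pow, ph, bitf]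
    split_ifs <;> simp_all
  rw [← hsum]
  linarith

lemma sqrt_eta (q : ℝ) (hq : 0 < q) : Real.sqrt (1 / q ^ 6) = 1 / q ^ 3 := by
  rw [Real.sqrt_eq_iff_mul_self_eq (by positivity) (by positivity)]
  field_simp

lemma level_step {B : ℝ} (hB : ∀ F : Finset ℤ, ∑ n ∈ F, gg n ≤ B) (hB1 : 1 ≤ B)
    {Q j0 j : ℕ} {st : St} (h : LInv B Q j0 j st) (hQ : 256 ≤ Q) (hQB : 10 * B ≤ Q) (hj0 : 1 ≤ j0) :
    ∃ (M : ℕ → ℕ) (st' : St), LInv B Q j0 (j + 1) st' ∧ Out Q j0 j st st' M := by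
  obtain ⟨M, M1, Mdis, Minj, MY, MZ, MW⟩ := choose_M h hQ hj0 (Q ^ (100 * (j + j0)))
  set qn := Q ^ (j + 1) with hqn
  set q : ℝ := (qn : ℝ) with hq
  set L : ℝ := 2 ^ j with hL
  have hL1 : 1 ≤ L := one_le_pow₀ (by norm_num)
  have hqL : 256 * L ^ 3 ≤ q := by
    have := num1 Q j hQ
    rw [hq, hqn, hL]; exact_mod_cast this
  have hLL3 : L ≤ L ^ 3 := le_self_pow₀ hL1 (by norm_num)
  have hLL2 : L ^ 2 ≤ L ^ 3 := pow_le_pow_right₀ hL1 (by norm_num)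
  have hQR : (256:ℝ) ≤ Q := by exact_mod_cast hQ
  have hQ0 : (0:ℝ) < Q := by linarith
  have hq0 : 0 < q := by nlinarith
  have hqQ : (Q:ℝ) ≤ q := by
    have : Q ≤ Q ^ (j + 1) := Nat.le_self_pow (by omega) Q
    rw [hq, hqn]; exact_mod_cast this
  have hBq : B * B ^ j ≤ q := by
    have h1 : B * B ^ j = B ^ (j + 1) := by ring
    have h2 : B ^ (j+1) ≤ (Q:ℝ) ^ (j+1) := pow_le_pow_left₀ (by linarith) (by linarith) _
    rw [h1, hq, hqn]; push_cast; exact h2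
  have hR1 : 1 ≤ Q ^ (100 * (j + j0)) := Nat.one_le_pow _ _ (by omega)
  have hN1 : 1 ≤ qn ^ 24 := Nat.one_le_pow _ _ (Nat.one_le_pow _ _ (by omega))
  have hstep : ∀ a s : ℕ, ∃ (S' : Finset ℤ) (c' : ℤ → ℂ), a < 2 ^ j → s < 2 →
      (∑ t ∈ S', ‖c' t‖ ^ 2 ≤ 1 / 2 * ∑ t ∈ st.S a, ‖st.c a t‖ ^ 2 ∧
      ∑ t ∈ S', pw (c' t) ≤ B * ∑ t ∈ st.S a, pw (st.c a t) ∧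
      S'.card * ((1 / q ^ 6) * Real.sqrt (1 / q ^ 6)) ≤ B * ∑ t ∈ st.S a, pw (st.c a t) ∧
      ∑ t ∈ S', ‖c' t‖ ^ 2 * Real.sqrt |(t:ℝ)| ≤ 1 / 2 * ∑ t ∈ st.S a, ‖st.c a t‖ ^ 2 * Real.sqrt |(t:ℝ)|
        + B * Real.sqrt (M a) * ∑ t ∈ st.S a, ‖st.c a t‖ ^ 2 ∧
      ∫ x, ‖ph s (M a * x) * tp (st.S a) (st.c a) x - tp S' c' x‖ ^ 2 ∂mu01
        ≤ 2 * (∑ t ∈ st.S a, ‖st.c a t‖) ^ 2 / ((qn ^ 24 : ℕ) : ℝ)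
          + 2 * Real.sqrt (1 / q ^ 6) * (B * ∑ t ∈ st.S a, pw (st.c a t))) := by
    intro a s
    by_cases hc : a < 2 ^ j ∧ s < 2
    · obtain ⟨S', c', hS⟩ := step_node hB s hc.2 (st.S a) (st.c a) (M a) (qn ^ 24)
        (hR1.trans (M1 a hc.1).1) hN1 (1 / q ^ 6) (by positivity)
        (by simpa only [Finset.coe_product] using Minj a hc.1)
      exact ⟨S', c', fun _ _ => hS⟩
    · exact ⟨∅, fun _ => 0, fun h1 h2 => absurd ⟨h1, h2⟩ hc⟩
  choose S' c' hS using hstep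
  have hpwB : ∀ a < 2 ^ j, B * ∑ t ∈ st.S a, pw (st.c a t) ≤ B * B ^ j := fun a ha =>
    mul_le_mul_of_nonneg_left (h.hpw a ha) (by linarith)
  set bit : ℝ → ℕ := fun x => bitf (M (st.p x) * x) with hbit
  have hbm : Measurable bit := by
    refine bitf_meas.comp (Measurable.mul ?_ measurable_id)
    exact (measurable_of_countable (fun n : ℕ => (M n : ℝ))).comp h.pm
  set Y : ℝ → ℂ := fun x => trigChar (M (st.p x)) x with hY
  set Z : ℝ → ℂ := fun x => trigChar (2 * M (st.p x)) x with hZ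
  have hYb : BM Y := sel_bm h.pm h.pl (f := fun a => trigChar (M a)) fun a _ => BM.tc _
  have hZb : BM Z := sel_bm h.pm h.pl (f := fun a => trigChar (2 * M a)) fun a _ => BM.tc _
  set st' : St := ⟨fun x => 2 * st.p x + bit x, fun a => S' (a / 2) (a % 2), fun a => c' (a / 2) (a % 2),
    fun n x => if n = 2 * j then (starRingEnd ℂ) (Y x)
      else if n = 2 * j + 1 then (starRingEnd ℂ) (Z x) else st.G n x⟩ with hst'
  have hbl : ∀ x, bit x < 2 := fun x => bitf_lt _
  have d2 : ∀ a, (2 * a) / 2 = a ∧ (2 * a) % 2 = 0 ∧ (2 * a + 1) / 2 = a ∧ (2 * a + 1) % 2 = 1 := by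
    intro a; omega
  have dd : ∀ a < 2 ^ (j + 1), a / 2 < 2 ^ j ∧ a % 2 < 2 := by
    intro a ha; rw [pow_succ] at ha; omega
  refine ⟨M, st', ?_, ?_⟩
  · constructor
    · exact (h.pm.const_mul 2).add hbm
    · intro x
      have := h.pl x
      have := hbl x
      simp only [hst', pow_succ]; omega
    · intro a ha
      obtain ⟨h1, h2⟩ := dd a ha
      have e := (hS _ _ h1 h2).2.2.1.trans ((hpwB _ h1).trans hBq)
      rw [sqrt_eta q hq0] at e
      have e2 : ((S' (a/2) (a%2)).card : ℝ) ≤ q ^ 10 := by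
        have : ((S' (a/2) (a%2)).card : ℝ) = (S' (a/2) (a%2)).card * (1 / q ^ 6 * (1 / q ^ 3)) * q ^ 9 := by
          field_simp
        rw [this]
        calc _ ≤ q * q ^ 9 := mul_le_mul_of_nonneg_right e (by positivity)
          _ = q ^ 10 := by ring
      have e3 : (S' (a/2) (a%2)).card ≤ qn ^ 10 := by rw [hq] at e2; exact_mod_cast e2
      rw [hqn, ← pow_mul, mul_comm] at e3
      exact e3
    · intro a ha
      obtain ⟨h1, h2⟩ := dd a ha
      refine (hS _ _ h1 h2).2.1.trans ((hpwB _ h1).trans (le_of_eq ?_))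
      ring
    · rw [pow_succ, mul_comm, sum_double]
      refine le_trans (Finset.sum_le_sum fun a ha => ?_) h.en
      have ha := Finset.mem_range.1 ha
      obtain ⟨e1, e2, e3, e4⟩ := d2 a
      simp only [hst', e1, e2, e3, e4]
      have f0 := (hS a 0 ha (by norm_num)).1
      have f1 := (hS a 1 ha (by norm_num)).1
      linarith
    · rw [pow_succ, mul_comm, sum_double]
      set X : ℝ := (Q:ℝ) ^ (50 * (j + j0)) with hX
      have hX0 : 0 < X := by positivity
      have hsq : ∀ a < 2 ^ j, Real.sqrt (M a) ≤ 2 * X := by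
        intro a ha
        rw [Real.sqrt_le_left (by positivity)]
        have h1 : (M a : ℝ) ≤ 2 * (Q:ℝ) ^ (100 * (j + j0)) := by exact_mod_cast (M1 a ha).2.le
        have h2 : (Q:ℝ) ^ (100 * (j + j0)) = X ^ 2 := by rw [hX, ← pow_mul]; congr 1; ring
        rw [h2] at h1
        nlinarith [sq_nonneg X]
      have hterm : ∀ a ∈ Finset.range (2 ^ j),
          (∑ t ∈ st'.S (2 * a), ‖st'.c (2 * a) t‖ ^ 2 * Real.sqrt |(t:ℝ)|
            + ∑ t ∈ st'.S (2 * a + 1), ‖st'.c (2 * a + 1) t‖ ^ 2 * Real.sqrt |(t:ℝ)|)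
          ≤ ∑ t ∈ st.S a, ‖st.c a t‖ ^ 2 * Real.sqrt |(t:ℝ)| + 4 * B * X * ∑ t ∈ st.S a, ‖st.c a t‖ ^ 2 := by
        intro a ha
        have ha := Finset.mem_range.1 ha
        obtain ⟨e1, e2, e3, e4⟩ := d2 a
        simp only [hst', e1, e2, e3, e4]
        have f0 := (hS a 0 ha (by norm_num)).2.2.2.1
        have f1 := (hS a 1 ha (by norm_num)).2.2.2.1
        have hE : 0 ≤ ∑ t ∈ st.S a, ‖st.c a t‖ ^ 2 := Finset.sum_nonneg fun _ _ => by positivity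
        have f2 : B * Real.sqrt (M a) * ∑ t ∈ st.S a, ‖st.c a t‖ ^ 2
            ≤ B * (2 * X) * ∑ t ∈ st.S a, ‖st.c a t‖ ^ 2 :=
          mul_le_mul_of_nonneg_right (mul_le_mul_of_nonneg_left (hsq a ha) (by linarith)) hE
        linarith
      refine (Finset.sum_le_sum hterm).trans ?_
      rw [Finset.sum_add_distrib, ← Finset.mul_sum]
      have g1 := h.mo
      rw [← hX] at g1
      have g2 := mul_le_mul_of_nonneg_left h.en (show 0 ≤ 4 * B * X by positivity)
      have g3 : (Q:ℝ) ^ (50 * (j + 1 + j0)) / Q = X * Q ^ 49 := by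
        rw [hX, show 50 * (j + 1 + j0) = 50 * (j + j0) + 49 + 1 by ring, pow_succ, pow_add]
        field_simp
      rw [g3]
      have g4 : X / Q ≤ X := div_le_self hX0.le (by linarith)
      have g5 : (Q:ℝ) ^ 2 ≤ Q ^ 49 := pow_le_pow_right₀ (by linarith) (by norm_num)
      have g6 : X * (Q:ℝ) ^ 2 ≤ X * Q ^ 49 := mul_le_mul_of_nonneg_left g5 hX0.le
      have g7 : X * (1 + 4 * B) ≤ X * (Q:ℝ) ^ 2 := mul_le_mul_of_nonneg_left (by nlinarith) hX0.le
      nlinarith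
    · rw [pow_succ, mul_comm, sum_double]
      have hτ : 0 < 1 / (4 * L) := by positivity
      have hρ : ∀ a < 2 ^ j, ∀ s < 2, ∫ x, ‖ph s (M a * x) * tp (st.S a) (st.c a) x - tp (S' a s) (c' a s) x‖ ^ 2 ∂mu01
          ≤ 4 / q ^ 2 := by
        intro a ha s hs
        refine (hS a s ha hs).2.2.2.2.trans ?_
        rw [sqrt_eta q hq0]
        have c1 : ∑ t ∈ st.S a, ‖st.c a t‖ ≤ q ^ 10 := by
          have := h.csum (by omega) ha (st.S a) (Finset.Subset.refl _)
          rw [hq]; exact_mod_cast this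
        have c0 : 0 ≤ ∑ t ∈ st.S a, ‖st.c a t‖ := Finset.sum_nonneg fun _ _ => norm_nonneg _
        have c2 : (∑ t ∈ st.S a, ‖st.c a t‖) ^ 2 ≤ (q ^ 10) ^ 2 := pow_le_pow_left₀ c0 c1 2
        have c3 : 2 * (∑ t ∈ st.S a, ‖st.c a t‖) ^ 2 / ((qn ^ 24 : ℕ) : ℝ) ≤ 2 / q ^ 4 := by
          push_cast
          rw [← hq, div_le_div_iff₀ (by positivity) (by positivity)]
          calc 2 * (∑ t ∈ st.S a, ‖st.c a t‖) ^ 2 * q ^ 4 ≤ 2 * (q ^ 10) ^ 2 * q ^ 4 := by gcongr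
            _ = 2 * q ^ 24 := by ring
        have c4 : 2 * (1 / q ^ 3) * (B * ∑ t ∈ st.S a, pw (st.c a t)) ≤ 2 * (1 / q ^ 3) * q :=
          mul_le_mul_of_nonneg_left ((hpwB a ha).trans hBq) (by positivity)
        have c5 : 2 * (1 / q ^ 3) * q = 2 / q ^ 2 := by field_simp
        have c6 : 2 / q ^ 4 ≤ 2 / q ^ 2 := by
          have : 1 ≤ q := by linarith
          exact div_le_div_of_nonneg_left (by norm_num) (by positivity)
            (pow_le_pow_right₀ this (by norm_num))
        have c7 : 4 / q ^ 2 = 2 / q ^ 2 + 2 / q ^ 2 := by ring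
        linarith
      have hterm : ∀ a ∈ Finset.range (2 ^ j),
          (∫ x, ‖ia st'.p (2 * a) x - tp (st'.S (2 * a)) (st'.c (2 * a)) x‖ ^ 2 ∂mu01
          + ∫ x, ‖ia st'.p (2 * a + 1) x - tp (st'.S (2 * a + 1)) (st'.c (2 * a + 1)) x‖ ^ 2 ∂mu01)
          ≤ (1 + 1 / (4 * L)) * ∫ x, ‖ia st.p a x - tp (st.S a) (st.c a) x‖ ^ 2 ∂mu01
            + (1 + 1 / (1 / (4 * L))) * (2 * (4 / q ^ 2)) := by
        intro a ha
        have ha := Finset.mem_range.1 ha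
        obtain ⟨e1, e2, e3, e4⟩ := d2 a
        have hia : ∀ s < 2, ∀ x, ia st'.p (2 * a + s) x = ia st.p a x * ph s (M a * x) := by
          intro s hs x
          have := hbl x
          simp only [hst', ia, ph]
          by_cases hp : st.p x = a
          · have hb : bitf (M a * x) = bit x := by simp only [hbit, hp]
            rw [hb, if_pos hp, one_mul]
            by_cases hb2 : bit x = s
            · rw [if_pos (by omega), if_pos hb2]
            · rw [if_neg (by omega), if_neg hb2]
          · rw [if_neg (by omega), if_neg hp, zero_mul]
        refine err_step h.pm a (M a) (hia 0 (by norm_num)) (hia 1 (by norm_num)) hτ ?_ ?_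
        · simp only [hst', e1, e2]; exact hρ a ha 0 (by norm_num)
        · simp only [hst', e3, e4]; exact hρ a ha 1 (by norm_num)
      refine (Finset.sum_le_sum hterm).trans ?_
      rw [Finset.sum_add_distrib, ← Finset.mul_sum, Finset.sum_const, Finset.card_range, nsmul_eq_mul]
      push_cast
      rw [← hL]
      have g1 := mul_le_mul_of_nonneg_left h.er (show 0 ≤ 1 + 1 / (4 * L) by positivity)
      rw [← hL] at g1
      refine (add_le_add_left g1 _).trans ?_
      have g2 : L * ((1 + 1 / (1 / (4 * L))) * (2 * (4 / q ^ 2))) ≤ 1 / (4 * L * Q) := by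
        have : L * ((1 + 1 / (1 / (4 * L))) * (2 * (4 / q ^ 2))) = (8 * L * (1 + 4 * L)) / q ^ 2 := by
          field_simp; norm_num
        rw [this, div_le_div_iff₀ (by positivity) (by positivity)]
        have k1 : 8 * L * (1 + 4 * L) * (4 * L) ≤ q := by nlinarith
        calc 8 * L * (1 + 4 * L) * (4 * L * Q) = (8 * L * (1 + 4 * L) * (4 * L)) * Q := by ring
          _ ≤ q * q := mul_le_mul k1 hqQ hQ0.le hq0.le
          _ = 1 * q ^ 2 := by ring
      refine (add_le_add_right g2 _).trans ?_
      have : (1 + 1 / (4 * L)) * ((1 - 1 / L) / Q) + 1 / (4 * L * Q)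
          = (1 - 1 / (L * 2) - 1 / (4 * L ^ 2)) / Q := by
        field_simp; ring
      rw [this]
      have g5 : 0 ≤ 1 / (4 * L ^ 2) := by positivity
      refine div_le_div_of_nonneg_right ?_ hQ0.le
      rw [pow_succ (2:ℝ) j, ← hL]
      linarith
    · intro n
      simp only [hst']
      by_cases h1 : n = 2 * j
      · simp only [if_pos h1]; exact hYb.star
      · by_cases h2 : n = 2 * j + 1
        · simp only [if_neg h1, if_pos h2]; exact hZb.star
        · simp only [if_neg h1, if_neg h2]; exact h.Gb n
    · intro n x
      simp only [hst']
      split_ifs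
      · rw [RCLike.norm_conj, hY, tc_norm]
      · rw [RCLike.norm_conj, hZ, tc_norm]
      · exact h.G1 n x
  · have hLκ : ((2 ^ j : ℕ) : ℝ) * (1 / q ^ 2) ≤ 1 / Q := by
      push_cast
      rw [← hL, mul_one_div, div_le_div_iff₀ (by positivity) hQ0]
      nlinarith
    constructor
    · exact M1
    · exact Mdis
    · intro x; rfl
    · have hW := W_est (T := fun a => tp (st.F (Q ^ (100 * (j + j0))) a) (st.c a)) (M := M) h.pm h.pl hbm hbl
        (fun a => tp_bm _ _) (κ := 1 / q ^ 2) (by positivity) MW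
      refine hW.trans ?_
      set r : ℕ := Q ^ (100 * (j + j0)) with hr
      have hr0 : (0:ℝ) < r / 2 := by
        have : (1:ℝ) ≤ r := by exact_mod_cast hR1
        linarith
      set X : ℝ := (Q:ℝ) ^ (50 * (j + j0)) with hX
      have hX0 : 0 < X := by positivity
      have hrX : X / 2 ≤ Real.sqrt ((r:ℝ) / 2) := by
        apply Real.le_sqrt_of_sq_le
        have h2 : (r:ℝ) = X ^ 2 := by rw [hX, hr, ← pow_mul]; push_cast; congr 1; ring
        rw [h2]; nlinarith [sq_nonneg X]
      have t1 : ∑ a ∈ Finset.range (2 ^ j), ∫ x, ‖ia st.p a x - tp (st.F r a) (st.c a) x‖ ^ 2 ∂mu01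
          ≤ 2 * ((1 - 1 / L) / Q) + 2 * (2 / Q) := by
        have := Finset.sum_le_sum fun a (_ : a ∈ Finset.range (2 ^ j)) =>
          trunc_est (ia_bm h.pm a) (st.S a) (st.c a) ((r:ℝ)/2) hr0
        refine this.trans ?_
        rw [Finset.sum_add_distrib, ← Finset.mul_sum, ← Finset.mul_sum, ← Finset.sum_div]
        have g1 := h.er
        have g2 : (∑ a ∈ Finset.range (2 ^ j), ∑ t ∈ st.S a, ‖st.c a t‖ ^ 2 * Real.sqrt |(t:ℝ)|)
            / Real.sqrt ((r:ℝ) / 2) ≤ 2 / Q := by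
          have g3 : (X / Q) / (X / 2) = 2 / Q := by field_simp
          rw [← g3]
          exact div_le_div₀ (by positivity) h.mo (by positivity) hrX
        rw [← hL] at g1
        linarith
      have t2 : 0 ≤ 1 / L := by positivity
      have t3 : (1 - 1 / L) / Q ≤ 1 / Q := div_le_div_of_nonneg_right (by linarith) hQ0.le
      have t4 : 2 * (((2 ^ j : ℕ) : ℝ)) ^ 2 * (1 / q ^ 2) ≤ 1 / Q := by
        push_cast
        rw [← hL, mul_one_div, div_le_div_iff₀ (by positivity) hQ0]
        nlinarith
      have t5 : 25 / (Q:ℝ) = 4 * (2 * (1 / Q) + 2 * (2 / Q)) + 1 / Q := by ring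
      rw [t5]
      linarith
    · intro n hn
      refine le_trans ?_ hLκ
      exact ia_int h.pm h.pl (f := fun a => trigChar (M a)) (fun a _ => BM.tc _) (h.Gb n)
        fun a ha => MY a ha n hn
    · intro n hn
      refine le_trans ?_ hLκ
      exact ia_int h.pm h.pl (f := fun a => trigChar (2 * M a)) (fun a _ => BM.tc _) (h.Gb n)
        fun a ha => MZ a ha n hn
    · intro n x; rfl


noncomputable def st0 : St := ⟨fun _ => 0, fun _ => {0}, fun _ _ => 1, fun _ _ => 0⟩

instance : Nonempty St := ⟨st0⟩

lemma st0_inv (B : ℝ) (Q j0 : ℕ) : LInv B Q j0 0 st0 := by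
  refine ⟨measurable_const, ?_, ?_, ?_, ?_, ?_, ?_, ?_, ?_⟩
  · intro x; simp [st0]
  · intro a _; simp [st0]
  · intro a _; simp [st0, pw]
  · simp [st0]
  · simp [st0]; positivity
  · simp [st0, ia, tp, tc_zero]
  · intro n; exact BM.const 0
  · intro n x; simp [st0]

lemma exists_seq {B : ℝ} (hB : ∀ F : Finset ℤ, ∑ n ∈ F, gg n ≤ B) (hB1 : 1 ≤ B) {Q j0 : ℕ}
    (hQ : 256 ≤ Q) (hQB : 10 * B ≤ Q) (hj0 : 1 ≤ j0) :
    ∃ (st : ℕ → St) (M : ℕ → ℕ → ℕ), ∀ j, LInv B Q j0 j (st j) ∧ Out Q j0 j (st j) (st (j+1)) (M j) := by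
  have H : ∀ (j : ℕ) (st : St), ∃ M st', LInv B Q j0 j st → LInv B Q j0 (j+1) st' ∧ Out Q j0 j st st' M := by
    intro j st
    by_cases h : LInv B Q j0 j st
    · obtain ⟨M, st', h'⟩ := level_step hB hB1 h hQ hQB hj0
      exact ⟨M, st', fun _ => h'⟩
    · exact ⟨fun _ => 0, st, fun h' => absurd h' h⟩
  choose fM fs hf using H
  let st : ℕ → St := fun n => Nat.rec st0 (fun j s => fs j s) n
  have hst : ∀ j, LInv B Q j0 j (st j) := by
    intro j
    induction j with
    | zero => exact st0_inv B Q j0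
    | succ j ih => exact (hf j (st j) ih).1
  exact ⟨st, fun j => fM j (st j), fun j => ⟨hst j, (hf j (st j) (hst j)).2⟩⟩

section
variable {B : ℝ} {Q j0 : ℕ} {st : ℕ → St} {M : ℕ → ℕ → ℕ}

def Chain (B : ℝ) (Q j0 : ℕ) (st : ℕ → St) (M : ℕ → ℕ → ℕ) : Prop :=
  ∀ j, LInv B Q j0 j (st j) ∧ Out Q j0 j (st j) (st (j+1)) (M j)

lemma G_pers (h : Chain B Q j0 st M) (i n : ℕ) (hn : n < 2 * (i + 1)) (k : ℕ) : (st (i + 1 + k)).G n = (st (i + 1)).G n := by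
  induction k with
  | zero => rfl
  | succ k ih =>
    rw [← ih]
    funext x
    rw [show i + 1 + (k + 1) = (i + 1 + k) + 1 by ring, (h (i+1+k)).2.hG, if_neg (by omega), if_neg (by omega)]

lemma Y_orth (h : Chain B Q j0 st M) (j i : ℕ) (hij : i < j) :
    ‖∫ x, trigChar (M j ((st j).p x)) x * (starRingEnd ℂ) (trigChar (M i ((st i).p x)) x) ∂mu01‖ ≤ 1 / Q := by
  have h1 := (h j).2.Y (2 * i) (by omega)
  obtain ⟨k, rfl⟩ : ∃ k, j = i + 1 + k := ⟨j - (i + 1), by omega⟩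
  rw [G_pers h i (2 * i) (by omega) k] at h1
  convert h1 using 3
  funext x
  rw [(h i).2.hG, if_pos rfl, mul_comm]

lemma Z_orth (h : Chain B Q j0 st M) (j i : ℕ) (hij : i < j) :
    ‖∫ x, trigChar (2 * M j ((st j).p x)) x * (starRingEnd ℂ) (trigChar (2 * M i ((st i).p x)) x) ∂mu01‖ ≤ 1 / Q := by
  have h1 := (h j).2.Z (2 * i + 1) (by omega)
  obtain ⟨k, rfl⟩ : ∃ k, j = i + 1 + k := ⟨j - (i + 1), by omega⟩
  rw [G_pers h i (2 * i + 1) (by omega) k] at h1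
  convert h1 using 3
  funext x
  rw [(h i).2.hG, if_neg (by omega), if_pos rfl, mul_comm]

lemma Y_bm (h : Chain B Q j0 st M) (j : ℕ) : BM (fun x => trigChar (M j ((st j).p x)) x) :=
  sel_bm (f := fun a => trigChar (M j a)) (h j).1.pm (h j).1.pl (fun a _ => BM.tc _)

lemma Z_bm (h : Chain B Q j0 st M) (j : ℕ) : BM (fun x => trigChar (2 * M j ((st j).p x)) x) :=
  sel_bm (f := fun a => trigChar (2 * M j a)) (h j).1.pm (h j).1.pl (fun a _ => BM.tc _)

lemma p_shift (h : Chain B Q j0 st M) (j k : ℕ) (x : ℝ) : (st (j + k)).p x / 2 ^ k = (st j).p x := by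
  induction k with
  | zero => simp
  | succ k ih =>
    rw [← ih, ← add_assoc, (h (j + k)).2.hp, pow_succ', ← Nat.div_div_eq_div_mul]
    congr 1
    have := bitf_lt (M (j + k) ((st (j + k)).p x) * x)
    omega

end


noncomputable def VV (Q j0 : ℕ) (st : ℕ → St) (M : ℕ → ℕ → ℕ) (j : ℕ) (x : ℝ) : ℂ :=
  ∑ a ∈ Finset.range (2 ^ j), if 2 * a + 1 ≤ (st (j+1)).p x then
    tp ((st j).F (Q ^ (100 * (j + j0))) a) ((st j).c a) x * trigChar (M j a) x else 0

lemma bit_sin (m : ℤ) (x : ℝ) :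
    (1 - (trigChar (2 * m) x).re) / 4 + (trigChar m x).im / 2
      ≤ (if bitf (m * x) = 1 then trigChar m x else 0 : ℂ).im := by
  have h2 : (trigChar (2 * m) x).re = 1 - 2 * (trigChar m x).im ^ 2 := by
    rw [tc_re, tc_im, show 2 * Real.pi * ((2 * m : ℤ):ℝ) * x = 2 * (2 * Real.pi * m * x) by push_cast; ring,
      Real.cos_two_mul, Real.cos_sq']
    ring
  rw [h2]
  have hs : (trigChar m x).im = Real.sin (2 * Real.pi * Int.fract (m * x)) := by
    rw [tc_im, show 2 * Real.pi * m * x = 2 * Real.pi * Int.fract (m * x) + (⌊(m * x : ℝ)⌋ : ℤ) * (2 * Real.pi) by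
      have := Int.fract_add_floor (m * x : ℝ)
      linear_combination (-2 * Real.pi) * this, Real.sin_add_int_mul_two_pi]
  have hp := Real.pi_pos
  have f0 := Int.fract_nonneg (m * x : ℝ)
  have f1 := Int.fract_lt_one (m * x : ℝ)
  have b1 : (trigChar m x).im ≤ 1 := by rw [hs]; exact Real.sin_le_one _
  have b2 : -1 ≤ (trigChar m x).im := by rw [hs]; exact Real.neg_one_le_sin _
  unfold bitf
  split_ifs with h1 h3 h3
  · have : 0 ≤ (trigChar m x).im := by
      rw [hs]; exact Real.sin_nonneg_of_nonneg_of_le_pi (by positivity) (by nlinarith)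
    nlinarith
  · exact absurd rfl h3
  · exact absurd h3 (by norm_num)
  · have : (trigChar m x).im ≤ 0 := by
      rw [hs, ← Real.sin_sub_two_pi]
      refine Real.sin_nonpos_of_nonpos_of_neg_pi_le (by nlinarith) (by push Not at h1; nlinarith)
    simp only [Complex.zero_im]
    nlinarith

section
variable {B : ℝ} {Q j0 : ℕ} {st : ℕ → St} {M : ℕ → ℕ → ℕ}

noncomputable def WJ (Q j0 : ℕ) (st : ℕ → St) (M : ℕ → ℕ → ℕ) (j : ℕ) : ℝ → ℂ :=
  WW (2 ^ j) (st j).p (fun x => bitf (M j ((st j).p x) * x))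
    (fun a => tp ((st j).F (Q ^ (100 * (j + j0))) a) ((st j).c a)) (M j)

lemma WJ_bm (h : Chain B Q j0 st M) (j : ℕ) : BM (WJ Q j0 st M j) := by
  refine WW_bm (h j).1.pm (h j).1.pl ?_ fun a => tp_bm _ _
  refine bitf_meas.comp (Measurable.mul ?_ measurable_id)
  exact (measurable_from_top (f := fun n : ℕ => ((M j n : ℕ) : ℝ))).comp (h j).1.pm

lemma VV_eq (h : Chain B Q j0 st M) (j : ℕ) (x : ℝ) :
    VV Q j0 st M j x = WJ Q j0 st M j x +
      (if bitf (((M j ((st j).p x) : ℤ):ℝ) * x) = 1 then trigChar (M j ((st j).p x)) x else 0) := by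
  unfold WJ WW VV
  rw [(h j).2.hp]
  simp

lemma S_lower (h : Chain B Q j0 st M) (J : ℕ) (β : ℕ → ℝ) (hβ : ∀ j, 0 ≤ β j)
    (h8 : ∑ j ∈ Finset.range J, β j = 8) (x : ℝ) :
    2 - ‖∑ j ∈ Finset.range J, (β j : ℂ) * trigChar (2 * M j ((st j).p x)) x‖
      - ‖∑ j ∈ Finset.range J, (β j : ℂ) * trigChar (M j ((st j).p x)) x‖
      - ‖∑ j ∈ Finset.range J, (β j : ℂ) * WJ Q j0 st M j x‖
      ≤ ‖∑ j ∈ Finset.range J, (β j : ℂ) * VV Q j0 st M j x‖ := by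
  set A := ∑ j ∈ Finset.range J, (β j : ℂ) * trigChar (2 * M j ((st j).p x)) x with hA
  set D := ∑ j ∈ Finset.range J, (β j : ℂ) * trigChar (M j ((st j).p x)) x with hD
  set W := ∑ j ∈ Finset.range J, (β j : ℂ) * WJ Q j0 st M j x with hW
  set T := ∑ j ∈ Finset.range J, (β j : ℂ) *
    (if bitf (((M j ((st j).p x) : ℤ):ℝ) * x) = 1 then trigChar (M j ((st j).p x)) x else 0 : ℂ) with hT
  have e : ∑ j ∈ Finset.range J, (β j : ℂ) * VV Q j0 st M j x = W + T := by
    rw [hW, hT, ← Finset.sum_add_distrib]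
    exact Finset.sum_congr rfl fun j _ => by rw [VV_eq h, mul_add]
  have hi : 2 - A.re / 4 + D.im / 2 ≤ T.im := by
    have e2 : 2 - A.re / 4 + D.im / 2 = ∑ j ∈ Finset.range J, β j *
        ((1 - (trigChar (2 * M j ((st j).p x)) x).re) / 4 + (trigChar (M j ((st j).p x)) x).im / 2) := by
      have h2 : (2:ℝ) = ∑ j ∈ Finset.range J, β j / 4 := by rw [← Finset.sum_div, h8]; norm_num
      have hA2 : A.re / 4 = ∑ j ∈ Finset.range J, β j * (trigChar (2 * M j ((st j).p x)) x).re / 4 := by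
        rw [hA, Complex.re_sum, Finset.sum_div]
        exact Finset.sum_congr rfl fun j _ => by rw [Complex.re_ofReal_mul]
      have hD2 : D.im / 2 = ∑ j ∈ Finset.range J, β j * (trigChar (M j ((st j).p x)) x).im / 2 := by
        rw [hD, Complex.im_sum, Finset.sum_div]
        exact Finset.sum_congr rfl fun j _ => by rw [Complex.im_ofReal_mul]
      rw [hA2, hD2]
      nth_rewrite 1 [h2]
      rw [← Finset.sum_sub_distrib, ← Finset.sum_add_distrib]
      exact Finset.sum_congr rfl fun j _ => by ring
    rw [e2, hT, Complex.im_sum]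
    refine Finset.sum_le_sum fun j _ => ?_
    rw [Complex.im_ofReal_mul]
    exact mul_le_mul_of_nonneg_left (bit_sin _ _) (hβ j)
  rw [e]
  have h1 := Complex.abs_re_le_norm A
  have h2 := Complex.abs_im_le_norm D
  have h3 := (Complex.abs_im_le_norm T)
  have h4 : ‖T‖ ≤ ‖W + T‖ + ‖W‖ := by
    have := norm_sub_le (W + T) W
    simpa using this
  have := abs_le.1 h1
  have := abs_le.1 h2
  have := le_abs_self T.im
  have := norm_nonneg A
  have := norm_nonneg D
  linarith [abs_le.1 h1, abs_le.1 h2]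

lemma S_good (h : Chain B Q j0 st M) (hQ : 1 ≤ Q) (J : ℕ) (β : ℕ → ℝ) (hβ : ∀ j, 0 ≤ β j)
    (h8 : ∑ j ∈ Finset.range J, β j = 8) :
    mu01.real {x | ‖∑ j ∈ Finset.range J, (β j : ℂ) * VV Q j0 st M j x‖ < 1}
      ≤ 6 * ∑ j ∈ Finset.range J, β j ^ 2 + 6000 / Q := by
  have hQ0 : (0:ℝ) < Q := by exact_mod_cast hQ
  set A := fun x => ∑ j ∈ Finset.range J, (β j : ℂ) * trigChar (2 * M j ((st j).p x)) x with hA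
  set D := fun x => ∑ j ∈ Finset.range J, (β j : ℂ) * trigChar (M j ((st j).p x)) x with hD
  set W := fun x => ∑ j ∈ Finset.range J, (β j : ℂ) * WJ Q j0 st M j x with hW
  have bA : BM A := BM.sum _ fun j _ => (BM.const _).mul (Z_bm h j)
  have bD : BM D := BM.sum _ fun j _ => (BM.const _).mul (Y_bm h j)
  have bW : BM W := BM.sum _ fun j _ => (BM.const _).mul (WJ_bm h j)
  have iA : ∫ x, ‖A x‖ ^ 2 ∂mu01 ≤ ∑ j ∈ Finset.range J, β j ^ 2 + 64 / Q := by
    have := almost_orth J (fun j x => trigChar (2 * M j ((st j).p x)) x) (fun j _ => Z_bm h j) β hβ (1 / Q)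
      (by positivity) (fun a _ b hb => Z_orth h a b hb)
    simp only [tc_norm, h8] at this
    simp at this
    refine this.trans (le_of_eq ?_); norm_num; ring
  have iD : ∫ x, ‖D x‖ ^ 2 ∂mu01 ≤ ∑ j ∈ Finset.range J, β j ^ 2 + 64 / Q := by
    have := almost_orth J (fun j x => trigChar (M j ((st j).p x)) x) (fun j _ => Y_bm h j) β hβ (1 / Q)
      (by positivity) (fun a _ b hb => Y_orth h a b hb)
    simp only [tc_norm, h8] at this
    simp at this
    refine this.trans (le_of_eq ?_); norm_num; ring
  have iW : ∫ x, ‖W x‖ ^ 2 ∂mu01 ≤ 1600 / Q := by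
    have hpt : ∀ x, ‖W x‖ ^ 2 ≤ 8 * ∑ j ∈ Finset.range J, β j * ‖WJ Q j0 st M j x‖ ^ 2 := by
      intro x
      have h1 : ‖W x‖ ≤ ∑ j ∈ Finset.range J, β j * ‖WJ Q j0 st M j x‖ := by
        refine (norm_sum_le _ _).trans (Finset.sum_le_sum fun j _ => ?_)
        rw [norm_mul, Complex.norm_real, Real.norm_of_nonneg (hβ j)]
      have h2 := Finset.sum_sq_le_sum_mul_sum_of_sq_le_mul (Finset.range J)
        (f := β) (g := fun j => β j * ‖WJ Q j0 st M j x‖ ^ 2) (r := fun j => β j * ‖WJ Q j0 st M j x‖)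
        (fun j _ => hβ j) (fun j _ => mul_nonneg (hβ j) (sq_nonneg _)) (fun j _ => le_of_eq (by ring))
      rw [h8] at h2
      exact (pow_le_pow_left₀ (norm_nonneg _) h1 2).trans h2
    have hint : ∀ j ∈ Finset.range J, Integrable (fun x => β j * ‖WJ Q j0 st M j x‖ ^ 2) mu01 :=
      fun j _ => ((WJ_bm h j).sq).const_mul _
    refine (integral_mono bW.sq ((integrable_finsetSum _ hint).const_mul 8) hpt).trans ?_
    rw [integral_const_mul, integral_finsetSum _ hint]
    have : ∑ j ∈ Finset.range J, ∫ x, β j * ‖WJ Q j0 st M j x‖ ^ 2 ∂mu01 ≤ ∑ j ∈ Finset.range J, β j * (25 / Q) := by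
      refine Finset.sum_le_sum fun j _ => ?_
      rw [integral_const_mul]
      exact mul_le_mul_of_nonneg_left (h j).2.W (hβ j)
    rw [← Finset.sum_mul, h8] at this
    refine (mul_le_mul_of_nonneg_left this (by norm_num)).trans (le_of_eq ?_)
    ring
  set f := fun x => ‖A x‖ ^ 2 + ‖D x‖ ^ 2 + ‖W x‖ ^ 2 with hf
  have hfi : Integrable f mu01 := (bA.sq.add bD.sq).add bW.sq
  have hm := mul_meas_ge_le_integral_of_nonneg (μ := mu01) (f := f)
    (Eventually.of_forall fun x => by positivity) hfi (1 / 3)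
  have hsub : {x | ‖∑ j ∈ Finset.range J, (β j : ℂ) * VV Q j0 st M j x‖ < 1} ⊆ {x | 1 / 3 ≤ f x} := by
    intro x hx
    simp only [Set.mem_ofPred_eq] at hx ⊢
    have := S_lower h J β hβ h8 x
    have : 1 < ‖A x‖ + ‖D x‖ + ‖W x‖ := by simp only [hA, hD, hW]; linarith
    simp only [hf]
    nlinarith [sq_nonneg (‖A x‖ - ‖D x‖), sq_nonneg (‖A x‖ - ‖W x‖), sq_nonneg (‖D x‖ - ‖W x‖)]
  have hif : ∫ x, f x ∂mu01 = ∫ x, ‖A x‖ ^ 2 ∂mu01 + ∫ x, ‖D x‖ ^ 2 ∂mu01 + ∫ x, ‖W x‖ ^ 2 ∂mu01 := by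
    have e1 := integral_add (bA.sq.add bD.sq) bW.sq
    have e2 := integral_add bA.sq bD.sq
    simp only [Pi.add_apply] at e1
    rw [hf, e1, e2]
  have h1 := measureReal_mono (μ := mu01) hsub
  have h2 : mu01.real {x | 1 / 3 ≤ f x} ≤ 3 * ∫ x, f x ∂mu01 := by linarith
  refine h1.trans (h2.trans ?_)
  rw [hif]
  have : (6000:ℝ) / Q = 3 * (64 / Q + 64 / Q + 1600 / Q) + 816 / Q := by ring
  have : 0 ≤ 816 / (Q:ℝ) := by positivity
  linarith
end


lemma exists_sort (n0 n1 : ℕ) (K : ℕ → ℕ) : ∃ σ : ℕ → ℕ,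
    Set.BijOn σ (Set.Ioc n0 n1) (Set.Ioc n0 n1) ∧
    ∀ n m, n0 < n → n ≤ m → m ≤ n1 → K (σ n) ≤ K (σ m) := by
  let f : Fin (n1 - n0) → ℕ := fun i => K (n0 + 1 + i)
  have hf := Tuple.monotone_sort f
  let g := Tuple.sort f
  have hlt : ∀ n, n0 < n ∧ n ≤ n1 → n - n0 - 1 < n1 - n0 := fun n hn => by omega
  let σ : ℕ → ℕ := fun n => if h : n0 < n ∧ n ≤ n1 then n0 + 1 + g ⟨n - n0 - 1, hlt n h⟩ else n
  have hσ : ∀ n (h : n0 < n ∧ n ≤ n1), σ n = n0 + 1 + g ⟨n - n0 - 1, hlt n h⟩ := fun n h => dif_pos h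
  refine ⟨σ, ⟨?_, ?_, ?_⟩, ?_⟩
  · intro n hn
    rw [hσ n hn]
    have := (g ⟨n - n0 - 1, hlt n hn⟩).2
    exact ⟨by omega, by omega⟩
  · intro n hn m hm hnm
    rw [hσ n hn, hσ m hm] at hnm
    have h1 : g ⟨n - n0 - 1, hlt n hn⟩ = g ⟨m - n0 - 1, hlt m hm⟩ := Fin.ext (by omega)
    have h2 := g.injective h1
    have h3 := Fin.mk.inj h2
    have := hn.1; have := hm.1
    omega
  · intro n hn
    have hn' := hlt n hn
    have h1 := (g.symm ⟨n - n0 - 1, hn'⟩).2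
    have hm : n0 < n0 + 1 + (g.symm ⟨n - n0 - 1, hn'⟩ : ℕ) ∧ n0 + 1 + (g.symm ⟨n - n0 - 1, hn'⟩ : ℕ) ≤ n1 :=
      ⟨by omega, by omega⟩
    refine ⟨n0 + 1 + (g.symm ⟨n - n0 - 1, hn'⟩ : ℕ), hm, ?_⟩
    rw [hσ _ hm]
    have e : (⟨n0 + 1 + (g.symm ⟨n - n0 - 1, hn'⟩ : ℕ) - n0 - 1, hlt _ hm⟩ : Fin (n1 - n0))
        = g.symm ⟨n - n0 - 1, hn'⟩ := Fin.ext (by simp only []; omega)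
    rw [e, Equiv.apply_symm_apply]
    have := hn.1
    simp only []
    omega
  · intro n m h1 h2 h3
    rw [hσ n ⟨h1, by omega⟩, hσ m ⟨by omega, h3⟩]
    exact hf (show (⟨n - n0 - 1, _⟩ : Fin (n1 - n0)) ≤ ⟨m - n0 - 1, _⟩ from by
      rw [Fin.mk_le_mk]; omega)

lemma arrange {ι : Type} [DecidableEq ι] (I : Finset ι) (φ : ι → ℕ) (hφ : Set.InjOn φ I) (n0 n1 : ℕ) (h01 : n0 ≤ n1)
    (hr : ∀ i ∈ I, n0 < φ i ∧ φ i ≤ n1) (key : ι → ℕ) (val : ι → ℂ) :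
    ∃ (a : ℕ → ℂ) (σ : ℕ → ℕ), Set.BijOn σ (Set.Ioc n0 n1) (Set.Ioc n0 n1) ∧
      (∀ w : ℕ → ℝ, ∑ n ∈ Finset.Ioc n0 n1, ‖a n‖ ^ 2 * w n = ∑ i ∈ I, ‖val i‖ ^ 2 * w (φ i)) ∧
      ∀ l : ℕ, ∃ m, n0 ≤ m ∧ m ≤ n1 ∧ ∀ x, ∑ n ∈ Finset.Ioc n0 m, a (σ n) * trigChar (σ n : ℤ) x
        = ∑ i ∈ I, if key i ≤ l then val i * trigChar (φ i : ℤ) x else 0 := by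
  classical
  have hinv : ∃ r : ℕ → Option ι, (∀ i ∈ I, r (φ i) = some i) ∧ ∀ n, n ∉ I.image φ → r n = none := by
    refine ⟨fun n => if h : ∃ i ∈ I, φ i = n then some h.choose else none, ?_, ?_⟩
    · intro i hi
      have h : ∃ i' ∈ I, φ i' = φ i := ⟨i, hi, rfl⟩
      simp only [dif_pos h]
      exact congrArg some (hφ h.choose_spec.1 hi h.choose_spec.2)
    · intro n hn
      have : ¬ ∃ i ∈ I, φ i = n := by simpa using hn
      simp only [dif_neg this]
  obtain ⟨r, hr1, hr2⟩ := hinv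
  set a : ℕ → ℂ := fun n => (r n).elim 0 val with ha
  set K : ℕ → ℕ := fun n => (r n).elim 0 key with hK
  obtain ⟨σ, hσ, hmon⟩ := exists_sort n0 n1 K
  have hsub : I.image φ ⊆ Finset.Ioc n0 n1 := by
    intro n hn
    obtain ⟨i, hi, rfl⟩ := Finset.mem_image.1 hn
    exact Finset.mem_Ioc.2 (hr i hi)
  refine ⟨a, σ, hσ, ?_, ?_⟩
  · intro w
    rw [← Finset.sum_subset hsub (fun n _ hn => by simp [ha, hr2 n hn]), Finset.sum_image hφ]
    exact Finset.sum_congr rfl fun i hi => by simp [ha, hr1 i hi]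
  · intro l
    have hm : ∃ m, n0 ≤ m ∧ m ≤ n1 ∧ ∀ n, n0 < n → n ≤ n1 → (n ≤ m ↔ K (σ n) ≤ l) := by
      by_cases hall : ∃ n, n0 < n ∧ n ≤ n1 ∧ ¬ K (σ n) ≤ l
      · have hs := Nat.find_spec hall
        have hmin := fun {k} => Nat.find_min hall (m := k)
        set N := Nat.find hall
        refine ⟨N - 1, by omega, by omega, fun n h1 h2 => ⟨fun h3 => ?_, fun h3 => ?_⟩⟩
        · by_contra h4
          exact hmin (k := n) (by omega) ⟨h1, h2, h4⟩
        · by_contra h4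
          exact hs.2.2 ((hmon N n hs.1 (by omega) h2).trans h3)
      · refine ⟨n1, h01, le_rfl, fun n h1 h2 => ⟨fun _ => ?_, fun _ => h2⟩⟩
        by_contra h4; exact hall ⟨n, h1, h2, h4⟩
    obtain ⟨m, hm0, hm1, hm⟩ := hm
    refine ⟨m, hm0, hm1, fun x => ?_⟩
    have e1 : ∑ n ∈ Finset.Ioc n0 m, a (σ n) * trigChar (σ n : ℤ) x
        = ∑ n ∈ Finset.Ioc n0 n1, (fun k => if K k ≤ l then a k * trigChar (k : ℤ) x else 0) (σ n) := by
      rw [← Finset.sum_subset (Finset.Ioc_subset_Ioc_right hm1)]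
      · refine Finset.sum_congr rfl fun n hn => ?_
        rw [Finset.mem_Ioc] at hn
        simp only [if_pos ((hm n hn.1 (hn.2.trans hm1)).1 hn.2)]
      · intro n hn hn'
        rw [Finset.mem_Ioc] at hn hn'
        have : ¬ K (σ n) ≤ l := fun h => hn' ⟨hn.1, (hm n hn.1 hn.2).2 h⟩
        simp only [if_neg this]
    have e2 : ∑ n ∈ Finset.Ioc n0 n1, (fun k => if K k ≤ l then a k * trigChar (k : ℤ) x else 0) (σ n)
        = ∑ n ∈ Finset.Ioc n0 n1, if K n ≤ l then a n * trigChar (n : ℤ) x else 0 := by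
      refine Finset.sum_bij (fun n _ => σ n) ?_ ?_ ?_ ?_
      · intro n hn
        rw [Finset.mem_Ioc] at hn ⊢
        exact hσ.mapsTo hn
      · intro n hn n' hn' h
        rw [Finset.mem_Ioc] at hn hn'
        exact hσ.injOn hn hn' h
      · intro n hn
        rw [Finset.mem_Ioc] at hn
        obtain ⟨k, hk, rfl⟩ := hσ.surjOn hn
        exact ⟨k, Finset.mem_Ioc.2 hk, rfl⟩
      · intro n _; rfl
    rw [e1, e2, ← Finset.sum_subset hsub, Finset.sum_image hφ]
    · exact Finset.sum_congr rfl fun i hi => by simp [ha, hK, hr1 i hi]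
    · intro n _ hn
      simp [ha, hr2 n hn]


lemma div_geom (w : ℕ → ℝ) (hpos : ∀ n, 1 ≤ n → 0 < w n)
    (hmono : ∀ m n, 1 ≤ m → m ≤ n → w m ≤ w n)
    (hdiv : ¬ Summable (fun n : ℕ => 1 / ((n : ℝ) * w n))) (b : ℕ) (hb : 2 ≤ b) (k : ℕ) :
    ¬ Summable (fun j : ℕ => 1 / w (b ^ (j + k))) := by
  intro hs
  have hs' : Summable (fun j : ℕ => 1 / w (b ^ j)) := (summable_nat_add_iff k).1 hs
  apply hdiv
  have hb1 : 1 < b := by omega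
  refine (summable_schlomilch_iff_of_nonneg (C := b) (u := fun k => b ^ k) ?_ ?_ ?_ ?_ (by omega) ?_).1 ?_
  · intro n
    rcases Nat.eq_zero_or_pos n with rfl | hn
    · simp
    · have := hpos n hn; positivity
  · intro m n hm hmn
    have h1 := hpos m hm
    have h2 := hmono m n hm hmn
    have h3 : (0:ℝ) < m := by exact_mod_cast hm
    have h4 : (m:ℝ) ≤ n := by exact_mod_cast hmn
    exact one_div_le_one_div_of_le (by positivity) (mul_le_mul h4 h2 h1.le (by linarith))
  · intro n; positivity
  · exact pow_right_strictMono₀ hb1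
  · intro n
    simp only [smul_eq_mul]
    rw [Nat.mul_sub, ← pow_succ', ← pow_succ']
  · refine (hs'.mul_left ((b:ℝ) - 1)).congr fun j => ?_
    have h1 := hpos (b ^ j) (Nat.one_le_pow _ _ (by omega))
    have h2 : (0:ℝ) < b := by exact_mod_cast (by omega : 0 < b)
    push_cast
    field_simp
    ring

lemma exists_beta (w : ℕ → ℝ) (hpos : ∀ n, 1 ≤ n → 0 < w n)
    (hmono : ∀ m n, 1 ≤ m → m ≤ n → w m ≤ w n)
    (hdiv : ¬ Summable (fun n : ℕ => 1 / ((n : ℝ) * w n))) (b : ℕ) (hb : 2 ≤ b) (k : ℕ) (ε : ℝ) (hε : 0 < ε) :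
    ∃ (J : ℕ) (β : ℕ → ℝ), (∀ j, 0 ≤ β j) ∧ ∑ j ∈ Finset.range J, β j = 8 ∧
      ∑ j ∈ Finset.range J, β j ^ 2 ≤ ε ∧ ∑ j ∈ Finset.range J, β j ^ 2 * w (b ^ (j + k)) ≤ ε := by
  have h1 := div_geom w hpos hmono hdiv b hb k
  have hw : ∀ j, 0 < w (b ^ (j + k)) := fun j => hpos _ (Nat.one_le_pow _ _ (by omega))
  have ht := (not_summable_iff_tendsto_nat_atTop_of_nonneg (fun j => (one_div_pos.2 (hw j)).le)).1 h1
  have hw1 := hpos 1 le_rfl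
  obtain ⟨J, hJ⟩ := (ht.eventually_ge_atTop (64 / (ε * min 1 (w 1)))).exists
  have hmin : 0 < min 1 (w 1) := lt_min one_pos hw1
  set U := ∑ j ∈ Finset.range J, 1 / w (b ^ (j + k)) with hU
  have hU0 : 0 < U := lt_of_lt_of_le (by positivity) hJ
  have hU1 : 64 / U ≤ ε * min 1 (w 1) := by
    rw [div_le_iff₀ (by positivity)] at hJ ⊢
    linarith
  have hβ2 : ∑ j ∈ Finset.range J, (8 * (1 / w (b ^ (j + k))) / U) ^ 2 * w (b ^ (j + k)) = 64 / U := by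
    have : ∀ j ∈ Finset.range J, (8 * (1 / w (b ^ (j + k))) / U) ^ 2 * w (b ^ (j + k))
        = 64 / U ^ 2 * (1 / w (b ^ (j + k))) := by
      intro j _
      have := hw j
      field_simp; norm_num
    rw [Finset.sum_congr rfl this, ← Finset.mul_sum, ← hU]
    field_simp
  refine ⟨J, fun j => 8 * (1 / w (b ^ (j + k))) / U, fun j => ?_, ?_, ?_, ?_⟩
  · have := hw j; positivity
  · rw [← Finset.sum_div, ← Finset.mul_sum, ← hU]; field_simp
  · have h2 : w 1 * ∑ j ∈ Finset.range J, (8 * (1 / w (b ^ (j + k))) / U) ^ 2 ≤ 64 / U := by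
      rw [← hβ2, Finset.mul_sum]
      refine Finset.sum_le_sum fun j _ => ?_
      rw [mul_comm]
      exact mul_le_mul_of_nonneg_left (hmono _ _ le_rfl (Nat.one_le_pow _ _ (by omega))) (sq_nonneg _)
    have h3 : ε * min 1 (w 1) ≤ ε * w 1 := mul_le_mul_of_nonneg_left (min_le_right _ _) hε.le
    nlinarith
  · simp only []
    rw [hβ2]
    refine hU1.trans ?_
    nlinarith [min_le_left 1 (w 1)]

abbrev Idx := Σ _ : ℕ, Σ _ : ℕ, ℤ

lemma F_mem {st : St} {r a : ℕ} {t : ℤ} (h : t ∈ st.F r a) : t ∈ st.S a ∧ |2 * t| ≤ (r:ℤ) := by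
  obtain ⟨h1, h2⟩ := Finset.mem_filter.1 h
  refine ⟨h1, ?_⟩
  have : |2 * (t:ℝ)| ≤ r := by rw [abs_mul, abs_two]; linarith
  exact_mod_cast this

lemma block (w : ℕ → ℝ) (hpos : ∀ n, 1 ≤ n → 0 < w n)
    (hmono : ∀ m n, 1 ≤ m → m ≤ n → w m ≤ w n)
    (hdiv : ¬ Summable (fun n : ℕ => 1 / ((n : ℝ) * w n))) (n0 : ℕ) (ε : ℝ) (hε : 0 < ε) :
    ∃ n1, n0 < n1 ∧ ∃ (a : ℕ → ℂ) (σ : ℕ → ℕ), Set.BijOn σ (Set.Ioc n0 n1) (Set.Ioc n0 n1) ∧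
      ∑ n ∈ Finset.Ioc n0 n1, ‖a n‖ ^ 2 * w n ≤ ε ∧ ∃ E : Set ℝ, mu01 E ≤ ENNReal.ofReal ε ∧
        ∀ x, x ∉ E → ∃ m, n0 ≤ m ∧ m ≤ n1 ∧ 1 ≤ ‖∑ n ∈ Finset.Ioc n0 m, a (σ n) * trigChar (σ n : ℤ) x‖ := by
  obtain ⟨B, hB1, hB⟩ := exists_B
  obtain ⟨Q, hQ⟩ := exists_nat_ge (max 256 (max (10 * B) (12000 / ε)))
  have hQ256 : 256 ≤ Q := by
    have : (256:ℝ) ≤ Q := (le_max_left _ _).trans hQ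
    exact_mod_cast this
  have hQB : 10 * B ≤ Q := (le_max_left _ _).trans ((le_max_right _ _).trans hQ)
  have hQε : 12000 / ε ≤ Q := (le_max_right _ _).trans ((le_max_right _ _).trans hQ)
  have hQ0 : (0:ℝ) < Q := by exact_mod_cast (by omega : 0 < Q)
  set j0 := n0 + 1 with hj0
  obtain ⟨st, M, hc⟩ := exists_seq hB hB1 (j0 := j0) hQ256 hQB (by omega)
  have hc : Chain B Q j0 st M := hc
  set b := Q ^ 100 with hb
  have hb10 : 10 ≤ b := by
    have := Nat.le_self_pow (n := 100) (by norm_num) Q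
    omega
  have hbR : ∀ j, Q ^ (100 * (j + j0)) = b ^ (j + j0) := fun j => pow_mul _ _ _
  obtain ⟨J, β, hβ0, hβ8, hβ2, hβw⟩ := exists_beta w hpos hmono hdiv b (by omega) (j0 + 1) (ε / 12) (by positivity)
  set R : ℕ → ℕ := fun j => b ^ (j + j0) with hR
  have hRs : ∀ j, 10 * R j ≤ R (j + 1) := by
    intro j
    simp only [hR]
    rw [show j + 1 + j0 = (j + j0) + 1 by ring, pow_succ, mul_comm]
    exact Nat.mul_le_mul_left _ hb10
  have hRm : Monotone R := fun i j hij => Nat.pow_le_pow_right (by omega) (by omega)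
  have hR0 : 2 * n0 < R 0 := by
    have h1 : (2:ℕ) * 2 ^ n0 ≤ R 0 := by
      simp only [hR, hj0, zero_add]
      rw [← pow_succ']
      exact Nat.pow_le_pow_left (by omega) _
    have := Nat.lt_two_pow_self (n := n0)
    omega
  let I : Finset Idx := (Finset.range J).sigma fun j => (Finset.range (2 ^ j)).sigma fun a => (st j).F (R j) a
  let φ : Idx → ℕ := fun i => ((M i.1 i.2.1 : ℤ) + i.2.2).toNat
  let key : Idx → ℕ := fun i => (2 * i.2.1 + 1) * 2 ^ (J - (i.1 + 1))
  let val : Idx → ℂ := fun i => (β i.1 : ℂ) * (st i.1).c i.2.1 i.2.2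
  have hI : ∀ i ∈ I, i.1 < J ∧ i.2.1 < 2 ^ i.1 ∧ i.2.2 ∈ (st i.1).F (R i.1) i.2.1 := by
    intro i hi
    have h1 := Finset.mem_sigma.1 hi
    have h2 := Finset.mem_sigma.1 h1.2
    exact ⟨Finset.mem_range.1 h1.1, Finset.mem_range.1 h2.1, h2.2⟩
  have hfr : ∀ j a t, a < 2 ^ j → t ∈ (st j).F (R j) a → (n0:ℤ) < (M j a : ℤ) + t ∧ (R j : ℤ) ≤ 2 * ((M j a : ℤ) + t) ∧
      2 * ((M j a : ℤ) + t) < 5 * R j := by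
    intro j a t ha ht
    have h1 := (hc j).2.M1 a ha
    rw [hbR] at h1
    have h2 := abs_le.1 (F_mem ht).2
    have h3 := hRm (Nat.zero_le j)
    simp only [hR] at *
    generalize b ^ (j + j0) = X at *
    generalize b ^ (0 + j0) = Y at *
    omega
  have hφc : ∀ i ∈ I, ((φ i : ℕ) : ℤ) = (M i.1 i.2.1 : ℤ) + i.2.2 := by
    intro i hi
    have h1 := hI i hi
    have h2 := hfr _ _ _ h1.2.1 h1.2.2
    exact Int.toNat_of_nonneg (by omega)
  have hinj : Set.InjOn φ I := by
    intro i hi i' hi' he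
    have e : (M i.1 i.2.1 : ℤ) + i.2.2 = (M i'.1 i'.2.1 : ℤ) + i'.2.2 := by
      rw [← hφc i hi, ← hφc i' hi', he]
    obtain ⟨j, a, t⟩ := i
    obtain ⟨j', a', t'⟩ := i'
    have h1 := hI _ hi
    have h1' := hI _ hi'
    have h2 := hfr _ _ _ h1.2.1 h1.2.2
    have h2' := hfr _ _ _ h1'.2.1 h1'.2.2
    simp only at e h1 h1' h2 h2'
    have hj : j = j' := by
      rcases lt_trichotomy j j' with h | h | h
      · have g1 := hRs j
        have g2 := hRm (show j + 1 ≤ j' from h)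
        omega
      · exact h
      · have g1 := hRs j'
        have g2 := hRm (show j' + 1 ≤ j from h)
        omega
    subst hj
    have ha : a = a' := by
      rcases lt_trichotomy a a' with h | h | h
      · exact absurd e.symm ((hc j).2.dis a' h1'.2.1 a h t' (F_mem h1'.2.2).1 t (F_mem h1.2.2).1)
      · exact h
      · exact absurd e ((hc j).2.dis a h1.2.1 a' h t (F_mem h1.2.2).1 t' (F_mem h1'.2.2).1)
    subst ha
    have ht : t = t' := by omega
    subst ht
    rfl
  have hRn : n0 < R J := by
    have := hRm (Nat.zero_le J); omega
  have hφr : ∀ i ∈ I, φ i ≤ R (i.1 + 1) := by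
    intro i hi
    have h1 := hI i hi
    have h2 := hfr _ _ _ h1.2.1 h1.2.2
    have h3 := hφc i hi
    have g1 := hRs i.1
    omega
  have hφ0 : ∀ i ∈ I, n0 < φ i := by
    intro i hi
    have h1 := hI i hi
    have h2 := hfr _ _ _ h1.2.1 h1.2.2
    have h3 := hφc i hi
    omega
  obtain ⟨a, σ, hσ, hen, hseg⟩ := arrange I φ hinj n0 (R J) hRn.le
    (fun i hi => ⟨hφ0 i hi, (hφr i hi).trans (hRm (hI i hi).1)⟩) key val
  refine ⟨R J, hRn, a, σ, hσ, ?_, {x | ‖∑ j ∈ Finset.range J, (β j : ℂ) * VV Q j0 st M j x‖ < 1}, ?_, ?_⟩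
  · rw [hen]
    have h1 : ∀ i ∈ I, ‖val i‖ ^ 2 * w (φ i) ≤ β i.1 ^ 2 * w (R (i.1 + 1)) * ‖(st i.1).c i.2.1 i.2.2‖ ^ 2 := by
      intro i hi
      have : ‖val i‖ ^ 2 = β i.1 ^ 2 * ‖(st i.1).c i.2.1 i.2.2‖ ^ 2 := by
        simp only [val]
        rw [norm_mul, Complex.norm_real, mul_pow, Real.norm_eq_abs, sq_abs]
      rw [this]
      have g := hmono (φ i) (R (i.1 + 1)) (by have := hφ0 i hi; omega) (hφr i hi)
      have := mul_le_mul_of_nonneg_left g (show 0 ≤ β i.1 ^ 2 * ‖(st i.1).c i.2.1 i.2.2‖ ^ 2 by positivity)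
      linarith
    refine (Finset.sum_le_sum h1).trans ?_
    have h2 : ∑ i ∈ I, β i.1 ^ 2 * w (R (i.1 + 1)) * ‖(st i.1).c i.2.1 i.2.2‖ ^ 2
        = ∑ j ∈ Finset.range J, β j ^ 2 * w (R (j + 1)) *
          ∑ a ∈ Finset.range (2 ^ j), ∑ t ∈ (st j).F (R j) a, ‖(st j).c a t‖ ^ 2 := by
      simp only [I]
      rw [Finset.sum_sigma]
      refine Finset.sum_congr rfl fun j _ => ?_
      rw [Finset.sum_sigma]
      simp only [Finset.mul_sum]
    rw [h2]
    have h3 : ∀ j ∈ Finset.range J, β j ^ 2 * w (R (j + 1)) *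
          ∑ a ∈ Finset.range (2 ^ j), ∑ t ∈ (st j).F (R j) a, ‖(st j).c a t‖ ^ 2
        ≤ β j ^ 2 * w (b ^ (j + (j0 + 1))) := by
      intro j _
      have g : ∑ a ∈ Finset.range (2 ^ j), ∑ t ∈ (st j).F (R j) a, ‖(st j).c a t‖ ^ 2 ≤ 1 := by
        refine le_trans (Finset.sum_le_sum fun a _ => ?_) (hc j).1.en
        exact Finset.sum_le_sum_of_subset_of_nonneg (Finset.filter_subset _ _) fun _ _ _ => by positivity
      have e : R (j + 1) = b ^ (j + (j0 + 1)) := by simp only [hR]; congr 1; ring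
      rw [e]
      have := hpos (b ^ (j + (j0 + 1))) (Nat.one_le_pow _ _ (by omega))
      exact mul_le_of_le_one_right (by positivity) g
    refine (Finset.sum_le_sum h3).trans (hβw.trans ?_)
    linarith
  · have h1 := S_good hc (by omega) J β hβ0 hβ8
    rw [← ofReal_measureReal]
    refine ENNReal.ofReal_le_ofReal (h1.trans ?_)
    have : 6000 / (Q:ℝ) ≤ ε / 2 := by
      rw [div_le_iff₀ hε] at hQε
      rw [div_le_iff₀ hQ0]; linarith
    linarith
  · intro x hx
    obtain ⟨m, hm0, hm1, hm⟩ := hseg ((st J).p x)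
    refine ⟨m, hm0, hm1, ?_⟩
    rw [hm x]
    have e : ∑ i ∈ I, (if key i ≤ (st J).p x then val i * trigChar (φ i : ℤ) x else 0)
        = ∑ j ∈ Finset.range J, (β j : ℂ) * VV Q j0 st M j x := by
      have e1 : ∀ i ∈ I, (if key i ≤ (st J).p x then val i * trigChar (φ i : ℤ) x else 0)
          = if 2 * i.2.1 + 1 ≤ (st (i.1 + 1)).p x then (β i.1 : ℂ) *
            ((st i.1).c i.2.1 i.2.2 * trigChar i.2.2 x * trigChar (M i.1 i.2.1) x) else 0 := by
        intro i hi
        have h1 := p_shift hc (i.1 + 1) (J - (i.1 + 1)) x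
        rw [show i.1 + 1 + (J - (i.1 + 1)) = J by have := (hI i hi).1; omega] at h1
        have h2 : key i ≤ (st J).p x ↔ 2 * i.2.1 + 1 ≤ (st (i.1 + 1)).p x := by
          rw [← h1, Nat.le_div_iff_mul_le (by positivity)]
        rw [hφc i hi, tc_add]
        simp only [h2, val]
        split_ifs
        · ring
        · rfl
      rw [Finset.sum_congr rfl e1]
      simp only [I]
      rw [Finset.sum_sigma]
      refine Finset.sum_congr rfl fun j _ => ?_
      rw [Finset.sum_sigma, VV, Finset.mul_sum]
      refine Finset.sum_congr rfl fun a _ => ?_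
      simp only []
      split_ifs
      · rw [tp, Finset.sum_mul, Finset.mul_sum, hbR]
      · simp
    rw [e]
    exact not_lt.1 hx


/-- If `w(n)` is an increasing sequence of positive numbers with `∑ 1/(n·w(n)) = ∞`, then there
are coefficients with `∑ |a_n|² w(n) < ∞` and a permutation `σ` of the positive integers such
that the rearranged series `∑ a_{σ(n)} e^{2πiσ(n)x}` diverges almost everywhere on `𝕋 = ℝ/ℤ`. -/
theorem statement3 (w : ℕ → ℝ) (hpos : ∀ n, 1 ≤ n → 0 < w n)
    (hmono : ∀ m n, 1 ≤ m → m ≤ n → w m ≤ w n)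
    (hdiv : ¬ Summable (fun n : ℕ => 1 / ((n : ℝ) * w n))) :
    ∃ a : ℕ → ℂ, Summable (fun n : ℕ => ‖a n‖ ^ 2 * w n) ∧
      ∃ σ : ℕ → ℕ, Set.BijOn σ {n : ℕ | 1 ≤ n} {n : ℕ | 1 ≤ n} ∧
        ∀ᵐ x ∂(volume.restrict (Set.Ioc (0:ℝ) 1)),
          ¬ ∃ L : ℂ, Tendsto
            (fun m : ℕ => ∑ n ∈ Finset.Icc 1 m, a (σ n) * trigChar (σ n : ℤ) x)
            atTop (nhds L) := by
  choose n1 hn1 a σ hσ hen E hE hx using fun n0 s : ℕ =>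
    block w hpos hmono hdiv n0 ((1 / 2 : ℝ) ^ s) (by positivity)
  let N : ℕ → ℕ := fun s => Nat.rec 0 (fun s n => n1 n s) s
  have hN0 : N 0 = 0 := rfl
  have hNs : ∀ s, N (s + 1) = n1 (N s) s := fun s => rfl
  have hNm : StrictMono N := strictMono_nat_of_lt_succ fun s => by rw [hNs]; exact hn1 _ _
  have hNid : ∀ s, s ≤ N s := fun s => hNm.id_le s
  have hex : ∀ n, ∃ s, n ≤ N (s + 1) := fun n => ⟨n, (Nat.le_succ n).trans (hNid (n + 1))⟩
  let d : ℕ → ℕ := fun n => Nat.find (hex n)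
  have hd1 : ∀ n, 1 ≤ n → N (d n) < n ∧ n ≤ N (d n + 1) := by
    intro n hn
    refine ⟨?_, Nat.find_spec (hex n)⟩
    by_contra h
    have h : n ≤ N (d n) := not_lt.1 h
    rcases Nat.eq_zero_or_pos (d n) with h0 | h0
    · rw [h0, hN0] at h; omega
    · refine Nat.find_min (hex n) (m := d n - 1) (show d n - 1 < d n by omega) ?_
      rw [Nat.sub_add_cancel h0]; exact h
  have hd2 : ∀ s n, N s < n → n ≤ N (s + 1) → d n = s := by
    intro s n h1 h2
    obtain ⟨h3, h4⟩ := hd1 n (by omega)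
    rcases lt_trichotomy (d n) s with h | h | h
    · have := hNm.monotone (show d n + 1 ≤ s from h); omega
    · exact h
    · have := hNm.monotone (show s + 1 ≤ d n from h); omega
  let A : ℕ → ℂ := fun n => if n = 0 then 0 else a (N (d n)) (d n) n
  let τ : ℕ → ℕ := fun n => σ (N (d n)) (d n) n
  have hτ1 : ∀ n, 1 ≤ n → N (d n) < τ n ∧ τ n ≤ N (d n + 1) := fun n hn => by
    rw [hNs]
    exact (hσ (N (d n)) (d n)).mapsTo (show n ∈ Set.Ioc _ _ from by rw [← hNs]; exact hd1 n hn)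
  have hτd : ∀ n, 1 ≤ n → d (τ n) = d n := fun n hn => hd2 _ _ (hτ1 n hn).1 (hτ1 n hn).2
  have hA : ∀ s n, N s < n → n ≤ N (s + 1) → A n = a (N s) s n := by
    intro s n h1 h2
    simp only [A]
    rw [if_neg (by omega), hd2 s n h1 h2]
  have hτ : ∀ s n, N s < n → n ≤ N (s + 1) → τ n = σ (N s) s n := by
    intro s n h1 h2
    simp only [τ]
    rw [hd2 s n h1 h2]
  have hfn : ∀ n, 0 ≤ ‖A n‖ ^ 2 * w n := by
    intro n
    rcases Nat.eq_zero_or_pos n with rfl | hn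
    · simp [A]
    · have := hpos n hn; positivity
  refine ⟨A, ?_, τ, ⟨?_, ?_, ?_⟩, ?_⟩
  · have hblk : ∀ s, ∑ n ∈ Finset.Ioc 0 (N s), ‖A n‖ ^ 2 * w n ≤ ∑ i ∈ Finset.range s, (1 / 2 : ℝ) ^ i := by
      intro s
      induction s with
      | zero => simp [hN0]
      | succ s ih =>
        rw [← Finset.sum_Ioc_consecutive _ (Nat.zero_le (N s)) (hNm (Nat.lt_succ_self s)).le,
          Finset.sum_range_succ]
        refine add_le_add ih ?_
        refine le_trans (le_of_eq ?_) (hen (N s) s)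
        refine Finset.sum_congr rfl fun n hn => ?_
        rw [Finset.mem_Ioc] at hn
        rw [hA s n hn.1 hn.2]
    refine summable_of_sum_range_le (c := 2) hfn fun n => ?_
    have hs : Finset.range n ⊆ insert 0 (Finset.Ioc 0 (N n)) := by
      intro k hk
      have := Finset.mem_range.1 hk
      have := hNid n
      rw [Finset.mem_insert, Finset.mem_Ioc]; omega
    refine (Finset.sum_le_sum_of_subset_of_nonneg hs fun k _ _ => hfn k).trans ?_
    rw [Finset.sum_insert (by simp)]
    have h0 : ‖A 0‖ ^ 2 * w 0 = 0 := by simp [A]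
    rw [h0, zero_add]
    refine (hblk n).trans ?_
    have h1 := summable_geometric_two.sum_le_tsum (Finset.range n) (fun i _ => by positivity)
    rw [tsum_geometric_two] at h1
    exact h1
  · intro n hn
    have := (hτ1 n hn).1
    show 1 ≤ τ n
    omega
  · intro n hn m hm h
    have hnm : d n = d m := by rw [← hτd n hn, ← hτd m hm, h]
    refine (hσ (N (d n)) (d n)).injOn (show n ∈ Set.Ioc _ _ from ?_) (show m ∈ Set.Ioc _ _ from ?_) ?_
    · rw [← hNs]; exact hd1 n hn
    · rw [← hNs, hnm]; exact hd1 m hm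
    · have : σ (N (d n)) (d n) n = σ (N (d m)) (d m) m := h
      rw [← hnm] at this
      exact this
  · intro n hn
    obtain ⟨k, hk, hkn⟩ := (hσ (N (d n)) (d n)).surjOn (show n ∈ Set.Ioc _ _ from by rw [← hNs]; exact hd1 n hn)
    rw [← hNs] at hk
    refine ⟨k, ?_, ?_⟩
    · have := hk.1
      show 1 ≤ k
      omega
    · rw [hτ (d n) k hk.1 hk.2, hkn]
  · have hsum : ∑' s, mu01 (E (N s) s) ≠ ⊤ := by
      refine ne_top_of_le_ne_top ?_ (ENNReal.tsum_le_tsum fun s => hE (N s) s)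
      rw [← ENNReal.ofReal_tsum_of_nonneg (fun s => by positivity) summable_geometric_two]
      exact ENNReal.ofReal_ne_top
    have hae := ae_eventually_notMem hsum
    show ∀ᵐ x ∂mu01, _
    filter_upwards [hae] with x hxe
    rintro ⟨L, hL⟩
    have hcau := hL.cauchySeq
    obtain ⟨K, hK⟩ := Metric.cauchySeq_iff.1 hcau 1 one_pos
    obtain ⟨s, hs, hsK⟩ := (hxe.and (eventually_ge_atTop K)).exists
    obtain ⟨m, hm0, hm1, hm⟩ := hx (N s) s x hs
    have h1 := hK m (by have := hNid s; omega) (N s) (by have := hNid s; omega)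
    rw [dist_eq_norm] at h1
    have e : ∑ n ∈ Finset.Icc 1 m, A (τ n) * trigChar (τ n : ℤ) x
        - ∑ n ∈ Finset.Icc 1 (N s), A (τ n) * trigChar (τ n : ℤ) x
        = ∑ n ∈ Finset.Ioc (N s) m, a (N s) s (σ (N s) s n) * trigChar (σ (N s) s n : ℤ) x := by
      have hIcc : ∀ k, Finset.Icc 1 k = Finset.Ioc 0 k := fun k => by
        ext i; simp only [Finset.mem_Icc, Finset.mem_Ioc]; omega
      rw [hIcc, hIcc, ← Finset.sum_Ioc_consecutive _ (Nat.zero_le (N s)) hm0, add_sub_cancel_left]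
      refine Finset.sum_congr rfl fun n hn => ?_
      rw [Finset.mem_Ioc] at hn
      have hn2 : n ≤ N (s + 1) := hn.2.trans hm1
      have hdn := hd2 s n hn.1 hn2
      have ht := hτ1 n (by omega)
      rw [hdn] at ht
      rw [hA s _ ht.1 ht.2, hτ s n hn.1 hn2]
    rw [e] at h1
    linarith
end

section
/- There exist absolute constants C, c > 0 and an integer N₀ such that for every integer N > N₀ the function f(x) = (1/‖x‖)·𝟙_{B(10 N^{-9}, N^{-8})}(x) on ℝ² satisfies: (i) c·N^{-8} ≤ ‖f‖_{L¹(ℝ²)} ≤ C·N^{-8}; (ii) c·√(log N) ≤ ‖f‖_{L²(ℝ²)} ≤ C·√(log N); (iii) for every 0 < δ < N^{-10}, sup_{‖h‖<δ} ( ∫_{ℝ²} |f(x+h) − f(x)|² dx )^{1/2} ≤ C·N⁵·√δ. -/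
open MeasureTheory Real

/-- The Euclidean plane `ℝ²`. -/
noncomputable abbrev Plane := EuclideanSpace ℝ (Fin 2)

/-- Demeter's function `f(x) = ‖x‖⁻¹ 𝟙_{B(10 N⁻⁹, N⁻⁸)}(x)` (real-valued). -/
noncomputable def demeterF (N : ℕ) : Plane → ℝ := fun x =>
  if 10 * (N:ℝ) ^ (-9 : ℤ) ≤ ‖x‖ ∧ ‖x‖ < (N:ℝ) ^ (-8 : ℤ) then ‖x‖⁻¹ else 0

theorem aux_radial (a b : ℝ) (ha : 0 < a) (hab : a ≤ b) (φ : ℝ → ℝ) :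
    ∫ x : Plane, (Set.Ico a b).indicator φ ‖x‖ = 2 * π * ∫ y in a..b, y * φ y := by
  have h := integral_fun_norm_addHaar (volume : Measure Plane) ((Set.Ico a b).indicator φ)
  rw [h]
  have hv : (volume : Measure Plane).real (Metric.ball 0 1) = π := by
    simp [Measure.real, EuclideanSpace.volume_ball_fin_two, Real.pi_pos.le]
  rw [hv, intervalIntegral.integral_of_le hab, ← integral_Ico_eq_integral_Ioc]
  have : ∀ y : ℝ, y ^ (Module.finrank ℝ Plane - 1) • (Set.Ico a b).indicator φ y
      = (Set.Ico a b).indicator (fun y => y * φ y) y := by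
    intro y
    by_cases hy : y ∈ Set.Ico a b <;> simp [hy]
  simp_rw [this]
  rw [setIntegral_indicator measurableSet_Ico]
  have : Set.Ioi 0 ∩ Set.Ico a b = Set.Ico a b := by
    apply Set.inter_eq_right.2
    intro y hy
    exact ha.trans_le hy.1
  rw [this]
  simp
  ring

theorem aux_ball (r : ℝ) (hr : 0 ≤ r) : (volume : Measure Plane).real (Metric.ball 0 r) = r^2 * π := by
  simp [Measure.real, EuclideanSpace.volume_ball_fin_two, ENNReal.toReal_ofReal hr, Real.pi_pos.le]

theorem aux_ann (r d : ℝ) (hd : 0 ≤ d) (hr : d ≤ r) :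
    (volume : Measure Plane).real (Metric.ball 0 (r+d) \ Metric.ball 0 (r-d)) = 4 * π * r * d := by
  rw [measureReal_sdiff (Metric.ball_subset_ball (by linarith)) measurableSet_ball,
    aux_ball _ (by linarith), aux_ball _ (by linarith)]
  ring

/-- generic function -/
noncomputable def auxF (a b : ℝ) (x : Plane) : ℝ := if a ≤ ‖x‖ ∧ ‖x‖ < b then ‖x‖⁻¹ else 0

theorem aux_L1 (a b : ℝ) (ha : 0 < a) (hab : a ≤ b) :
    ∫ x : Plane, |auxF a b x| = 2 * π * (b - a) := by
  have : ∀ x, |auxF a b x| = (Set.Ico a b).indicator (fun y => y⁻¹) ‖x‖ := by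
    intro x
    simp only [auxF, Set.indicator, Set.mem_Ico]
    split_ifs <;> simp
  simp_rw [this]
  rw [aux_radial a b ha hab]
  congr 1
  rw [intervalIntegral.integral_congr (g := fun _ => (1:ℝ))]
  · simp
  · intro y hy
    rw [Set.uIcc_of_le hab] at hy
    exact mul_inv_cancel₀ (ha.trans_le hy.1).ne'

theorem aux_L2 (a b : ℝ) (ha : 0 < a) (hab : a ≤ b) :
    ∫ x : Plane, (auxF a b x)^2 = 2 * π * Real.log (b / a) := by
  have : ∀ x, (auxF a b x)^2 = (Set.Ico a b).indicator (fun y => (y⁻¹)^2) ‖x‖ := by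
    intro x
    simp only [auxF, Set.indicator, Set.mem_Ico]
    split_ifs <;> simp
  simp_rw [this]
  rw [aux_radial a b ha hab]
  congr 1
  rw [intervalIntegral.integral_congr (g := fun y => y⁻¹)]
  · exact integral_inv_of_pos ha (ha.trans_le hab)
  · intro y hy
    rw [Set.uIcc_of_le hab] at hy
    have := (ha.trans_le hy.1).ne'
    simp only
    field_simp

theorem aux_mod (a b d : ℝ) (ha : 0 < a) (hab : a ≤ b) (hd : 0 < d) (hda : d ≤ a) (h : Plane)
    (hh : ‖h‖ < d) :
    ∫ x : Plane, (auxF a b (x + h) - auxF a b x)^2 ≤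
      (d / a^2)^2 * (b^2 * π) + (1/a^2) * (4 * π * a * d) + (1/a^2) * (4 * π * b * d) := by
  set A : Set Plane := Metric.ball 0 b
  set B : Set Plane := Metric.ball 0 (a+d) \ Metric.ball 0 (a-d)
  set D : Set Plane := Metric.ball 0 (b+d) \ Metric.ball 0 (b-d)
  have mA : MeasurableSet A := measurableSet_ball
  have mB : MeasurableSet B := measurableSet_ball.diff measurableSet_ball
  have mD : MeasurableSet D := measurableSet_ball.diff measurableSet_ball
  have fA : volume A ≠ ⊤ := measure_ball_lt_top.ne
  have fB : volume B ≠ ⊤ := measure_ne_top_of_subset Set.sdiff_subset measure_ball_lt_top.ne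
  have fD : volume D ≠ ⊤ := measure_ne_top_of_subset Set.sdiff_subset measure_ball_lt_top.ne
  have iA : Integrable (A.indicator (fun _ : Plane => (d / a^2)^2)) :=
    (integrable_indicator_iff mA).2 (integrableOn_const fA)
  have iB : Integrable (B.indicator (fun _ : Plane => 1/a^2)) :=
    (integrable_indicator_iff mB).2 (integrableOn_const fB)
  have iD : Integrable (D.indicator (fun _ : Plane => 1/a^2)) :=
    (integrable_indicator_iff mD).2 (integrableOn_const fD)
  have key : ∫ x : Plane, (auxF a b (x + h) - auxF a b x)^2 ≤
      ∫ x : Plane, (A.indicator (fun _ : Plane => (d / a^2)^2) x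
        + B.indicator (fun _ : Plane => 1/a^2) x + D.indicator (fun _ : Plane => 1/a^2) x) := by
    apply integral_mono_of_nonneg
    · exact Filter.Eventually.of_forall fun x => sq_nonneg _
    · exact (iA.add iB).add iD
    refine Filter.Eventually.of_forall fun x => ?_
    have h1 : |‖x + h‖ - ‖x‖| ≤ ‖h‖ := by
      simpa using abs_norm_sub_norm_le (x + h) x
    have h2 := abs_le.1 h1
    have nA : 0 ≤ A.indicator (fun _ : Plane => (d / a^2)^2) x :=
      Set.indicator_nonneg (fun _ _ => by positivity) x
    have nB : 0 ≤ B.indicator (fun _ : Plane => 1/a^2) x :=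
      Set.indicator_nonneg (fun _ _ => by positivity) x
    have nD : 0 ≤ D.indicator (fun _ : Plane => 1/a^2) x :=
      Set.indicator_nonneg (fun _ _ => by positivity) x
    have inv_le : ∀ t : ℝ, a ≤ t → (t⁻¹)^2 ≤ 1/a^2 := by
      intro t ht
      rw [inv_pow, one_div]
      gcongr
    have bd : (a - d ≤ ‖x‖ ∧ ‖x‖ < a + d) ∨ (b - d ≤ ‖x‖ ∧ ‖x‖ < b + d) →
        1/a^2 ≤ A.indicator (fun _ : Plane => (d / a^2)^2) x
        + B.indicator (fun _ : Plane => 1/a^2) x + D.indicator (fun _ : Plane => 1/a^2) x := by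
      rintro (⟨u, v⟩ | ⟨u, v⟩)
      · have : x ∈ B := by simp [B, u, v]
        rw [Set.indicator_of_mem this]; linarith
      · have : x ∈ D := by simp [D, u, v]
        rw [Set.indicator_of_mem this]; linarith
    simp only [auxF]
    split_ifs with p q q
    · have : x ∈ A := by simp [A, q.2]
      rw [Set.indicator_of_mem this]
      have px := ha.trans_le q.1
      have ph := ha.trans_le p.1
      have : |‖x + h‖⁻¹ - ‖x‖⁻¹| ≤ d / a^2 := by
        rw [inv_sub_inv ph.ne' px.ne', abs_div, abs_of_pos (mul_pos ph px), sq]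
        have : |‖x‖ - ‖x+h‖| ≤ d := by rw [abs_sub_comm]; linarith
        gcongr
        · exact p.1
        · exact q.1
      have := sq_le_sq' (by linarith [(abs_le.1 this).1]) (abs_le.1 this).2
      linarith
    · rw [sub_zero]
      refine (inv_le _ p.1).trans (bd ?_)
      rw [not_and_or, not_le, not_lt] at q
      rcases q with q | q
      · left; constructor <;> linarith [p.1]
      · right; constructor <;> linarith [p.2]
    · rw [zero_sub, neg_sq]
      refine (inv_le _ q.1).trans (bd ?_)
      rw [not_and_or, not_le, not_lt] at p
      rcases p with p | p
      · left; constructor <;> linarith [q.1]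
      · right; constructor <;> linarith [q.2]
    · rw [sub_zero, zero_pow two_ne_zero]; linarith
  refine key.trans (le_of_eq ?_)
  have iAB : Integrable (fun x => A.indicator (fun _ : Plane => (d / a^2)^2) x
        + B.indicator (fun _ : Plane => 1/a^2) x) := iA.add iB
  rw [integral_add iAB iD, integral_add iA iB, integral_indicator_const _ mA,
    integral_indicator_const _ mB, integral_indicator_const _ mD, aux_ball b (by linarith),
    aux_ann a d hd.le hda, aux_ann b d hd.le (by linarith)]
  simp only [smul_eq_mul]
  ring

theorem statement5 :
    ∃ C c : ℝ, 0 < C ∧ 0 < c ∧ ∃ N₀ : ℕ, ∀ N : ℕ, N₀ < N →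
      (c * (N:ℝ) ^ (-8 : ℤ) ≤ ∫ x : Plane, |demeterF N x| ∧
        ∫ x : Plane, |demeterF N x| ≤ C * (N:ℝ) ^ (-8 : ℤ)) ∧
      (c * Real.sqrt (Real.log N) ≤ (∫ x : Plane, (demeterF N x) ^ 2) ^ ((1:ℝ)/2) ∧
        (∫ x : Plane, (demeterF N x) ^ 2) ^ ((1:ℝ)/2) ≤ C * Real.sqrt (Real.log N)) ∧
      (∀ δ : ℝ, 0 < δ → δ < (N:ℝ) ^ (-10 : ℤ) → ∀ h : Plane, ‖h‖ < δ →
        (∫ x : Plane, (demeterF N (x + h) - demeterF N x) ^ 2) ^ ((1:ℝ)/2) ≤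
          C * (N:ℝ) ^ 5 * Real.sqrt δ) := by
  refine ⟨10, 1, by norm_num, by norm_num, 100, fun N hN => ?_⟩
  have hn : (100:ℝ) < N := by exact_mod_cast hN
  have hF : demeterF N = auxF (10 * (N:ℝ) ^ (-9 : ℤ)) ((N:ℝ) ^ (-8 : ℤ)) := rfl
  rw [hF]
  generalize (N:ℝ) = n at hn
  have n0 : 0 < n := by linarith
  have ea : 10 * n ^ (-9 : ℤ) = 10 / n^9 := by
    rw [zpow_neg, div_eq_mul_inv]; norm_cast
  have eb : n ^ (-8 : ℤ) = 1 / n^8 := by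
    rw [zpow_neg, one_div]; norm_cast
  have ed : n ^ (-10 : ℤ) = 1 / n^10 := by
    rw [zpow_neg, one_div]; norm_cast
  rw [ea, eb, ed]
  have ha : 0 < 10 / n^9 := by positivity
  have hb : 0 < 1 / n^8 := by positivity
  have hab' : 10 / n^9 ≤ (1 / n^8) / 2 := by
    rw [div_div, div_le_div_iff₀ (by positivity) (by positivity)]
    have : 0 < n^8 := by positivity
    nlinarith
  have hab : 10 / n^9 ≤ 1 / n^8 := by linarith
  have p3 := Real.pi_gt_three
  have p4 := Real.pi_lt_d2
  simp only [← Real.sqrt_eq_rpow]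
  refine ⟨?_, ?_, ?_⟩
  · rw [aux_L1 _ _ ha hab]
    constructor <;> nlinarith
  · rw [aux_L2 _ _ ha hab]
    have : (1 / n^8) / (10 / n^9) = n / 10 := by field_simp
    rw [this]
    have l0 : 0 < Real.log n := Real.log_pos (by linarith)
    have l1 : Real.log (n/10) ≤ Real.log n := Real.log_le_log (by positivity) (by linarith)
    have l2 : Real.log n ≤ 2 * Real.log (n/10) := by
      rw [← Real.log_rpow (by positivity)]
      apply Real.log_le_log n0
      norm_num
      nlinarith
    constructor
    · rw [one_mul]; apply Real.sqrt_le_sqrt; nlinarith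
    · rw [Real.sqrt_le_left (by positivity), mul_pow, Real.sq_sqrt l0.le]
      nlinarith
  · intro d hd hd' h hh
    have hda : d ≤ 10 / n^9 := by
      refine hd'.le.trans ?_
      rw [div_le_div_iff₀ (by positivity) (by positivity)]
      have : 0 < n^9 := by positivity
      nlinarith
    have := aux_mod _ _ d ha hab hd hda h hh
    rw [Real.sqrt_le_left (by positivity), mul_pow, Real.sq_sqrt hd.le]
    refine this.trans ?_
    have e : (d / (10 / n^9)^2)^2 * ((1 / n^8)^2 * π) + (1/(10 / n^9)^2) * (4 * π * (10 / n^9) * d)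
      + (1/(10 / n^9)^2) * (4 * π * (1 / n^8) * d) =
       n^10 * d * π * (d * n^10 / 10000) + n^9 * d * π * (4/10) + n^10 * d * π * (4/100) := by
      field_simp
      ring
    rw [e]
    have h1 : d * n^10 ≤ 1 := by
      rw [lt_div_iff₀ (by positivity)] at hd'; exact hd'.le
    have h2 : n^9 ≤ n^10 := pow_le_pow_right₀ (by linarith) (by norm_num)
    have q : 0 < n^10 * d := by positivity
    have t1 : n^10 * d * π * (d * n^10 / 10000) ≤ n^10 * d * π * (1 / 10000) := by gcongr
    have t2 : n^9 * d * π * (4/10) ≤ n^10 * d * π * (4/10) := by gcongr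
    have t3 : n^10 * d * π ≤ n^10 * d * 4 := by gcongr; linarith
    nlinarith
end

section
/- Let p and q be coprime positive integers. Then the discrete trigonometric systems T^{(pq)} and T^{(p)} × T^{(q)} are equivalent: there exists a bijection Φ : {1,…,p}×{1,…,q} → {1,…,pq} such that for every m ≥ 1, all indices 𝐧¹,…,𝐧^m ∈ {1,…,p}×{1,…,q} and all open balls B₁,…,B_m ⊂ ℂ, the two-dimensional Lebesgue measure of { x ∈ [0,1)² : (t^{(p)}_{𝐧ʲ₁} × t^{(q)}_{𝐧ʲ₂})(x) ∈ B_j for j = 1,…,m } equals the one-dimensional Lebesgue measure of { y ∈ [0,1) : t^{(pq)}_{Φ(𝐧ʲ)}(y) ∈ B_j for j = 1,…,m }. -/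
open MeasureTheory

/-- The `n`-th function `t_n^{(l)}` of the discrete trigonometric system of order `l` on `[0,1)`:
`t_n^{(l)}(x) = ∑_{k=1}^l exp(2πi nk/l) 𝟙_{[(k-1)/l, k/l)}(x)`. -/
noncomputable def discTrig (l n : ℕ) (x : ℝ) : ℂ :=
  ∑ k ∈ Finset.Icc 1 l,
    if ((k : ℝ) - 1) / l ≤ x ∧ x < (k : ℝ) / l
      then Complex.exp (2 * Real.pi * Complex.I * (n * k) / l) else 0

noncomputable def cE (l a : ℕ) : ℂ := Complex.exp (2 * Real.pi * Complex.I * (a : ℂ) / l)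

lemma cE_add_mul (l a t : ℕ) (hl : 0 < l) : cE l (a + l * t) = cE l a := by
  unfold cE
  rw [Complex.exp_eq_exp_iff_exists_int]
  refine ⟨t, ?_⟩
  have : (l : ℂ) ≠ 0 := by exact_mod_cast hl.ne'
  push_cast
  field_simp

lemma cE_mod (l a : ℕ) (hl : 0 < l) : cE l (a % l) = cE l a := by
  conv_rhs => rw [← Nat.mod_add_div a l]
  rw [cE_add_mul l _ _ hl]

lemma cE_congr (l a b : ℕ) (hl : 0 < l) (h : a ≡ b [MOD l]) : cE l a = cE l b := by
  rw [← cE_mod l a hl, ← cE_mod l b hl, h]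

lemma cE_mul (p q a b : ℕ) (hp : 0 < p) (hq : 0 < q) :
    cE p a * cE q b = cE (p * q) (a * q + b * p) := by
  unfold cE
  rw [← Complex.exp_add]
  congr 1
  have : (p : ℂ) ≠ 0 := by exact_mod_cast hp.ne'
  have : (q : ℂ) ≠ 0 := by exact_mod_cast hq.ne'
  push_cast
  field_simp

/-- cell -/
def cell (l k : ℕ) : Set ℝ := Set.Ico ((k : ℝ) / l) (((k : ℝ) + 1) / l)

lemma mem_cell (l k : ℕ) (hl : 0 < l) (x : ℝ) :
    x ∈ cell l k ↔ 0 ≤ x ∧ ⌊(l : ℝ) * x⌋₊ = k := by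
  have hl' : (0 : ℝ) < l := by exact_mod_cast hl
  unfold cell
  rw [Set.mem_Ico, div_le_iff₀ hl', lt_div_iff₀ hl']
  constructor
  · rintro ⟨h1, h2⟩
    have hx : 0 ≤ x * l := le_trans (by positivity) h1
    have hx0 : 0 ≤ x := nonneg_of_mul_nonneg_left hx hl'
    refine ⟨hx0, ?_⟩
    rw [Nat.floor_eq_iff (by positivity), mul_comm]
    exact ⟨h1, h2⟩
  · rintro ⟨h0, h⟩
    rw [Nat.floor_eq_iff (by positivity), mul_comm] at h
    exact h

lemma floor_lt (l : ℕ) (hl : 0 < l) (x : ℝ) (hx : x ∈ Set.Ico (0:ℝ) 1) :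
    ⌊(l : ℝ) * x⌋₊ < l := by
  have hl' : (0 : ℝ) < l := by exact_mod_cast hl
  rw [Nat.floor_lt (mul_nonneg hl'.le hx.1)]
  nlinarith [hx.2]

lemma cell_sub (l k : ℕ) (hl : 0 < l) (hk : k < l) (x : ℝ) (hx : x ∈ cell l k) :
    x ∈ Set.Ico (0:ℝ) 1 := by
  have hl' : (0 : ℝ) < l := by exact_mod_cast hl
  refine ⟨((mem_cell l k hl x).1 hx).1, lt_of_lt_of_le hx.2 ?_⟩
  rw [div_le_one hl']
  exact_mod_cast hk

lemma volume_cell (l k : ℕ) : volume (cell l k) = ENNReal.ofReal (1 / l) := by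
  unfold cell
  rw [Real.volume_Ico]
  congr 1
  ring

lemma discTrig_eq (l n : ℕ) (hl : 0 < l) (x : ℝ) (hx : x ∈ Set.Ico (0:ℝ) 1) :
    discTrig l n x = cE l (n * (⌊(l : ℝ) * x⌋₊ + 1)) := by
  have hf := floor_lt l hl x hx
  unfold discTrig
  rw [Finset.sum_eq_single (⌊(l : ℝ) * x⌋₊ + 1)]
  · rw [if_pos]
    · unfold cE
      push_cast
      rfl
    · have := (mem_cell l ⌊(l : ℝ) * x⌋₊ hl x).2 ⟨hx.1, rfl⟩
      unfold cell at this
      push_cast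
      rw [add_sub_cancel_right]
      exact this
  · intro b hb hne
    rw [if_neg]
    intro h
    obtain ⟨c, rfl⟩ : ∃ c, b = c + 1 := ⟨b - 1, by have := (Finset.mem_Icc.1 hb).1; omega⟩
    push_cast at h
    rw [add_sub_cancel_right] at h
    exact hne (by rw [((mem_cell l c hl x).1 h).2])
  · intro h
    exact absurd (Finset.mem_Icc.2 ⟨by omega, by omega⟩) h

lemma volume1 (l : ℕ) (hl : 0 < l) (P : ℕ → Prop) [DecidablePred P] :
    volume {y : ℝ | y ∈ Set.Ico (0:ℝ) 1 ∧ P ⌊(l : ℝ) * y⌋₊} =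
      ((Finset.range l).filter P).card * ENNReal.ofReal (1 / l) := by
  have : {y : ℝ | y ∈ Set.Ico (0:ℝ) 1 ∧ P ⌊(l : ℝ) * y⌋₊} =
      ⋃ k ∈ (Finset.range l).filter P, cell l k := by
    ext y
    simp only [Set.mem_setOf_eq, Set.mem_iUnion, Finset.mem_filter, Finset.mem_range, exists_prop]
    constructor
    · rintro ⟨hy, h⟩
      exact ⟨_, ⟨floor_lt l hl y hy, h⟩, (mem_cell l _ hl y).2 ⟨hy.1, rfl⟩⟩
    · rintro ⟨k, ⟨hk, hP⟩, hy⟩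
      refine ⟨cell_sub l k hl hk y hy, ?_⟩
      rw [((mem_cell l k hl y).1 hy).2]
      exact hP
  rw [this, measure_biUnion_finset]
  · simp only [volume_cell, Finset.sum_const, nsmul_eq_mul]
  · intro a _ b _ hab
    refine Set.disjoint_left.2 fun x ha hb => hab ?_
    rw [← ((mem_cell l a hl x).1 ha).2, ((mem_cell l b hl x).1 hb).2]
  · intro b _
    exact measurableSet_Ico

lemma volume2 (p q : ℕ) (hp : 0 < p) (hq : 0 < q) (P : ℕ × ℕ → Prop) [DecidablePred P] :
    volume {x : ℝ × ℝ | x ∈ Set.Ico (0:ℝ) 1 ×ˢ Set.Ico (0:ℝ) 1 ∧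
        P (⌊(p : ℝ) * x.1⌋₊, ⌊(q : ℝ) * x.2⌋₊)} =
      ((Finset.range p ×ˢ Finset.range q).filter P).card *
        ENNReal.ofReal (1 / ((p * q : ℕ) : ℝ)) := by
  have : {x : ℝ × ℝ | x ∈ Set.Ico (0:ℝ) 1 ×ˢ Set.Ico (0:ℝ) 1 ∧
        P (⌊(p : ℝ) * x.1⌋₊, ⌊(q : ℝ) * x.2⌋₊)} =
      ⋃ k ∈ (Finset.range p ×ˢ Finset.range q).filter P, cell p k.1 ×ˢ cell q k.2 := by
    ext ⟨x, y⟩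
    simp only [Set.mem_setOf_eq, Set.mem_iUnion, Finset.mem_filter, Finset.mem_product,
      Finset.mem_range, exists_prop, Set.mem_prod]
    constructor
    · rintro ⟨⟨hx, hy⟩, h⟩
      exact ⟨_, ⟨⟨floor_lt p hp x hx, floor_lt q hq y hy⟩, h⟩,
        (mem_cell p _ hp x).2 ⟨hx.1, rfl⟩, (mem_cell q _ hq y).2 ⟨hy.1, rfl⟩⟩
    · rintro ⟨⟨a, b⟩, ⟨⟨ha, hb⟩, hP⟩, hx, hy⟩
      refine ⟨⟨cell_sub p a hp ha x hx, cell_sub q b hq hb y hy⟩, ?_⟩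
      rw [((mem_cell p a hp x).1 hx).2, ((mem_cell q b hq y).1 hy).2]
      exact hP
  rw [this, measure_biUnion_finset]
  · have hv : ∀ k : ℕ × ℕ, volume (cell p k.1 ×ˢ cell q k.2) =
        ENNReal.ofReal (1 / ((p * q : ℕ) : ℝ)) := by
      intro k
      rw [Measure.volume_eq_prod, Measure.prod_prod, volume_cell, volume_cell,
        ← ENNReal.ofReal_mul (by positivity)]
      congr 1
      push_cast
      rw [one_div_mul_one_div]
    simp only [hv, Finset.sum_const, nsmul_eq_mul]
  · rintro ⟨a, a'⟩ _ ⟨b, b'⟩ _ hab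
    refine Set.disjoint_left.2 fun x ha hb => hab ?_
    have h1 := ((mem_cell p a hp x.1).1 ha.1).2
    have h2 := ((mem_cell p b hp x.1).1 hb.1).2
    have h3 := ((mem_cell q a' hq x.2).1 ha.2).2
    have h4 := ((mem_cell q b' hq x.2).1 hb.2).2
    simp only [Prod.mk.injEq]
    omega
  · intro b _
    exact measurableSet_Ico.prod measurableSet_Ico

lemma card_eq (p q : ℕ) (hp : 0 < p) (hq : 0 < q) (hpq : Nat.Coprime p q)
    (P : ℕ × ℕ → Prop) [DecidablePred P] (Q : ℕ → Prop) [DecidablePred Q]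
    (h : ∀ c, Q c ↔ P (c % p, c % q)) :
    ((Finset.range p ×ˢ Finset.range q).filter P).card =
      ((Finset.range (p * q)).filter Q).card := by
  symm
  apply Finset.card_bij (fun c _ => (c % p, c % q))
  · intro c hc
    simp only [Finset.mem_filter, Finset.mem_product, Finset.mem_range] at hc ⊢
    exact ⟨⟨Nat.mod_lt _ hp, Nat.mod_lt _ hq⟩, (h c).1 hc.2⟩
  · intro a ha b hb hab
    simp only [Finset.mem_filter, Finset.mem_range, Prod.mk.injEq] at ha hb hab
    have : a ≡ b [MOD p * q] := (Nat.modEq_and_modEq_iff_modEq_mul hpq).1 hab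
    exact this.eq_of_lt_of_lt ha.1 hb.1
  · rintro ⟨a, b⟩ hab
    simp only [Finset.mem_filter, Finset.mem_product, Finset.mem_range] at hab
    obtain ⟨⟨ha, hb⟩, hP⟩ := hab
    have hc := (Nat.chineseRemainder hpq a b).2
    have hlt := Nat.chineseRemainder_lt_mul hpq a b hp.ne' hq.ne'
    have e1 : (Nat.chineseRemainder hpq a b : ℕ) % p = a := by
      have := hc.1
      rwa [Nat.ModEq, Nat.mod_eq_of_lt ha] at this
    have e2 : (Nat.chineseRemainder hpq a b : ℕ) % q = b := by
      have := hc.2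
      rwa [Nat.ModEq, Nat.mod_eq_of_lt hb] at this
    refine ⟨Nat.chineseRemainder hpq a b, ?_, ?_⟩
    · simp only [Finset.mem_filter, Finset.mem_range]
      refine ⟨hlt, (h _).2 ?_⟩
      rw [e1, e2]
      exact hP
    · rw [e1, e2]

def cPhi (p q : ℕ) (n : ℕ × ℕ) : ℕ := (n.1 * q + n.2 * p - 1) % (p * q) + 1

lemma cPhi_modEq (p q : ℕ) (n : ℕ × ℕ) (hq : 0 < q) (h : 1 ≤ n.1) :
    cPhi p q n ≡ n.1 * q + n.2 * p [MOD p * q] := by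
  unfold cPhi
  have h1 : 1 ≤ n.1 * q + n.2 * p := by nlinarith [Nat.zero_le (n.2 * p)]
  have := (Nat.mod_modEq (n.1 * q + n.2 * p - 1) (p * q)).add_right 1
  rwa [Nat.sub_add_cancel h1] at this

lemma eq_of_modEq_Icc (p a b : ℕ) (ha : a ∈ Set.Icc 1 p) (hb : b ∈ Set.Icc 1 p)
    (h : a ≡ b [MOD p]) : a = b := by
  obtain ⟨a, rfl⟩ : ∃ c, a = c + 1 := ⟨a - 1, by have := ha.1; omega⟩
  obtain ⟨b, rfl⟩ : ∃ c, b = c + 1 := ⟨b - 1, by have := hb.1; omega⟩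
  have := Nat.ModEq.eq_of_lt_of_lt (Nat.ModEq.add_right_cancel' 1 h) ha.2 hb.2
  omega

lemma cPhi_bij (p q : ℕ) (hp : 0 < p) (hq : 0 < q) (hpq : Nat.Coprime p q) :
    Set.BijOn (cPhi p q) (Set.Icc 1 p ×ˢ Set.Icc 1 q) (Set.Icc 1 (p * q)) := by
  have hm : Set.MapsTo (cPhi p q) (Set.Icc 1 p ×ˢ Set.Icc 1 q) (Set.Icc 1 (p * q)) := by
    intro n _
    exact ⟨Nat.le_add_left _ _, Nat.mod_lt _ (Nat.mul_pos hp hq)⟩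
  have hi : Set.InjOn (cPhi p q) (Set.Icc 1 p ×ˢ Set.Icc 1 q) := by
    rintro ⟨a, b⟩ ⟨ha, hb⟩ ⟨c, d⟩ ⟨hc, hd⟩ h
    have h1 := cPhi_modEq p q (a, b) hq ha.1
    have h2 := cPhi_modEq p q (c, d) hq hc.1
    rw [h] at h1
    have h3 : a * q + b * p ≡ c * q + d * p [MOD p * q] := h1.symm.trans h2
    have hP : a * q ≡ c * q [MOD p] := by
      have := h3.of_mul_right q
      simpa [Nat.ModEq] using this
    have hQ : b * p ≡ d * p [MOD q] := by
      have := h3.of_mul_left p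
      simpa [Nat.ModEq] using this
    have e1 := eq_of_modEq_Icc p a c ha hc (Nat.ModEq.cancel_right_of_coprime hpq hP)
    have e2 := eq_of_modEq_Icc q b d hb hd (Nat.ModEq.cancel_right_of_coprime hpq.symm hQ)
    rw [e1, e2]
  refine ⟨hm, hi, ?_⟩
  have := Finset.surjOn_of_injOn_of_card_le (s := Finset.Icc 1 p ×ˢ Finset.Icc 1 q)
    (t := Finset.Icc 1 (p * q)) (cPhi p q) (by simpa using hm) (by simpa using hi) (by simp)
  simpa using this

lemma prod_eq (p q : ℕ) (hp : 0 < p) (hq : 0 < q) (n : ℕ × ℕ) (h : 1 ≤ n.1) (c : ℕ) :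
    cE (p * q) (cPhi p q n * (c + 1)) =
      cE p (n.1 * (c % p + 1)) * cE q (n.2 * (c % q + 1)) := by
  rw [cE_congr p _ (n.1 * (c + 1)) hp (((Nat.mod_modEq c p).add_right 1).mul_left _),
    cE_congr q _ (n.2 * (c + 1)) hq (((Nat.mod_modEq c q).add_right 1).mul_left _),
    cE_mul p q _ _ hp hq]
  apply cE_congr _ _ _ (Nat.mul_pos hp hq)
  have := (cPhi_modEq p q n hq h).mul_right (c + 1)
  convert this using 1
  ring

/-- For coprime `p, q`, the systems `T^{(pq)}` and `T^{(p)} × T^{(q)}` are equivalent: joint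
distributions agree under a suitable bijection `Φ` of the index sets. -/
theorem statement11 (p q : ℕ) (hp : 0 < p) (hq : 0 < q) (hpq : Nat.Coprime p q) :
    ∃ Φ : ℕ × ℕ → ℕ, Set.BijOn Φ (Set.Icc 1 p ×ˢ Set.Icc 1 q) (Set.Icc 1 (p * q)) ∧
      ∀ (m : ℕ) (idx : Fin m → ℕ × ℕ) (z : Fin m → ℂ) (r : Fin m → ℝ),
        (∀ j, idx j ∈ Set.Icc 1 p ×ˢ Set.Icc 1 q) →
        volume {x : ℝ × ℝ | x ∈ Set.Ico (0:ℝ) 1 ×ˢ Set.Ico (0:ℝ) 1 ∧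
            ∀ j, discTrig p (idx j).1 x.1 * discTrig q (idx j).2 x.2 ∈ Metric.ball (z j) (r j)} =
          volume {y : ℝ | y ∈ Set.Ico (0:ℝ) 1 ∧
            ∀ j, discTrig (p * q) (Φ (idx j)) y ∈ Metric.ball (z j) (r j)} := by
  classical
  refine ⟨cPhi p q, cPhi_bij p q hp hq hpq, ?_⟩
  intro m idx z r hidx
  let P : ℕ × ℕ → Prop := fun k => ∀ j, cE p ((idx j).1 * (k.1 + 1)) * cE q ((idx j).2 * (k.2 + 1))
    ∈ Metric.ball (z j) (r j)
  let Q : ℕ → Prop := fun c => ∀ j, cE (p * q) (cPhi p q (idx j) * (c + 1)) ∈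
    Metric.ball (z j) (r j)
  have hPQ : ∀ c, Q c ↔ P (c % p, c % q) := by
    intro c
    refine forall_congr' fun j => ?_
    rw [prod_eq p q hp hq (idx j) (hidx j).1.1 c]
  have hA := volume2 p q hp hq P
  have hB := volume1 (p * q) (Nat.mul_pos hp hq) Q
  rw [← card_eq p q hp hq hpq P Q hPQ, ← hA] at hB
  convert hB.symm using 2
  · ext x
    refine and_congr_right fun hx => forall_congr' fun j => ?_
    rw [discTrig_eq p _ hp _ hx.1, discTrig_eq q _ hq _ hx.2]
  · ext y
    refine and_congr_right fun hy => forall_congr' fun j => ?_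
    rw [discTrig_eq (p * q) _ (Nat.mul_pos hp hq) _ hy]
end
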